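/- (Strichartz estimates for the vibrating plate equation) Let d ≥ 1, s ∈ ℝ with s - 2 > -d, and let (q,r) and (q̃,r̃) be admissible pairs. There is a constant C > 0, independent of the interval, such that for every interval I ⊆ [0,∞) containing 0, all u₀, u₁ ∈ 𝒮(ℝ^d) and every F ∈ 𝒮(ℝ × ℝ^d), the Duhamel solution u(t,·) := cos(tΔ)u₀ + (sin(tΔ)/Δ)u₁ + ∫₀ᵗ (sin((t-σ)Δ)/Δ) F(σ,·) dσ of the vibrating plate equation ∂ₜ²u + Δ²u = F with data u(0) = u₀, ∂ₜu(0) = u₁ satisfies ‖u‖_{L^q_I Ẇ^{s,r}} ≤ C ( ‖u₀‖_{Ḣ^s} + ‖u₁‖_{Ḣ^{s-2}} + ‖F‖_{L^{q̃'}_I Ẇ^{s-2,r̃'}} ). -/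

import Mathlib

open MeasureTheory Complex Filter
open scoped ENNReal RealInnerProductSpace

noncomputable section

/-- `d`-dimensional Euclidean space. -/
abbrev Ed (d : ℕ) := EuclideanSpace ℝ (Fin d)

/-- Fourier transform: `f̂(ξ) = ∫ e^{-i x·ξ} f(x) dx`. -/
def FT (d : ℕ) (f : Ed d → ℂ) (ξ : Ed d) : ℂ :=
  ∫ x, Complex.exp (-Complex.I * (⟪x, ξ⟫ : ℝ)) * f x

/-- Inverse Fourier transform: `(F⁻¹ g)(x) = (2π)^{-d} ∫ e^{i x·ξ} g(ξ) dξ`. -/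
def FTinv (d : ℕ) (g : Ed d → ℂ) (x : Ed d) : ℂ :=
  (((2 * Real.pi) ^ d : ℝ) : ℂ)⁻¹ * ∫ ξ, Complex.exp (Complex.I * (⟪x, ξ⟫ : ℝ)) * g ξ

/-- Bessel-type fractional differentiation `⟨D⟩^s f = F⁻¹((1+|ξ|²)^{s/2} f̂(ξ))`. -/
def besselD (d : ℕ) (s : ℝ) (f : Ed d → ℂ) : Ed d → ℂ :=
  FTinv d fun ξ => (((1 + ‖ξ‖ ^ 2) ^ (s / 2) : ℝ) : ℂ) * FT d f ξ

/-- Riesz-type fractional differentiation `|D|^s f = F⁻¹(|ξ|^s f̂(ξ))`. -/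
def rieszD (d : ℕ) (s : ℝ) (f : Ed d → ℂ) : Ed d → ℂ :=
  FTinv d fun ξ => ((‖ξ‖ ^ s : ℝ) : ℂ) * FT d f ξ

/-- Homogeneous Sobolev seminorm `‖f‖_{Ẇ^{s,r}} = ‖|D|^s f‖_{L^r}`. -/
def sobNorm (d : ℕ) (s : ℝ) (r : ℝ≥0∞) (f : Ed d → ℂ) : ℝ≥0∞ :=
  eLpNorm (rieszD d s f) r volume

/-- The propagator `sin(tΔ)/Δ f = F⁻¹(|ξ|^{-2} sin(t|ξ|²) f̂(ξ))`. -/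
def sinLapDivLap (d : ℕ) (t : ℝ) (f : Ed d → ℂ) : Ed d → ℂ :=
  FTinv d fun ξ => ((Real.sin (t * ‖ξ‖ ^ 2) / ‖ξ‖ ^ 2 : ℝ) : ℂ) * FT d f ξ

/-- The propagator `cos(tΔ) f = F⁻¹(cos(t|ξ|²) f̂(ξ))`. -/
def cosLap (d : ℕ) (t : ℝ) (f : Ed d → ℂ) : Ed d → ℂ :=
  FTinv d fun ξ => ((Real.cos (t * ‖ξ‖ ^ 2) : ℝ) : ℂ) * FT d f ξ

/-- An admissible (Schrödinger) pair: `2 ≤ q,r ≤ ∞`, `2/q + d/r = d/2`, `(q,r,d) ≠ (2,∞,2)`. -/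
def Admissible (d : ℕ) (q r : ℝ≥0∞) : Prop :=
  2 ≤ q ∧ 2 ≤ r ∧ 2 / q + d / r = d / 2 ∧ ¬(q = 2 ∧ r = ∞ ∧ d = 2)

/-- Mixed space-time norm `‖u‖_{L^q_I X} = (∫_I (g t)^q dt)^{1/q}` where `g t = ‖u(t,·)‖_X`,
with the essential supremum modification when `q = ∞`. -/
def mixedNorm (q : ℝ≥0∞) (I : Set ℝ) (g : ℝ → ℝ≥0∞) : ℝ≥0∞ :=
  if q = ∞ then essSup g (volume.restrict I)
  else (∫⁻ t in I, g t ^ q.toReal) ^ (1 / q.toReal)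

namespace Plate

open FourierTransform SchwartzMap
open scoped ComplexConjugate Topology

variable {d : ℕ}

lemma ae_eq_of_forall_schwartz {f g : Ed d → ℂ} (hf : LocallyIntegrable f) (hg : LocallyIntegrable g)
    (h : ∀ φ : 𝓢(Ed d, ℂ), ∫ x, φ x * f x = ∫ x, φ x * g x) : f =ᵐ[volume] g := by
  refine ae_eq_of_integral_contDiff_smul_eq hf hg fun φ hφ hc => ?_
  have hg₁ : HasCompactSupport (Complex.ofRealCLM ∘ φ) := hc.comp_left rfl
  have hg₂ : ContDiff ℝ (⊤ : ℕ∞) (Complex.ofRealCLM ∘ φ) := by fun_prop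
  have := h (hg₁.toSchwartzMap hg₂)
  simpa using this

lemma integral_fourier_mul {f g : Ed d → ℂ} (hf : Integrable f) (hg : Integrable g) :
    ∫ x, 𝓕 f x * g x = ∫ x, f x * 𝓕 g x := by
  have := VectorFourier.integral_fourierIntegral_smul_eq_flip (L := innerₗ (Ed d))
    Real.continuous_fourierChar continuous_inner hf hg
  simpa [Real.fourier_eq, VectorFourier.fourierIntegral, flip_innerₗ] using this

lemma continuous_fourier {f : Ed d → ℂ} (hf : Integrable f) : Continuous (𝓕 f) :=
  VectorFourier.fourierIntegral_continuous Real.continuous_fourierChar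
    (by exact continuous_inner) hf

lemma norm_fourier_le (f : Ed d → ℂ) (x : Ed d) : ‖𝓕 f x‖ ≤ ∫ y, ‖f y‖ := by
  exact VectorFourier.norm_fourierIntegral_le_integral_norm _ _ _ _ _

lemma fourierInv_eq_fourier_neg' (f : Ed d → ℂ) : 𝓕⁻ f = fun x => 𝓕 f (-x) := by
  ext x; exact Real.fourierInv_eq_fourier_neg f x

lemma continuous_fourierInv {f : Ed d → ℂ} (hf : Integrable f) : Continuous (𝓕⁻ f) := by
  rw [fourierInv_eq_fourier_neg']; exact (continuous_fourier hf).comp continuous_neg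

lemma norm_fourierInv_le (f : Ed d → ℂ) (x : Ed d) : ‖𝓕⁻ f x‖ ≤ ∫ y, ‖f y‖ := by
  rw [fourierInv_eq_fourier_neg']; exact norm_fourier_le _ _

lemma integral_fourierInv_mul {f g : Ed d → ℂ} (hf : Integrable f) (hg : Integrable g) :
    ∫ x, 𝓕⁻ f x * g x = ∫ x, f x * 𝓕⁻ g x := by
  have h1 : ∀ x, 𝓕⁻ g x = 𝓕 (fun y => g (-y)) x := fun x => by
    rw [Real.fourierInv_eq_fourier_comp_neg]
  simp only [h1]
  rw [← integral_fourier_mul hf hg.comp_neg, ← integral_neg_eq_self]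
  simp [fourierInv_eq_fourier_neg']

lemma fourier_toLp_ae {g : Ed d → ℂ} (h1 : Integrable g) (h2 : MemLp g 2) :
    (𝓕 (h2.toLp g) : Lp ℂ 2 (volume : Measure (Ed d))) =ᵐ[volume] 𝓕 g := by
  refine ae_eq_of_forall_schwartz ((Lp.memLp _).locallyIntegrable (by norm_num))
    (continuous_fourier h1).locallyIntegrable fun φ => ?_
  have h := congrArg (fun T => T φ) (Lp.fourier_toTemperedDistribution_eq (h2.toLp g))
  simp only [TemperedDistribution.fourier_apply, Lp.toTemperedDistribution_apply, smul_eq_mul] at h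
  rw [← h, ← integral_fourier_mul φ.integrable h1]
  refine integral_congr_ae ?_
  filter_upwards [h2.coeFn_toLp] with x hx
  rw [hx, SchwartzMap.fourier_coe]

lemma fourier_toLp_fourierInv_ae {k : Ed d → ℂ} (h1 : Integrable k) (h2 : MemLp (𝓕⁻ k) 2) :
    (𝓕 (h2.toLp (𝓕⁻ k)) : Lp ℂ 2 (volume : Measure (Ed d))) =ᵐ[volume] k := by
  refine ae_eq_of_forall_schwartz ((Lp.memLp _).locallyIntegrable (by norm_num))
    h1.locallyIntegrable fun φ => ?_
  have h := congrArg (fun T => T φ) (Lp.fourier_toTemperedDistribution_eq (h2.toLp (𝓕⁻ k)))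
  simp only [TemperedDistribution.fourier_apply, Lp.toTemperedDistribution_apply, smul_eq_mul] at h
  rw [← h]
  have h3 : ∫ x, (𝓕 φ : 𝓢(Ed d, ℂ)) x * (h2.toLp (𝓕⁻ k)) x = ∫ x, (𝓕 φ : 𝓢(Ed d, ℂ)) x * 𝓕⁻ k x := by
    refine integral_congr_ae ?_
    filter_upwards [h2.coeFn_toLp] with x hx
    rw [hx]
  rw [h3]
  have h4 := integral_fourierInv_mul (𝓕 φ : 𝓢(Ed d, ℂ)).integrable h1
  rw [← h4]
  have : ∀ x, 𝓕⁻ (⇑(𝓕 φ : 𝓢(Ed d, ℂ))) x = φ x := fun x => by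
    rw [← SchwartzMap.fourierInv_coe, fourierInv_fourier_eq]
  simp [this]

lemma eLpNorm_fourier {g : Ed d → ℂ} (h1 : Integrable g) (h2 : MemLp g 2) :
    eLpNorm (𝓕 g) 2 volume = eLpNorm g 2 volume := by
  rw [← eLpNorm_congr_ae (fourier_toLp_ae h1 h2), ← eLpNorm_congr_ae h2.coeFn_toLp,
    ← Lp.enorm_def, ← Lp.enorm_def]
  have := Lp.norm_fourier_eq (h2.toLp g)
  rw [← ofReal_norm, this, ofReal_norm]

lemma eLpNorm_fourier_sub {g k : Ed d → ℂ} (h1 : Integrable g) (h2 : MemLp g 2)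
    (hk1 : Integrable k) (hk2 : MemLp (𝓕⁻ k) 2) :
    eLpNorm (𝓕 g - k) 2 volume = eLpNorm (g - 𝓕⁻ k) 2 volume := by
  have e1 : 𝓕 g - k =ᵐ[volume] ↑↑(𝓕 (h2.toLp g - hk2.toLp (𝓕⁻ k)) :
      Lp ℂ 2 (volume : Measure (Ed d))) := by
    have : (𝓕 (h2.toLp g - hk2.toLp (𝓕⁻ k)) : Lp ℂ 2 (volume : Measure (Ed d)))
      = 𝓕 (h2.toLp g) - 𝓕 (hk2.toLp (𝓕⁻ k)) := by
        exact map_sub (Lp.fourierTransformₗᵢ (Ed d) ℂ) _ _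
    rw [this]
    filter_upwards [fourier_toLp_ae h1 h2, fourier_toLp_fourierInv_ae hk1 hk2,
      Lp.coeFn_sub (𝓕 (h2.toLp g)) (𝓕 (hk2.toLp (𝓕⁻ k)))] with x a b c
    rw [c, Pi.sub_apply, Pi.sub_apply, a, b]
  rw [eLpNorm_congr_ae e1, ← Lp.enorm_def]
  have := Lp.norm_fourier_eq (h2.toLp g - hk2.toLp (𝓕⁻ k))
  rw [← ofReal_norm, this, ofReal_norm, ← MemLp.toLp_sub, Lp.enorm_toLp]

lemma eLpNorm_le_fourierInv {k : Ed d → ℂ} (h1 : Integrable k) :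
    eLpNorm k 2 volume ≤ eLpNorm (𝓕⁻ k) 2 volume := by
  by_cases h : eLpNorm (𝓕⁻ k) 2 volume = ∞
  · rw [h]; exact le_top
  have h2 : MemLp (𝓕⁻ k) 2 :=
    ⟨(continuous_fourierInv h1).aestronglyMeasurable, lt_top_iff_ne_top.2 h⟩
  rw [← eLpNorm_congr_ae (fourier_toLp_fourierInv_ae h1 h2), ← eLpNorm_congr_ae h2.coeFn_toLp,
    ← Lp.enorm_def, ← Lp.enorm_def]
  have := Lp.norm_fourier_eq (h2.toLp (𝓕⁻ k))
  rw [← ofReal_norm, this, ofReal_norm]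

lemma eLpNorm_two_le_of_bound {α : Type*} [MeasurableSpace α] {μ : Measure α} {f : α → ℂ} {M p : ℝ}
    (hf : ∀ x, ‖f x‖ ≤ M) (hp : 0 < p) (hp2 : p ≤ 2) :
    eLpNorm f 2 μ ≤ ENNReal.ofReal M ^ (1 - p / 2) * eLpNorm f (ENNReal.ofReal p) μ ^ (p / 2) := by
  have hp0 : ENNReal.ofReal p ≠ 0 := by simpa using hp
  rw [eLpNorm_eq_lintegral_rpow_enorm_toReal (by norm_num) (by norm_num),
    eLpNorm_eq_lintegral_rpow_enorm_toReal hp0 ENNReal.ofReal_ne_top, ENNReal.toReal_ofReal hp.le,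
    ← ENNReal.rpow_mul, ENNReal.toReal_ofNat]
  have e1 : 1 / p * (p / 2) = 1 / 2 := by field_simp
  have e2 : 1 - p / 2 = (2 - p) * (1 / 2) := by ring
  rw [e1, e2, ENNReal.rpow_mul, ← ENNReal.mul_rpow_of_nonneg _ _ (by norm_num)]
  refine ENNReal.rpow_le_rpow ?_ (by norm_num)
  rw [← lintegral_const_mul' _ _ (by simp [ENNReal.rpow_eq_top_iff, hp2])]
  refine lintegral_mono fun x => ?_
  have : ‖f x‖ₑ ^ (2 : ℝ) = ‖f x‖ₑ ^ (2 - p) * ‖f x‖ₑ ^ p := by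
    rw [← ENNReal.rpow_add_of_nonneg _ _ (by linarith) hp.le]; ring_nf
  rw [this]
  gcongr
  rw [← ofReal_norm]; exact ENNReal.ofReal_le_ofReal (hf x)

lemma fourier_fourierInv_ae {k : Ed d → ℂ} (h1 : Integrable k) (h2 : Integrable (𝓕⁻ k)) :
    𝓕 (𝓕⁻ k) =ᵐ[volume] k := by
  have h3 : MemLp (𝓕⁻ k) 2 := by
    refine ⟨h2.1, (eLpNorm_two_le_of_bound (p := 1) (norm_fourierInv_le k) one_pos one_le_two).trans_lt ?_⟩
    have := (memLp_one_iff_integrable.2 h2).2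
    refine ENNReal.mul_lt_top (ENNReal.rpow_lt_top_of_nonneg (by norm_num) ENNReal.ofReal_ne_top) ?_
    exact ENNReal.rpow_lt_top_of_nonneg (by norm_num) (by simpa using this.ne)
  exact (fourier_toLp_ae h2 h3).symm.trans (fourier_toLp_fourierInv_ae h1 h3)

lemma conj_fourier (h : Ed d → ℂ) (η : Ed d) : conj (𝓕 h η) = 𝓕 (fun x => conj (h (-x))) η := by
  rw [Real.fourier_eq', Real.fourier_eq', ← integral_conj, ← integral_neg_eq_self]
  refine integral_congr_ae (ae_of_all _ fun x => ?_)
  simp only [smul_eq_mul, map_mul, ← Complex.exp_conj, inner_neg_left]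
  congr 2
  simp only [conj_ofReal, conj_I]
  push_cast
  ring

/-- The sesquilinear form of the Schrödinger propagator, on the Fourier side. -/
def propForm (τ : ℝ) (g h : Ed d → ℂ) : ℂ :=
  ∫ η, cexp (I * (τ * ‖η‖ ^ 2 : ℝ)) * (𝓕 g η * conj (𝓕 h η))

lemma integrable_fourier_mul_conj {g h : Ed d → ℂ} (g1 : Integrable g) (g2 : MemLp g 2)
    (h1 : Integrable h) (h2 : MemLp h 2) : Integrable fun η => 𝓕 g η * conj (𝓕 h η) := by
  have a : MemLp (𝓕 g) 2 := ⟨(continuous_fourier g1).aestronglyMeasurable, by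
    rw [eLpNorm_fourier g1 g2]; exact g2.2⟩
  have b : MemLp (𝓕 h) 2 := ⟨(continuous_fourier h1).aestronglyMeasurable, by
    rw [eLpNorm_fourier h1 h2]; exact h2.2⟩
  exact a.integrable_mul b.star

lemma enorm_integral_mul_le {α : Type*} [MeasurableSpace α] {μ : Measure α} {f g : α → ℂ}
    (hf : AEStronglyMeasurable f μ) (hg : AEStronglyMeasurable g μ) :
    ∫⁻ x, ‖f x‖ₑ * ‖g x‖ₑ ∂μ ≤ eLpNorm f 2 μ * eLpNorm g 2 μ := by
  rw [eLpNorm_eq_lintegral_rpow_enorm_toReal (by norm_num) (by norm_num),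
    eLpNorm_eq_lintegral_rpow_enorm_toReal (by norm_num) (by norm_num), ENNReal.toReal_ofNat]
  exact ENNReal.lintegral_mul_le_Lp_mul_Lq μ Real.HolderConjugate.two_two hf.enorm hg.enorm

lemma norm_exp_I_mul (x : ℝ) : ‖cexp (I * (x : ℝ))‖ = 1 := by
  rw [mul_comm]; exact norm_exp_ofReal_mul_I x

lemma enorm_exp_I_mul (x : ℝ) : ‖cexp (I * (x : ℝ))‖ₑ = 1 := by
  rw [← ofReal_norm, norm_exp_I_mul]; simp

lemma enorm_propForm_le_energy (τ : ℝ) {g h : Ed d → ℂ} (g1 : Integrable g) (g2 : MemLp g 2)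
    (h1 : Integrable h) (h2 : MemLp h 2) :
    ‖propForm τ g h‖ₑ ≤ eLpNorm g 2 volume * eLpNorm h 2 volume := by
  rw [← eLpNorm_fourier g1 g2, ← eLpNorm_fourier h1 h2]
  refine (enorm_integral_le_lintegral_enorm _).trans ?_
  refine le_trans (le_of_eq ?_) (enorm_integral_mul_le (continuous_fourier g1).aestronglyMeasurable
    (continuous_fourier h1).aestronglyMeasurable)
  refine lintegral_congr fun x => ?_
  rw [enorm_mul, enorm_mul, enorm_exp_I_mul, one_mul, RCLike.enorm_conj]

lemma norm_gaussian_fourier_le {b : ℂ} (hb : 0 < b.re) (x w : Ed d) :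
    ‖𝓕 (fun v : Ed d => cexp (-b * ‖v‖ ^ 2 + 2 * Real.pi * I * ⟪x, v⟫)) w‖
      ≤ (Real.pi / ‖b‖) ^ ((d : ℝ) / 2) := by
  rw [fourier_gaussian_innerProductSpace' hb, norm_mul]
  have hb0 : b ≠ 0 := fun h => by simp [h] at hb
  have e1 : ((Module.finrank ℝ (Ed d) : ℂ) / 2) = (((d : ℝ) / 2 : ℝ) : ℂ) := by simp
  have e2 : ‖((Real.pi : ℂ) / b) ^ ((Module.finrank ℝ (Ed d) : ℂ) / 2)‖
      = (Real.pi / ‖b‖) ^ ((d : ℝ) / 2) := by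
    rw [e1, Complex.norm_cpow_of_ne_zero (div_ne_zero (by simp [Real.pi_ne_zero]) hb0)]
    simp [abs_of_pos Real.pi_pos]
  have e3 : ‖cexp (-Real.pi ^ 2 * ‖x - w‖ ^ 2 / b)‖ ≤ 1 := by
    rw [Complex.norm_exp, Real.exp_le_one_iff]
    have : (-(Real.pi : ℂ) ^ 2 * ‖x - w‖ ^ 2 / b) = ((-(Real.pi ^ 2 * ‖x - w‖ ^ 2) : ℝ) : ℂ) * b⁻¹ := by
      push_cast; ring
    rw [this, Complex.re_ofReal_mul, Complex.inv_re]
    have : 0 ≤ b.re / normSq b := div_nonneg hb.le (normSq_nonneg _)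
    have h2 : 0 ≤ (Real.pi ^ 2 * ‖x - w‖ ^ 2) := by positivity
    nlinarith [mul_nonneg h2 this]
  rw [e2]
  exact mul_le_of_le_one_right (by positivity) e3

lemma norm_regularized_le {b : ℂ} (hb : 0 < b.re) {g h : Ed d → ℂ} (g1 : Integrable g)
    (h1 : Integrable h) :
    ‖∫ η, cexp (-b * ‖η‖ ^ 2) * (𝓕 g η * conj (𝓕 h η))‖
      ≤ (Real.pi / ‖b‖) ^ ((d : ℝ) / 2) * (∫ x, ‖g x‖) * ∫ x, ‖h x‖ := by
  set A := (Real.pi / ‖b‖) ^ ((d : ℝ) / 2) with hA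
  have hA0 : 0 ≤ A := by positivity
  set h' : Ed d → ℂ := fun x => conj (h (-x)) with hh'
  have h1' : Integrable h' := by
    exact Complex.conjLIE.integrable_comp_iff.2 h1.comp_neg
  have hgauss := GaussianFourier.integrable_cexp_neg_mul_sq_norm_add (V := Ed d) hb 0 0
  simp only [zero_mul, add_zero] at hgauss
  have hk : Integrable fun η => cexp (-b * ‖η‖ ^ 2) * 𝓕 h' η :=
    hgauss.mul_bdd (continuous_fourier h1').aestronglyMeasurable (ae_of_all _ (norm_fourier_le h'))
  have e1 : ∫ η, cexp (-b * ‖η‖ ^ 2) * (𝓕 g η * conj (𝓕 h η))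
      = ∫ y, g y * 𝓕 (fun η => cexp (-b * ‖η‖ ^ 2) * 𝓕 h' η) y := by
    rw [← integral_fourier_mul g1 hk]
    refine integral_congr_ae (ae_of_all _ fun η => ?_)
    simp only [conj_fourier h η]; ring
  have hnorm : ∫ x, ‖h' x‖ = ∫ x, ‖h x‖ := by
    simp only [hh', RCLike.norm_conj]; exact integral_neg_eq_self (fun x => ‖h x‖) volume
  have e2 : ∀ y, ‖𝓕 (fun η => cexp (-b * ‖η‖ ^ 2) * 𝓕 h' η) y‖ ≤ A * ∫ x, ‖h x‖ := by
    intro y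
    have hi := GaussianFourier.integrable_cexp_neg_mul_sq_norm_add (V := Ed d) hb
      (2 * Real.pi * I) (-y)
    have : 𝓕 (fun η => cexp (-b * ‖η‖ ^ 2) * 𝓕 h' η) y
        = ∫ x, h' x * 𝓕 (fun v : Ed d => cexp (-b * ‖v‖ ^ 2 + 2 * Real.pi * I * ⟪-y, v⟫)) x := by
      rw [← integral_fourier_mul h1' hi, Real.fourier_eq']
      refine integral_congr_ae (ae_of_all _ fun η => ?_)
      simp only [smul_eq_mul, Complex.exp_add]
      have : cexp (↑(-2 * Real.pi * ⟪η, y⟫) * I) = cexp (2 * Real.pi * I * ⟪-y, η⟫) := by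
        congr 1; rw [inner_neg_left, real_inner_comm]; push_cast; ring
      rw [this]; ring
    rw [this, ← hnorm, ← integral_const_mul]
    refine norm_integral_le_of_norm_le (h1'.norm.const_mul A) (ae_of_all _ fun x => ?_)
    rw [norm_mul, mul_comm]
    exact mul_le_mul_of_nonneg_right (norm_gaussian_fourier_le hb _ _) (norm_nonneg _)
  rw [e1]
  have : A * (∫ x, ‖g x‖) * ∫ x, ‖h x‖ = ∫ x, ‖g x‖ * (A * ∫ x, ‖h x‖) := by
    rw [integral_mul_const]; ring
  rw [this]
  refine norm_integral_le_of_norm_le (g1.norm.mul_const _) (ae_of_all _ fun x => ?_)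
  rw [norm_mul]
  exact mul_le_mul_of_nonneg_left (e2 x) (norm_nonneg _)

lemma norm_propForm_le_dispersive {τ : ℝ} (hτ : τ ≠ 0) {g h : Ed d → ℂ} (g1 : Integrable g)
    (g2 : MemLp g 2) (h1 : Integrable h) (h2 : MemLp h 2) :
    ‖propForm τ g h‖ ≤ (Real.pi / |τ|) ^ ((d : ℝ) / 2) * (∫ x, ‖g x‖) * ∫ x, ‖h x‖ := by
  have hint := integrable_fourier_mul_conj g1 g2 h1 h2
  let b : ℕ → ℂ := fun n => ((1 / ((n : ℝ) + 1) : ℝ) : ℂ) - I * τ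
  have hbre : ∀ n, (b n).re = 1 / ((n : ℝ) + 1) := fun n => by
    simp only [b, sub_re, ofReal_re, mul_re, I_re, I_im, ofReal_im]; ring
  have hbim : ∀ n, (b n).im = -τ := fun n => by simp [b]
  have hb : ∀ n, 0 < (b n).re := fun n => by rw [hbre]; positivity
  have hlim : Tendsto (fun n => ∫ η, cexp (-b n * ‖η‖ ^ 2) * (𝓕 g η * conj (𝓕 h η))) atTop
      (𝓝 (propForm τ g h)) := by
    refine tendsto_integral_of_dominated_convergence (fun η => ‖𝓕 g η * conj (𝓕 h η)‖) ?_
      hint.norm ?_ ?_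
    · intro n
      refine AEStronglyMeasurable.mul ?_ hint.1
      exact Continuous.aestronglyMeasurable (by fun_prop)
    · intro n
      refine ae_of_all _ fun η => ?_
      rw [norm_mul]
      refine mul_le_of_le_one_left (norm_nonneg _) ?_
      rw [Complex.norm_exp, Real.exp_le_one_iff]
      have : (-b n * (‖η‖ : ℂ) ^ 2).re = -((b n).re * ‖η‖ ^ 2) := by
        have : -b n * (‖η‖ : ℂ) ^ 2 = ((‖η‖ ^ 2 : ℝ) : ℂ) * (-b n) := by push_cast; ring
        rw [this, Complex.re_ofReal_mul]; simp; ring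
      rw [this, neg_nonpos]
      exact mul_nonneg (hb n).le (sq_nonneg _)
    · refine ae_of_all _ fun η => ?_
      refine Tendsto.mul_const _ ?_
      have : Tendsto b atTop (𝓝 (((0 : ℝ) : ℂ) - I * τ)) :=
        ((continuous_ofReal.tendsto _).comp tendsto_one_div_add_atTop_nhds_zero_nat).sub_const _
      have h3 := (((this.neg).mul_const ((‖η‖ : ℂ) ^ 2))).cexp
      convert h3 using 2
      push_cast; ring_nf
  refine le_of_tendsto hlim.norm (Eventually.of_forall fun n => ?_)
  refine (norm_regularized_le (hb n) g1 h1).trans ?_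
  have : |τ| ≤ ‖b n‖ := by rw [← abs_neg, ← hbim n]; exact Complex.abs_im_le_norm _
  have h0 : 0 < |τ| := abs_pos.2 hτ
  gcongr

lemma enorm_propForm_le_dispersive {τ : ℝ} (hτ : τ ≠ 0) {g h : Ed d → ℂ} (g1 : Integrable g)
    (g2 : MemLp g 2) (h1 : Integrable h) (h2 : MemLp h 2) :
    ‖propForm τ g h‖ₑ ≤
      ENNReal.ofReal ((Real.pi / |τ|) ^ ((d : ℝ) / 2)) * eLpNorm g 1 volume * eLpNorm h 1 volume := by
  rw [eLpNorm_one_eq_lintegral_enorm, eLpNorm_one_eq_lintegral_enorm,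
    ← ofReal_integral_norm_eq_lintegral_enorm g1, ← ofReal_integral_norm_eq_lintegral_enorm h1,
    ← ENNReal.ofReal_mul (by positivity), ← ENNReal.ofReal_mul (by positivity), ← ofReal_norm]
  exact ENNReal.ofReal_le_ofReal (norm_propForm_le_dispersive hτ g1 g2 h1 h2)

end Plate

namespace Plate

open FourierTransform
open scoped ComplexConjugate Topology

variable {d : ℕ}

lemma two_rpow_ne_top (x : ℝ) : (2 : ℝ≥0∞) ^ x ≠ ∞ := by simp [ENNReal.rpow_eq_top_iff]

lemma two_rpow_add (x y : ℝ) : (2 : ℝ≥0∞) ^ (x + y) = 2 ^ x * 2 ^ y :=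
  ENNReal.rpow_add _ _ (by norm_num) (by norm_num)

lemma two_rpow_le {x y : ℝ} (h : x ≤ y) : (2 : ℝ≥0∞) ^ x ≤ 2 ^ y :=
  ENNReal.rpow_le_rpow_of_exponent_le (by norm_num) h

lemma exists_tsum_abs_add_le {c : ℝ} (hc : 0 < c) :
    ∃ C : ℝ≥0∞, C ≠ ∞ ∧ ∀ x : ℝ, ∑' k : ℤ, (2 : ℝ≥0∞) ^ (-(c * |k + x|)) ≤ C := by
  have hsum : Summable fun k : ℤ => (2 : ℝ) ^ (-(c * |(k : ℝ)|)) := by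
    have hg : Summable fun n : ℕ => ((2 : ℝ) ^ (-c)) ^ n :=
      summable_geometric_of_lt_one (by positivity)
        (Real.rpow_lt_one_of_one_lt_of_neg (by norm_num) (by linarith))
    have e : ∀ n : ℕ, (2 : ℝ) ^ (-(c * |(n : ℝ)|)) = ((2 : ℝ) ^ (-c)) ^ n := fun n => by
      rw [← Real.rpow_natCast, ← Real.rpow_mul (by norm_num), abs_of_nonneg (by positivity)]
      ring_nf
    rw [summable_int_iff_summable_nat_and_neg]
    constructor
    · simpa only [Int.cast_natCast, e] using hg
    · simpa only [Int.cast_neg, abs_neg, Int.cast_natCast, e] using hg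
  have hS : ∑' k : ℤ, (2 : ℝ≥0∞) ^ (-(c * |(k : ℝ)|)) ≠ ∞ := by
    have e : ∀ k : ℤ, (2 : ℝ≥0∞) ^ (-(c * |(k : ℝ)|))
        = ENNReal.ofReal ((2 : ℝ) ^ (-(c * |(k : ℝ)|))) := fun k => by
      rw [← ENNReal.ofReal_rpow_of_pos (by norm_num)]; simp
    simp_rw [e]
    rw [← ENNReal.ofReal_tsum_of_nonneg (fun _ => by positivity) hsum]
    exact ENNReal.ofReal_ne_top
  refine ⟨2 ^ c * ∑' k : ℤ, (2 : ℝ≥0∞) ^ (-(c * |(k : ℝ)|)),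
    ENNReal.mul_ne_top (two_rpow_ne_top _) hS, fun x => ?_⟩
  rw [← ENNReal.tsum_mul_left,
    ← (Equiv.addRight ⌊x⌋).tsum_eq (fun k : ℤ => (2 : ℝ≥0∞) ^ c * 2 ^ (-(c * |(k : ℝ)|)))]
  refine ENNReal.tsum_le_tsum fun k => ?_
  rw [← two_rpow_add]
  refine two_rpow_le ?_
  have h1 := Int.floor_le x
  have h2 := Int.lt_floor_add_one x
  have h3 : |((k + ⌊x⌋ : ℤ) : ℝ)| ≤ |k + x| + 1 := by
    push_cast
    have : (k : ℝ) + ⌊x⌋ = (k + x) - (x - ⌊x⌋) := by ring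
    rw [this]
    refine (abs_sub _ _).trans ?_
    have : |x - ⌊x⌋| ≤ 1 := abs_le.2 ⟨by linarith, by linarith⟩
    linarith
  simp only [Equiv.coe_addRight]
  nlinarith

lemma exists_tsum_abs_mul_add_le {c a : ℝ} (hc : 0 < c) (ha : 0 < a) :
    ∃ C : ℝ≥0∞, C ≠ ∞ ∧ ∀ x : ℝ, ∑' k : ℤ, (2 : ℝ≥0∞) ^ (-(c * |k * a + x|)) ≤ C := by
  obtain ⟨C, hC, h⟩ := exists_tsum_abs_add_le (mul_pos hc ha)
  refine ⟨C, hC, fun x => le_trans (le_of_eq ?_) (h (x / a))⟩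
  congr 1; ext k
  have : (k : ℝ) * a + x = a * (k + x / a) := by field_simp
  rw [this, abs_mul, abs_of_pos ha, mul_assoc]

/-- Schur's test with square-root weights. -/
lemma tsum_weight_le {ι κ : Type*} [Countable ι] [Countable κ] {w : ι → κ → ℝ≥0∞} {a : ι → ℝ≥0∞}
    {b : κ → ℝ≥0∞} {C : ℝ≥0∞} (h1 : ∀ i, ∑' j, w i j ≤ C) (h2 : ∀ j, ∑' i, w i j ≤ C) :
    ∑' i, ∑' j, w i j * (a i ^ (1 / 2 : ℝ) * b j ^ (1 / 2 : ℝ))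
      ≤ C * ((∑' i, a i) ^ (1 / 2 : ℝ) * (∑' j, b j) ^ (1 / 2 : ℝ)) := by
  let _ : MeasurableSpace (ι × κ) := ⊤
  have key := ENNReal.lintegral_mul_le_Lp_mul_Lq (Measure.count : Measure (ι × κ))
    Real.HolderConjugate.two_two (f := fun x => (w x.1 x.2 * a x.1) ^ (1 / 2 : ℝ))
    (g := fun x => (w x.1 x.2 * b x.2) ^ (1 / 2 : ℝ)) (measurable_of_countable _).aemeasurable
    (measurable_of_countable _).aemeasurable
  simp only [lintegral_count, Pi.mul_apply] at key
  have e : ∀ x : ℝ≥0∞, (x ^ (1 / 2 : ℝ)) ^ (2 : ℝ) = x := fun x => by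
    rw [← ENNReal.rpow_mul]; norm_num
  simp only [e] at key
  have e3 : ∀ x : ℝ≥0∞, x ^ (1 / 2 : ℝ) * x ^ (1 / 2 : ℝ) = x := fun x => by
    rw [← ENNReal.rpow_add_of_nonneg _ _ (by norm_num) (by norm_num)]; norm_num
  have e2 : ∀ x : ι × κ, (w x.1 x.2 * a x.1) ^ (1 / 2 : ℝ) * (w x.1 x.2 * b x.2) ^ (1 / 2 : ℝ)
      = w x.1 x.2 * (a x.1 ^ (1 / 2 : ℝ) * b x.2 ^ (1 / 2 : ℝ)) := fun x => by
    rw [ENNReal.mul_rpow_of_nonneg _ _ (by norm_num), ENNReal.mul_rpow_of_nonneg _ _ (by norm_num),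
      mul_mul_mul_comm, e3]
  simp only [e2] at key
  rw [ENNReal.tsum_prod' ] at key
  refine key.trans ?_
  have hA : ∑' x : ι × κ, w x.1 x.2 * a x.1 ≤ C * ∑' i, a i := by
    rw [ENNReal.tsum_prod', ← ENNReal.tsum_mul_left]
    refine ENNReal.tsum_le_tsum fun i => ?_
    simp only [ENNReal.tsum_mul_right]; gcongr; exact h1 i
  have hB : ∑' x : ι × κ, w x.1 x.2 * b x.2 ≤ C * ∑' j, b j := by
    rw [ENNReal.tsum_prod', ENNReal.tsum_comm, ← ENNReal.tsum_mul_left]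
    refine ENNReal.tsum_le_tsum fun i => ?_
    simp only [ENNReal.tsum_mul_right]; gcongr; exact h2 i
  calc _ ≤ (C * ∑' i, a i) ^ (1 / 2 : ℝ) * (C * ∑' j, b j) ^ (1 / 2 : ℝ) := by gcongr
    _ = _ := by
      rw [ENNReal.mul_rpow_of_nonneg _ _ (by norm_num), ENNReal.mul_rpow_of_nonneg _ _ (by norm_num),
        mul_mul_mul_comm, e3]

/-- The `L^p` norm on `ℝ^d` for a real exponent. -/
def nr (p : ℝ) (g : Ed d → ℂ) : ℝ≥0∞ := (∫⁻ x, ‖g x‖ₑ ^ p) ^ (1 / p)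

lemma nr_eq_eLpNorm {p : ℝ} (hp : 0 < p) (g : Ed d → ℂ) :
    nr p g = eLpNorm g (ENNReal.ofReal p) volume := by
  rw [eLpNorm_eq_lintegral_rpow_enorm_toReal (by simpa using hp) ENNReal.ofReal_ne_top,
    ENNReal.toReal_ofReal hp.le, nr]

lemma nr_two (g : Ed d → ℂ) : nr 2 g = eLpNorm g 2 volume := by
  rw [nr_eq_eLpNorm two_pos]; simp

lemma nr_one (g : Ed d → ℂ) : nr 1 g = eLpNorm g 1 volume := by
  rw [nr_eq_eLpNorm one_pos]; simp

lemma nr_rpow {p : ℝ} (hp : 0 < p) (g : Ed d → ℂ) : nr p g ^ p = ∫⁻ x, ‖g x‖ₑ ^ p := by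
  rw [nr, ← ENNReal.rpow_mul, one_div_mul_cancel hp.ne', ENNReal.rpow_one]

lemma nr_mono {p : ℝ} (hp : 0 < p) {g h : Ed d → ℂ} (H : ∀ x, ‖g x‖ₑ ≤ ‖h x‖ₑ) :
    nr p g ≤ nr p h := by
  unfold nr
  have : 0 ≤ 1 / p := by positivity
  gcongr with x
  exact H x

/-- Bounded measurable functions vanishing outside a bounded set. -/
structure Good (g : Ed d → ℂ) : Prop where
  meas : Measurable g
  bdd : ∃ M R : ℝ, (∀ x, ‖g x‖ ≤ M) ∧ ∀ x, R < ‖x‖ → g x = 0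

lemma lintegral_le_of_bound {α : Type*} [NormedAddCommGroup α] [MeasurableSpace α]
    {μ : Measure α} {g : α → ℂ} {M R p : ℝ}
    (hp : 0 < p) (hM : ∀ x, ‖g x‖ ≤ M) (hR : ∀ x, R < ‖x‖ → g x = 0) :
    ∫⁻ x, ‖g x‖ₑ ^ p ∂μ ≤ ENNReal.ofReal M ^ p * μ (Metric.closedBall 0 R) := by
  refine le_trans (lintegral_mono (g := (Metric.closedBall 0 R).indicator
    fun _ => ENNReal.ofReal M ^ p) fun x => ?_) (lintegral_indicator_const_le _ _)
  by_cases hx : R < ‖x‖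
  · simp [hR x hx, hp]
  · rw [Set.indicator_of_mem (by simpa using hx)]
    rw [← ofReal_norm]
    exact ENNReal.rpow_le_rpow (ENNReal.ofReal_le_ofReal (hM x)) hp.le

namespace Good

variable {g h : Ed d → ℂ}

lemma nr_ne_top (hg : Good g) {p : ℝ} (hp : 0 < p) : nr p g ≠ ∞ := by
  obtain ⟨M, R, hM, hR⟩ := hg.bdd
  refine ENNReal.rpow_ne_top_of_nonneg (by positivity)
    ((lintegral_le_of_bound hp hM hR).trans_lt ?_).ne
  exact ENNReal.mul_lt_top (ENNReal.rpow_lt_top_of_nonneg hp.le ENNReal.ofReal_ne_top)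
    measure_closedBall_lt_top

lemma memLp_two (hg : Good g) : MemLp g 2 :=
  ⟨hg.meas.aestronglyMeasurable, by
    rw [← nr_two]; exact (hg.nr_ne_top two_pos).lt_top⟩

lemma integrable (hg : Good g) : Integrable g :=
  memLp_one_iff_integrable.1 ⟨hg.meas.aestronglyMeasurable, by
    rw [← nr_one]; exact (hg.nr_ne_top one_pos).lt_top⟩

lemma mono (hg : Good g) (hm : Measurable h) (H : ∀ x, ‖h x‖ ≤ ‖g x‖) : Good h := by
  obtain ⟨M, R, hM, hR⟩ := hg.bdd
  exact ⟨hm, M, R, fun x => (H x).trans (hM x), fun x hx => by simpa [hR x hx] using H x⟩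

lemma sub (hg : Good g) (hh : Good h) : Good (g - h) := by
  obtain ⟨M, R, hM, hR⟩ := hg.bdd
  obtain ⟨M', R', hM', hR'⟩ := hh.bdd
  refine ⟨hg.meas.sub hh.meas, M + M', max R R', fun x => (norm_sub_le _ _).trans
    (add_le_add (hM x) (hM' x)), fun x hx => ?_⟩
  simp [hR x ((le_max_left _ _).trans_lt hx), hR' x ((le_max_right _ _).trans_lt hx)]

end Good

lemma propForm_energy (τ : ℝ) {g h : Ed d → ℂ} (hg : Good g) (hh : Good h) :
    ‖propForm τ g h‖ₑ ≤ nr 2 g * nr 2 h := by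
  rw [nr_two, nr_two]
  exact enorm_propForm_le_energy τ hg.integrable hg.memLp_two hh.integrable hh.memLp_two

lemma propForm_dispersive {τ : ℝ} (hτ : τ ≠ 0) {g h : Ed d → ℂ} (hg : Good g) (hh : Good h) :
    ‖propForm τ g h‖ₑ ≤ ENNReal.ofReal ((Real.pi / |τ|) ^ ((d : ℝ) / 2)) * nr 1 g * nr 1 h := by
  rw [nr_one, nr_one]
  exact enorm_propForm_le_dispersive hτ hg.integrable hg.memLp_two hh.integrable hh.memLp_two

lemma fourier_add_fun {g h : Ed d → ℂ} (hg : Integrable g) (hh : Integrable h) :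
    𝓕 (fun x => g x + h x) = fun η => 𝓕 g η + 𝓕 h η := by
  ext η
  simp only [Real.fourier_eq, smul_add]
  exact integral_add (by simpa using hg) (by simpa using hh)

lemma integrable_propForm (τ : ℝ) {g h : Ed d → ℂ} (hg : Good g) (hh : Good h) :
    Integrable fun η => cexp (I * (τ * ‖η‖ ^ 2 : ℝ)) * (𝓕 g η * conj (𝓕 h η)) := by
  refine (integrable_fourier_mul_conj hg.integrable hg.memLp_two hh.integrable
    hh.memLp_two).bdd_mul (c := 1) (Continuous.aestronglyMeasurable (by fun_prop))
    (ae_of_all _ fun η => (norm_exp_I_mul _).le)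

lemma propForm_add_left (τ : ℝ) {g g' h : Ed d → ℂ} (hg : Good g) (hg' : Good g') (hh : Good h) :
    propForm τ (fun x => g x + g' x) h = propForm τ g h + propForm τ g' h := by
  unfold propForm
  rw [← integral_add (integrable_propForm τ hg hh) (integrable_propForm τ hg' hh),
    fourier_add_fun hg.integrable hg'.integrable]
  congr 1; ext η; ring

lemma conj_propForm (τ : ℝ) (g h : Ed d → ℂ) : conj (propForm τ g h) = propForm (-τ) h g := by
  unfold propForm
  rw [← integral_conj]
  congr 1; ext η
  simp only [map_mul, ← Complex.exp_conj, conj_I, conj_ofReal, conj_conj]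
  push_cast; ring_nf

lemma propForm_add_right (τ : ℝ) {g h h' : Ed d → ℂ} (hg : Good g) (hh : Good h) (hh' : Good h') :
    propForm τ g (fun x => h x + h' x) = propForm τ g h + propForm τ g h' := by
  have := propForm_add_left (-τ) hh hh' hg
  apply_fun conj at this
  simpa [conj_propForm] using this

end Plate

namespace Plate

open FourierTransform
open scoped ComplexConjugate Topology

variable {d : ℕ}

/-- The dyadic level sets of `g`, normalized by its `L^p` norm. -/
def lvl (p : ℝ) (g : Ed d → ℂ) (k : ℤ) : Set (Ed d) :=
  {x | nr p g * 2 ^ (k : ℝ) < ‖g x‖ₑ ∧ ‖g x‖ₑ ≤ nr p g * 2 ^ ((k : ℝ) + 1)}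

/-- The restriction of `g` to a dyadic level set. -/
def atom (p : ℝ) (g : Ed d → ℂ) (k : ℤ) : Ed d → ℂ := (lvl p g k).indicator g

/-- The `L^p` mass of the dyadic level set. -/
def mass (p : ℝ) (g : Ed d → ℂ) (k : ℤ) : ℝ≥0∞ := 2 ^ ((k : ℝ) * p) * volume (lvl p g k)

/-- Symmetric partial sums of the atomic decomposition. -/
def atomSum (p : ℝ) (g : Ed d → ℂ) (K : ℕ) (x : Ed d) : ℂ :=
  ∑ k ∈ Finset.Icc (-(K : ℤ)) K, atom p g k x

variable {p : ℝ} {g h : Ed d → ℂ}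

lemma measurableSet_lvl (hg : Measurable g) (k : ℤ) : MeasurableSet (lvl p g k) :=
  (measurableSet_lt measurable_const hg.enorm).inter (measurableSet_le hg.enorm measurable_const)

lemma lvl_disjoint : Pairwise (Function.onFun Disjoint (lvl p g)) := by
  have aux : ∀ k l : ℤ, k < l → Disjoint (lvl p g k) (lvl p g l) := fun k l hkl => by
    rw [Set.disjoint_left]
    intro x hx hx'
    have : nr p g * (2 : ℝ≥0∞) ^ ((k : ℝ) + 1) ≤ nr p g * 2 ^ (l : ℝ) := by
      gcongr
      · norm_num
      · exact_mod_cast hkl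
    exact absurd ((hx'.1.trans_le hx.2).trans_le this) (lt_irrefl _)
  intro k l hkl
  rcases lt_or_gt_of_ne hkl with h | h
  · exact aux k l h
  · exact (aux l k h).symm

lemma exists_mem_lvl (hN : nr p g ≠ 0) (hN' : nr p g ≠ ∞) {x : Ed d} (hx : g x ≠ 0) :
    ∃ k, x ∈ lvl p g k := by
  obtain ⟨k, hk⟩ := ENNReal.exists_mem_Ioc_zpow (x := ‖g x‖ₑ / nr p g) (y := 2)
    (ENNReal.div_ne_zero.2 ⟨by simpa using hx, hN'⟩) (ENNReal.div_ne_top enorm_ne_top hN)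
    (by norm_num) (by norm_num)
  refine ⟨k, ?_, ?_⟩
  · rw [ENNReal.rpow_intCast, mul_comm]
    exact (ENNReal.lt_div_iff_mul_lt (Or.inl hN) (Or.inl hN')).1 hk.1
  · have := hk.2
    rw [ENNReal.div_le_iff_le_mul (Or.inl hN) (Or.inl hN')] at this
    rw [mul_comm]; convert this using 2
    rw [← ENNReal.rpow_intCast]; push_cast; rfl

lemma sum_atom_eq (S : Finset ℤ) (x : Ed d) [Decidable (∃ k ∈ S, x ∈ lvl p g k)] :
    ∑ k ∈ S, atom p g k x = if ∃ k ∈ S, x ∈ lvl p g k then g x else 0 := by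
  split_ifs with h
  · obtain ⟨k, hk, hx⟩ := h
    rw [Finset.sum_eq_single k]
    · exact Set.indicator_of_mem hx g
    · intro l _ hl
      exact Set.indicator_of_notMem (fun hx' => Set.disjoint_left.1 (lvl_disjoint hl) hx' hx) g
    · exact fun h => absurd hk h
  · push Not at h
    exact Finset.sum_eq_zero fun k hk => Set.indicator_of_notMem (h k hk) g

lemma norm_atomSum_le (K : ℕ) (x : Ed d) : ‖atomSum p g K x‖ ≤ ‖g x‖ := by
  classical
  rw [atomSum, sum_atom_eq]; split_ifs <;> simp

lemma norm_sub_atomSum_le (K : ℕ) (x : Ed d) : ‖g x - atomSum p g K x‖ ≤ ‖g x‖ := by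
  classical
  rw [atomSum, sum_atom_eq]; split_ifs <;> simp

lemma tendsto_atomSum (hg : Good g) (hp : 0 < p) :
    ∀ᵐ x, Tendsto (fun K => atomSum p g K x) atTop (𝓝 (g x)) := by
  classical
  by_cases hN : nr p g = 0
  · rw [nr, ENNReal.rpow_eq_zero_iff] at hN
    have hN : ∫⁻ x, ‖g x‖ₑ ^ p = 0 := by
      rcases hN with h | h
      · exact h.1
      · exact absurd h.2 (not_lt.2 (by positivity))
    rw [lintegral_eq_zero_iff (hg.meas.enorm.pow_const p)] at hN
    filter_upwards [hN] with x hx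
    have hx : g x = 0 := by simpa [hp.ne', hp.not_gt, hp] using hx
    have : ∀ K, atomSum p g K x = 0 := fun K => norm_le_zero_iff.1 (by
      simpa [hx] using norm_atomSum_le (p := p) (g := g) K x)
    simp [this, hx]
  · refine ae_of_all _ fun x => ?_
    by_cases hx : g x = 0
    · have : ∀ K, atomSum p g K x = 0 := fun K => norm_le_zero_iff.1 (by
        simpa [hx] using norm_atomSum_le (p := p) (g := g) K x)
      simp [this, hx]
    obtain ⟨k, hk⟩ := exists_mem_lvl hN (hg.nr_ne_top hp) hx
    refine tendsto_const_nhds.congr' ?_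
    filter_upwards [eventually_ge_atTop k.natAbs] with K hK
    rw [atomSum, sum_atom_eq, if_pos ⟨k, by simp only [Finset.mem_Icc]; omega, hk⟩]

lemma Good.atom (hg : Good g) (k : ℤ) : Good (atom p g k) :=
  hg.mono (hg.meas.indicator (measurableSet_lvl hg.meas k)) fun _ => norm_indicator_le_norm_self _ _

lemma Good.atomSum (hg : Good g) (K : ℕ) : Good (atomSum p g K) :=
  hg.mono (Finset.measurable_sum _ fun k _ => (hg.atom k).meas) (norm_atomSum_le K)

lemma tsum_mass_le (hg : Good g) (hp : 0 < p) : ∑' k, mass p g k ≤ 1 := by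
  by_cases hN : nr p g = 0
  · have : ∀ k, mass p g k = 0 := fun k => by
      have : lvl p g k = ∅ := by
        ext x; simp [lvl, hN]
      simp [mass, this]
    simp [this]
  have hN' := hg.nr_ne_top hp
  have h1 : ∀ k, nr p g ^ p * mass p g k ≤ ∫⁻ x in lvl p g k, ‖g x‖ₑ ^ p := fun k => by
    have e : nr p g ^ p * mass p g k
        = ∫⁻ x in lvl p g k, (nr p g * 2 ^ (k : ℝ)) ^ p := by
      rw [setLIntegral_const, mass, ENNReal.mul_rpow_of_nonneg _ _ hp.le, ← ENNReal.rpow_mul,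
        mul_assoc]
    rw [e]
    refine setLIntegral_mono' (measurableSet_lvl hg.meas k) fun x hx => ?_
    exact ENNReal.rpow_le_rpow hx.1.le hp.le
  have h2 : nr p g ^ p * ∑' k, mass p g k ≤ nr p g ^ p * 1 := by
    rw [← ENNReal.tsum_mul_left, mul_one]
    refine (ENNReal.tsum_le_tsum h1).trans ?_
    rw [← lintegral_iUnion (fun k => measurableSet_lvl hg.meas k) lvl_disjoint, nr_rpow hp]
    exact setLIntegral_le_lintegral _ _
  exact (ENNReal.mul_le_mul_iff_right (by simp [ENNReal.rpow_eq_zero_iff, hN, hN'])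
    (by simp [ENNReal.rpow_eq_top_iff, hN, hN'])).1 h2

lemma mass_le_one (hg : Good g) (hp : 0 < p) (k : ℤ) : mass p g k ≤ 1 :=
  (ENNReal.le_tsum k).trans (tsum_mass_le hg hp)

lemma nr_atom_le (hg : Good g) (hp : 0 < p) {P : ℝ} (h1 : 1 ≤ P) (h2 : P ≤ 2) (k : ℤ) :
    nr P (atom p g k) ≤ 2 * nr p g * mass p g k ^ (1 / 2 : ℝ) * 2 ^ ((k : ℝ) * (1 - p / P)) := by
  have hP : 0 < P := by linarith
  have e1 : ∫⁻ x, ‖atom p g k x‖ₑ ^ P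
      ≤ (nr p g * 2 ^ ((k : ℝ) + 1)) ^ P * volume (lvl p g k) := by
    rw [← setLIntegral_const, ← lintegral_indicator (measurableSet_lvl hg.meas k)]
    refine lintegral_mono fun x => ?_
    by_cases hx : x ∈ lvl p g k
    · rw [atom, Set.indicator_of_mem hx, Set.indicator_of_mem hx]
      exact ENNReal.rpow_le_rpow hx.2 hP.le
    · rw [atom, Set.indicator_of_notMem hx, Set.indicator_of_notMem hx]
      simp [hP]
  have e2 : volume (lvl p g k) = mass p g k * 2 ^ (-((k : ℝ) * p)) := by
    rw [mass, mul_right_comm, ← two_rpow_add]; simp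
  calc nr P (atom p g k) ≤ ((nr p g * 2 ^ ((k : ℝ) + 1)) ^ P * volume (lvl p g k)) ^ (1 / P) := by
        rw [nr]; exact ENNReal.rpow_le_rpow e1 (by positivity)
    _ = nr p g * 2 ^ ((k : ℝ) + 1) * (mass p g k ^ (1 / P) * 2 ^ (-((k : ℝ) * p) * (1 / P))) := by
        rw [ENNReal.mul_rpow_of_nonneg _ _ (by positivity), ← ENNReal.rpow_mul,
          mul_one_div_cancel hP.ne', ENNReal.rpow_one, e2,
          ENNReal.mul_rpow_of_nonneg _ _ (by positivity), ← ENNReal.rpow_mul]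
    _ ≤ nr p g * 2 ^ ((k : ℝ) + 1) *
        (mass p g k ^ (1 / 2 : ℝ) * 2 ^ (-((k : ℝ) * p) * (1 / P))) := by
        refine mul_le_mul_right (mul_le_mul_left ?_ _) _
        exact ENNReal.rpow_le_rpow_of_exponent_ge (mass_le_one hg hp k)
          (one_div_le_one_div_of_le hP h2)
    _ = _ := by
        have : (k : ℝ) * (1 - p / P) = k + (-((k : ℝ) * p) * (1 / P)) := by field_simp; ring
        rw [this, two_rpow_add, two_rpow_add, ENNReal.rpow_one]
        ring

lemma tendsto_nr_sub_atomSum (hg : Good g) (hp : 0 < p) :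
    Tendsto (fun K => nr 2 (g - atomSum p g K)) atTop (𝓝 0) := by
  have hfin : ∫⁻ x, ‖g x‖ₑ ^ (2 : ℝ) ≠ ∞ := by
    rw [← nr_rpow two_pos]
    exact ENNReal.rpow_ne_top_of_nonneg (by norm_num) (hg.nr_ne_top two_pos)
  have h : Tendsto (fun K => ∫⁻ x, ‖(g - atomSum p g K) x‖ₑ ^ (2 : ℝ)) atTop
      (𝓝 (∫⁻ _ : Ed d, 0)) := by
    refine tendsto_lintegral_of_dominated_convergence (fun x => ‖g x‖ₑ ^ (2 : ℝ))
      (fun K => (hg.sub (hg.atomSum K)).meas.enorm.pow_const _) (fun K => ae_of_all _ fun x => ?_)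
      hfin ?_
    · refine ENNReal.rpow_le_rpow ?_ (by norm_num)
      rw [← ofReal_norm, ← ofReal_norm]
      exact ENNReal.ofReal_le_ofReal (norm_sub_atomSum_le K x)
    · filter_upwards [tendsto_atomSum hg hp] with x hx
      have h1 : Tendsto (fun K => g x - atomSum p g K x) atTop (𝓝 (g x - g x)) := hx.const_sub _
      have h2 := (ENNReal.continuous_rpow_const (y := 2)).tendsto _ |>.comp h1.enorm
      simpa [Function.comp_def] using h2
  have h3 := (ENNReal.continuous_rpow_const (y := 1 / 2)).tendsto _ |>.comp h
  simpa [nr, Function.comp_def] using h3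

lemma propForm_sub_left (τ : ℝ) {g g' h : Ed d → ℂ} (hg : Good g) (hg' : Good g') (hh : Good h) :
    propForm τ (g - g') h = propForm τ g h - propForm τ g' h := by
  have := propForm_add_left τ (hg.sub hg') hg' hh
  simp only [Pi.sub_apply, sub_add_cancel] at this
  rw [eq_sub_iff_add_eq]; exact this.symm

lemma propForm_sub_right (τ : ℝ) {g h h' : Ed d → ℂ} (hg : Good g) (hh : Good h) (hh' : Good h') :
    propForm τ g (h - h') = propForm τ g h - propForm τ g h' := by
  have := propForm_add_right τ hg (hh.sub hh') hh'
  simp only [Pi.sub_apply, sub_add_cancel] at this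
  rw [eq_sub_iff_add_eq]; exact this.symm

lemma good_zero : Good (fun _ : Ed d => (0 : ℂ)) :=
  ⟨measurable_const, 0, 0, by simp, by simp⟩

lemma good_sum {ι : Type*} (S : Finset ι) {g : ι → Ed d → ℂ} (hg : ∀ i, Good (g i)) :
    Good (fun x => ∑ i ∈ S, g i x) := by
  classical
  induction S using Finset.induction_on with
  | empty => simpa using good_zero
  | insert i S hi ih =>
    have := (hg i).sub (good_zero.sub ih)
    simp only [Finset.sum_insert hi]
    convert this using 2
    simp

lemma propForm_sum_left (τ : ℝ) {ι : Type*} (S : Finset ι) {g : ι → Ed d → ℂ}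
    (hg : ∀ i, Good (g i)) (hh : Good h) :
    propForm τ (fun x => ∑ i ∈ S, g i x) h = ∑ i ∈ S, propForm τ (g i) h := by
  classical
  induction S using Finset.induction_on with
  | empty => simp [propForm, Real.fourier_eq]
  | insert i S hi ih =>
    simp only [Finset.sum_insert hi]
    rw [propForm_add_left τ (hg i) (good_sum S hg) hh, ih]

lemma propForm_sum_right (τ : ℝ) {ι : Type*} (S : Finset ι) {g : ι → Ed d → ℂ}
    (hg : ∀ i, Good (g i)) (hh : Good h) :
    propForm τ h (fun x => ∑ i ∈ S, g i x) = ∑ i ∈ S, propForm τ h (g i) := by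
  have := propForm_sum_left (-τ) S hg hh
  apply_fun conj at this
  simpa [conj_propForm] using this

lemma propForm_atomSum (τ : ℝ) (hg : Good g) (hh : Good h) (K : ℕ) :
    propForm τ (atomSum p g K) (atomSum p h K) = ∑ k ∈ Finset.Icc (-(K : ℤ)) K,
      ∑ l ∈ Finset.Icc (-(K : ℤ)) K, propForm τ (atom p g k) (atom p h l) := by
  unfold atomSum
  rw [propForm_sum_left τ _ (fun k => hg.atom k) (good_sum _ fun k => hh.atom k)]
  exact Finset.sum_congr rfl fun k _ => propForm_sum_right τ _ (fun l => hh.atom l) (hg.atom k)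

lemma tendsto_propForm_atomSum (τ : ℝ) (hg : Good g) (hh : Good h) (hp : 0 < p) :
    Tendsto (fun K => propForm τ (atomSum p g K) (atomSum p h K)) atTop (𝓝 (propForm τ g h)) := by
  rw [tendsto_iff_edist_tendsto_0]
  have hb : ∀ K, edist (propForm τ (atomSum p g K) (atomSum p h K)) (propForm τ g h)
      ≤ nr 2 (g - atomSum p g K) * nr 2 h + nr 2 g * nr 2 (h - atomSum p h K) := fun K => by
    rw [edist_comm, edist_eq_enorm_sub]
    have : propForm τ g h - propForm τ (atomSum p g K) (atomSum p h K)
        = propForm τ (g - atomSum p g K) h + propForm τ (atomSum p g K) (h - atomSum p h K) := by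
      rw [propForm_sub_left τ hg (hg.atomSum K) hh,
        propForm_sub_right τ (hg.atomSum K) hh (hh.atomSum K)]
      ring
    rw [this]
    refine (enorm_add_le _ _).trans (add_le_add (propForm_energy τ (hg.sub (hg.atomSum K)) hh)
      ((propForm_energy τ (hg.atomSum K) (hh.sub (hh.atomSum K))).trans ?_))
    gcongr
    refine nr_mono two_pos fun x => ?_
    rw [← ofReal_norm, ← ofReal_norm]
    exact ENNReal.ofReal_le_ofReal (norm_atomSum_le K x)
  refine tendsto_of_tendsto_of_tendsto_of_le_of_le tendsto_const_nhds ?_ (fun _ => zero_le) hb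
  have h1 := ENNReal.Tendsto.mul_const (b := nr 2 h) (tendsto_nr_sub_atomSum hg hp)
    (Or.inr (hh.nr_ne_top two_pos))
  have h2 := ENNReal.Tendsto.const_mul (a := nr 2 g) (tendsto_nr_sub_atomSum hh hp)
    (Or.inr (hg.nr_ne_top two_pos))
  simpa using h1.add h2

lemma sum_sum_le_tsum {ι κ : Type*} (S : Finset ι) (T : Finset κ) (f : ι → κ → ℝ≥0∞) :
    ∑ k ∈ S, ∑ l ∈ T, f k l ≤ ∑' k, ∑' l, f k l :=
  (Finset.sum_le_sum fun _ _ => ENNReal.sum_le_tsum _).trans (ENNReal.sum_le_tsum _)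

lemma enorm_propForm_le_tsum (τ : ℝ) (hg : Good g) (hh : Good h) (hp : 0 < p) :
    ‖propForm τ g h‖ₑ ≤ ∑' k, ∑' l, ‖propForm τ (atom p g k) (atom p h l)‖ₑ := by
  refine le_of_tendsto (tendsto_propForm_atomSum τ hg hh hp).enorm (Eventually.of_forall fun K => ?_)
  rw [propForm_atomSum τ hg hh]
  refine (enorm_sum_le _ _).trans ((Finset.sum_le_sum fun _ _ => enorm_sum_le _ _).trans ?_)
  exact sum_sum_le_tsum _ _ _

lemma exponent_min_le {p a m : ℝ} (h1 : 1 < p) (h2 : p < 2) :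
    min (a - m * (p - 1)) (m * (1 - p / 2))
      ≤ a * (2 / p - 1) - min (p - 1) (1 - p / 2) * |m - 2 * a / p| := by
  have hp : 0 < p := by linarith
  set u := m - 2 * a / p with hu
  have hm : m = u + 2 * a / p := by rw [hu]; ring
  rcases le_total 0 u with h | h
  · rw [abs_of_nonneg h]
    refine (min_le_left _ _).trans ?_
    have e : a - m * (p - 1) = a * (2 / p - 1) - (p - 1) * u := by rw [hm]; field_simp; ring
    rw [e]
    have := mul_le_mul_of_nonneg_right (min_le_left (p - 1) (1 - p / 2)) h
    linarith
  · rw [abs_of_nonpos h]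
    refine (min_le_right _ _).trans ?_
    have e : m * (1 - p / 2) = a * (2 / p - 1) + (1 - p / 2) * u := by rw [hm]; field_simp; ring
    rw [e]
    have := mul_le_mul_of_nonneg_right (min_le_right (p - 1) (1 - p / 2)) (neg_nonneg.2 h)
    linarith

lemma exists_propForm_interp_of_lt (d : ℕ) {p : ℝ} (h1 : 1 < p) (h2 : p < 2) :
    ∃ C : ℝ≥0∞, C ≠ ∞ ∧ ∀ τ : ℝ, τ ≠ 0 → ∀ g h : Ed d → ℂ, Good g → Good h →
      ‖propForm τ g h‖ₑ ≤ C * ENNReal.ofReal ((Real.pi / |τ|) ^ ((d : ℝ) / 2)) ^ (2 / p - 1)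
        * (nr p g * nr p h) := by
  have hp : 0 < p := by linarith
  have hc : 0 < min (p - 1) (1 - p / 2) := lt_min (by linarith) (by linarith)
  obtain ⟨C, hC, hsum⟩ := exists_tsum_abs_add_le hc
  refine ⟨4 * C, ENNReal.mul_ne_top (by norm_num) hC, fun τ hτ g h hg hh => ?_⟩
  have hA : 0 < (Real.pi / |τ|) ^ ((d : ℝ) / 2) := by
    have := Real.pi_pos
    have := abs_pos.2 hτ
    positivity
  obtain ⟨a, ha⟩ : ∃ a : ℝ, ENNReal.ofReal ((Real.pi / |τ|) ^ ((d : ℝ) / 2)) = 2 ^ a := by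
    refine ⟨Real.logb 2 ((Real.pi / |τ|) ^ ((d : ℝ) / 2)), ?_⟩
    rw [← ENNReal.ofReal_ofNat, ENNReal.ofReal_rpow_of_pos (by norm_num),
      Real.rpow_logb (by norm_num) (by norm_num) hA]
  rw [ha, ← ENNReal.rpow_mul]
  set N := nr p g * nr p h with hN
  have hterm : ∀ k l : ℤ, ‖propForm τ (atom p g k) (atom p h l)‖ₑ ≤
      4 * N * 2 ^ (a * (2 / p - 1)) *
        (2 ^ (-(min (p - 1) (1 - p / 2) * |(k : ℝ) + l - 2 * a / p|)) *
          (mass p g k ^ (1 / 2 : ℝ) * mass p h l ^ (1 / 2 : ℝ))) := fun k l => by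
    have b1 : ‖propForm τ (atom p g k) (atom p h l)‖ₑ ≤ 4 * N *
        (mass p g k ^ (1 / 2 : ℝ) * mass p h l ^ (1 / 2 : ℝ)) *
          2 ^ (a - ((k : ℝ) + l) * (p - 1)) := by
      refine (propForm_dispersive hτ (hg.atom k) (hh.atom l)).trans ?_
      rw [ha]
      refine (mul_le_mul' (mul_le_mul_right (nr_atom_le hg hp le_rfl one_le_two k) _)
        (nr_atom_le hh hp le_rfl one_le_two l)).trans (le_of_eq ?_)
      have : a - ((k : ℝ) + l) * (p - 1) = a + (k * (1 - p / 1) + l * (1 - p / 1)) := by ring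
      rw [this, two_rpow_add, two_rpow_add, hN]
      ring
    have b2 : ‖propForm τ (atom p g k) (atom p h l)‖ₑ ≤ 4 * N *
        (mass p g k ^ (1 / 2 : ℝ) * mass p h l ^ (1 / 2 : ℝ)) *
          2 ^ (((k : ℝ) + l) * (1 - p / 2)) := by
      refine (propForm_energy τ (hg.atom k) (hh.atom l)).trans ?_
      refine (mul_le_mul' (nr_atom_le hg hp one_le_two le_rfl k)
        (nr_atom_le hh hp one_le_two le_rfl l)).trans (le_of_eq ?_)
      rw [add_mul, two_rpow_add, hN]
      ring
    have b3 : ‖propForm τ (atom p g k) (atom p h l)‖ₑ ≤ 4 * N *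
        (mass p g k ^ (1 / 2 : ℝ) * mass p h l ^ (1 / 2 : ℝ)) *
          2 ^ (min (a - ((k : ℝ) + l) * (p - 1)) (((k : ℝ) + l) * (1 - p / 2))) := by
      rcases min_choice (a - ((k : ℝ) + l) * (p - 1)) (((k : ℝ) + l) * (1 - p / 2)) with e | e
      · rw [e]; exact b1
      · rw [e]; exact b2
    refine (b3.trans (mul_le_mul_right (two_rpow_le (exponent_min_le h1 h2)) _)).trans
      (le_of_eq ?_)
    rw [sub_eq_add_neg (a * _), two_rpow_add]
    ring
  refine (enorm_propForm_le_tsum τ hg hh hp).trans ?_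
  refine (ENNReal.tsum_le_tsum fun k => ENNReal.tsum_le_tsum fun l => hterm k l).trans ?_
  simp only [ENNReal.tsum_mul_left]
  have hs := tsum_weight_le (C := C) (a := mass p g) (b := mass p h)
    (w := fun k l : ℤ => 2 ^ (-(min (p - 1) (1 - p / 2) * |(k : ℝ) + l - 2 * a / p|)))
    (fun k => by
      refine le_trans (le_of_eq ?_) (hsum (k - 2 * a / p))
      congr 1; ext l; congr 4; ring)
    (fun l => by
      refine le_trans (le_of_eq ?_) (hsum (l - 2 * a / p))
      congr 1; ext k; congr 4; ring)
  have hm1 : (∑' k, mass p g k) ^ (1 / 2 : ℝ) ≤ 1 :=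
    ENNReal.rpow_le_one (tsum_mass_le hg hp) (by norm_num)
  have hm2 : (∑' k, mass p h k) ^ (1 / 2 : ℝ) ≤ 1 :=
    ENNReal.rpow_le_one (tsum_mass_le hh hp) (by norm_num)
  have hs' := hs.trans (mul_le_mul_right (mul_le_mul' hm1 hm2) C)
  refine (mul_le_mul_right hs' _).trans (le_of_eq ?_)
  ring

/-- Interpolation between the dispersive and the energy estimate. -/
lemma exists_propForm_interp (d : ℕ) {p : ℝ} (h1 : 1 ≤ p) (h2 : p ≤ 2) :
    ∃ C : ℝ≥0∞, C ≠ ∞ ∧ ∀ τ : ℝ, τ ≠ 0 → ∀ g h : Ed d → ℂ, Good g → Good h →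
      ‖propForm τ g h‖ₑ ≤ C * ENNReal.ofReal ((Real.pi / |τ|) ^ ((d : ℝ) / 2)) ^ (2 / p - 1)
        * (nr p g * nr p h) := by
  rcases h1.eq_or_lt with rfl | h1
  · refine ⟨1, by norm_num, fun τ hτ g h hg hh => (propForm_dispersive hτ hg hh).trans ?_⟩
    norm_num [mul_assoc]
  rcases h2.eq_or_lt with rfl | h2
  · refine ⟨1, by norm_num, fun τ hτ g h hg hh => (propForm_energy τ hg hh).trans ?_⟩
    norm_num
  exact exists_propForm_interp_of_lt d h1 h2

end Plate

namespace Plate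

open FourierTransform
open scoped ComplexConjugate Topology

variable {d : ℕ}

/-- Bounded measurable space-time functions vanishing outside a bounded set. -/
structure Tst (G : ℝ → Ed d → ℂ) : Prop where
  meas : Measurable (Function.uncurry G)
  bdd : ∃ M R : ℝ, (∀ t x, ‖G t x‖ ≤ M) ∧ (∀ t x, R < |t| → G t x = 0) ∧
    ∀ t x, R < ‖x‖ → G t x = 0

/-- The spatial Fourier transform of `G`, evolved along the Schrödinger flow. -/
def evol (κ : ℝ) (G : ℝ → Ed d → ℂ) (s : ℝ) (η : Ed d) : ℂ :=
  cexp (I * (κ * s * ‖η‖ ^ 2 : ℝ)) * 𝓕 (G s) η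

/-- The time-integrated evolution. -/
def totalEvol (κ : ℝ) (G : ℝ → Ed d → ℂ) (η : Ed d) : ℂ := ∫ s, evol κ G s η

/-- The `TT*` kernel form. -/
def tform (κ : ℝ) (G H : ℝ → Ed d → ℂ) (s t : ℝ) : ℂ := propForm (κ * (s - t)) (G s) (H t)

/-- The mixed space-time norm for real exponents. -/
def nrT (Q p : ℝ) (G : ℝ → Ed d → ℂ) : ℝ≥0∞ := (∫⁻ t, nr p (G t) ^ Q) ^ (1 / Q)

lemma nrT_rpow {Q p : ℝ} (hQ : 0 < Q) (G : ℝ → Ed d → ℂ) :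
    nrT Q p G ^ Q = ∫⁻ t, nr p (G t) ^ Q := by
  rw [nrT, ← ENNReal.rpow_mul, one_div_mul_cancel hQ.ne', ENNReal.rpow_one]

lemma measurable_nr {G : ℝ → Ed d → ℂ} (hG : Measurable (Function.uncurry G)) (p : ℝ) :
    Measurable fun t => nr p (G t) := by
  unfold nr
  exact (Measurable.lintegral_prod_right' (hG.enorm.pow_const p)).pow_const _

lemma stronglyMeasurable_evol {κ : ℝ} {G : ℝ → Ed d → ℂ} (hG : Measurable (Function.uncurry G)) :
    StronglyMeasurable (Function.uncurry (evol κ G)) := by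
  have h : StronglyMeasurable (fun z : ℝ × Ed d => 𝓕 (G z.1) z.2) := by
    simp only [Real.fourier_eq']
    refine StronglyMeasurable.integral_prod_right
      (f := fun (z : ℝ × Ed d) v => cexp (↑(-2 * Real.pi * ⟪v, z.2⟫) * I) • G z.1 v) ?_
    refine Measurable.stronglyMeasurable ?_
    refine Measurable.smul (f := fun w : (ℝ × Ed d) × Ed d =>
      cexp (↑(-2 * Real.pi * ⟪w.2, w.1.2⟫) * I)) (g := fun w => G w.1.1 w.2) ?_ ?_
    · exact Continuous.measurable (by fun_prop)
    · exact hG.comp (by fun_prop : Measurable fun w : (ℝ × Ed d) × Ed d => (w.1.1, w.2))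
  refine StronglyMeasurable.mul (f := fun z : ℝ × Ed d => cexp (I * (κ * z.1 * ‖z.2‖ ^ 2 : ℝ))) ?_ h
  exact Continuous.stronglyMeasurable (by fun_prop)

lemma stronglyMeasurable_evol_comp {α : Type*} [MeasurableSpace α] {κ : ℝ} {G : ℝ → Ed d → ℂ}
    (hG : Measurable (Function.uncurry G)) {u : α → ℝ} (hu : Measurable u) :
    StronglyMeasurable fun w : α × Ed d => evol κ G (u w.1) w.2 := by
  have m : StronglyMeasurable fun z : ℝ × Ed d => evol κ G z.1 z.2 := stronglyMeasurable_evol hG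
  have c : Measurable fun w : α × Ed d => (u w.1, w.2) := by fun_prop
  exact StronglyMeasurable.comp_measurable (f := fun z : ℝ × Ed d => evol κ G z.1 z.2) m c

lemma measurable_totalEvol {κ : ℝ} {G : ℝ → Ed d → ℂ} (hG : Measurable (Function.uncurry G)) :
    StronglyMeasurable (totalEvol κ G) :=
  (stronglyMeasurable_evol hG).integral_prod_left

lemma tform_eq (κ : ℝ) (G H : ℝ → Ed d → ℂ) (s t : ℝ) :
    tform κ G H s t = ∫ η, evol κ G s η * conj (evol κ H t η) := by
  unfold tform propForm evol
  refine integral_congr_ae (ae_of_all _ fun η => ?_)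
  have : I * ((κ * (s - t) * ‖η‖ ^ 2 : ℝ) : ℂ)
      = I * (κ * s * ‖η‖ ^ 2 : ℝ) + -I * (κ * t * ‖η‖ ^ 2 : ℝ) := by push_cast; ring
  simp only [this, Complex.exp_add, map_mul, ← Complex.exp_conj, conj_I, conj_ofReal]
  ring

lemma stronglyMeasurable_tform {κ : ℝ} {G H : ℝ → Ed d → ℂ}
    (hG : Measurable (Function.uncurry G)) (hH : Measurable (Function.uncurry H)) :
    StronglyMeasurable (Function.uncurry (tform κ G H)) := by
  have : Function.uncurry (tform κ G H)
      = fun z : ℝ × ℝ => ∫ η, evol κ G z.1 η * conj (evol κ H z.2 η) := by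
    ext ⟨s, t⟩; exact tform_eq κ G H s t
  rw [this]
  refine StronglyMeasurable.integral_prod_right
    (f := fun (z : ℝ × ℝ) η => evol κ G z.1 η * conj (evol κ H z.2 η)) ?_
  refine Measurable.stronglyMeasurable ?_
  refine Measurable.mul (f := fun w : (ℝ × ℝ) × Ed d => evol κ G w.1.1 w.2)
    (g := fun w => conj (evol κ H w.1.2 w.2)) ?_ ?_
  · exact (stronglyMeasurable_evol_comp hG measurable_fst).measurable
  · exact Complex.continuous_conj.measurable.comp
      (stronglyMeasurable_evol_comp hH measurable_snd).measurable

lemma conj_tform (κ : ℝ) (G H : ℝ → Ed d → ℂ) (s t : ℝ) :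
    conj (tform κ G H s t) = tform κ H G t s := by
  unfold tform; rw [conj_propForm]; congr 1; ring

namespace Tst

variable {G H : ℝ → Ed d → ℂ} {κ : ℝ}

lemma good (hG : Tst G) (t : ℝ) : Good (G t) := by
  obtain ⟨M, R, hM, -, hR⟩ := hG.bdd
  exact ⟨hG.meas.of_uncurry_left, M, R, hM t, hR t⟩

lemma mono (hG : Tst G) (hm : Measurable (Function.uncurry H)) (h : ∀ t x, ‖H t x‖ ≤ ‖G t x‖) :
    Tst H := by
  obtain ⟨M, R, hM, hR, hR'⟩ := hG.bdd
  exact ⟨hm, M, R, fun t x => (h t x).trans (hM t x),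
    fun t x ht => by simpa [hR t x ht] using h t x, fun t x ht => by simpa [hR' t x ht] using h t x⟩

lemma cut (hG : Tst G) {A : Set ℝ} (hA : MeasurableSet A) : Tst (A.indicator G) := by
  classical
  have e : ∀ t x, A.indicator G t x = (A ×ˢ Set.univ).indicator (Function.uncurry G) (t, x) := by
    intro t x; by_cases h : t ∈ A <;> simp [h]
  refine hG.mono ?_ fun t x => ?_
  · have : Function.uncurry (A.indicator G) = (A ×ˢ Set.univ).indicator (Function.uncurry G) := by
      ext ⟨t, x⟩; exact e t x
    rw [this]; exact hG.meas.indicator (hA.prod MeasurableSet.univ)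
  · rw [e]; exact norm_indicator_le_norm_self (Function.uncurry G) _

lemma nr_bound (hG : Tst G) {p : ℝ} (hp : 0 < p) : ∃ (B : ℝ≥0∞) (R : ℝ), B ≠ ∞ ∧
    (∀ t, nr p (G t) ≤ B) ∧ ∀ t, R < |t| → nr p (G t) = 0 := by
  obtain ⟨M, R, hM, hR, hR'⟩ := hG.bdd
  refine ⟨(ENNReal.ofReal M ^ p * volume (Metric.closedBall (0 : Ed d) R)) ^ (1 / p), R, ?_,
    fun t => ENNReal.rpow_le_rpow (lintegral_le_of_bound hp (hM t) (hR' t)) (by positivity),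
    fun t ht => ?_⟩
  · refine ENNReal.rpow_ne_top_of_nonneg (by positivity) (ENNReal.mul_ne_top
      (ENNReal.rpow_ne_top_of_nonneg hp.le ENNReal.ofReal_ne_top) measure_closedBall_lt_top.ne)
  · have : G t = fun _ => 0 := funext fun x => hR t x ht
    simp [nr, this, hp]

lemma lintegral_nr_ne_top (hG : Tst G) {p Q : ℝ} (hp : 0 < p) (hQ : 0 < Q) :
    ∫⁻ t, nr p (G t) ^ Q ≠ ∞ := by
  obtain ⟨B, R, hB, h1, h2⟩ := hG.nr_bound hp
  have : ∫⁻ t, nr p (G t) ^ Q ≤ ∫⁻ t, (Metric.closedBall (0 : ℝ) R).indicator (fun _ => B ^ Q) t := by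
    refine lintegral_mono fun t => ?_
    by_cases ht : R < |t|
    · simp [h2 t ht, hQ]
    · rw [Set.indicator_of_mem (by simpa using ht)]
      exact ENNReal.rpow_le_rpow (h1 t) hQ.le
  refine (this.trans_lt ((lintegral_indicator_const_le _ _).trans_lt ?_)).ne
  exact ENNReal.mul_lt_top (ENNReal.rpow_lt_top_of_nonneg hQ.le hB) measure_closedBall_lt_top

lemma eLpNorm_evol (hG : Tst G) (s : ℝ) : eLpNorm (evol κ G s) 2 volume = nr 2 (G s) := by
  rw [nr_two, ← eLpNorm_fourier (hG.good s).integrable (hG.good s).memLp_two]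
  refine eLpNorm_congr_norm_ae (ae_of_all _ fun η => ?_)
  rw [evol, norm_mul, norm_exp_I_mul, one_mul]

end Tst

lemma integrable_prod_mul_conj {α : Type*} [MeasurableSpace α] {μ : Measure α} [SFinite μ]
    {Ψ₁ Ψ₂ : α → Ed d → ℂ} (m1 : StronglyMeasurable (Function.uncurry Ψ₁))
    (m2 : StronglyMeasurable (Function.uncurry Ψ₂))
    (h : ∫⁻ a, eLpNorm (Ψ₁ a) 2 volume * eLpNorm (Ψ₂ a) 2 volume ∂μ ≠ ∞) :
    Integrable (Function.uncurry fun a η => Ψ₁ a η * conj (Ψ₂ a η)) (μ.prod volume) := by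
  have m : StronglyMeasurable (Function.uncurry fun a η => Ψ₁ a η * conj (Ψ₂ a η)) :=
    m1.mul (Complex.continuous_conj.comp_stronglyMeasurable m2)
  refine ⟨m.aestronglyMeasurable, ?_⟩
  rw [HasFiniteIntegral, lintegral_prod _ m.enorm.aemeasurable]
  refine lt_of_le_of_lt (lintegral_mono fun a => ?_) (lt_top_iff_ne_top.2 h)
  refine le_trans (le_of_eq ?_) (enorm_integral_mul_le
    (m1.of_uncurry_left (x := a)).aestronglyMeasurable
    (m2.of_uncurry_left (x := a)).aestronglyMeasurable)
  refine lintegral_congr fun η => ?_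
  simp [enorm_mul]

section

variable {G H : ℝ → Ed d → ℂ} {κ : ℝ}

lemma integrable_evol_mul (hG : Tst G) (hH : Tst H) :
    Integrable (Function.uncurry fun (z : ℝ × ℝ) η => evol κ G z.1 η * conj (evol κ H z.2 η))
      ((volume.prod volume).prod volume) := by
  refine integrable_prod_mul_conj (Ψ₁ := fun z : ℝ × ℝ => evol κ G z.1)
    (Ψ₂ := fun z : ℝ × ℝ => evol κ H z.2) ?_ ?_ ?_
  · exact stronglyMeasurable_evol_comp hG.meas measurable_fst
  · exact stronglyMeasurable_evol_comp hH.meas measurable_snd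
  · simp only [hG.eLpNorm_evol, hH.eLpNorm_evol]
    rw [lintegral_prod_mul (measurable_nr hG.meas 2).aemeasurable
      (measurable_nr hH.meas 2).aemeasurable]
    have h1 := hG.lintegral_nr_ne_top two_pos one_pos
    have h2 := hH.lintegral_nr_ne_top two_pos one_pos
    simp only [ENNReal.rpow_one] at h1 h2
    exact ENNReal.mul_ne_top h1 h2

lemma integrable_tform (hG : Tst G) (hH : Tst H) :
    Integrable (Function.uncurry (tform κ G H)) (volume.prod volume) := by
  refine (integrable_evol_mul (κ := κ) hG hH).integral_prod_left.congr (ae_of_all _ fun z => ?_)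
  exact (tform_eq κ G H z.1 z.2).symm

lemma integral_tform (hG : Tst G) (hH : Tst H) :
    ∫ z : ℝ × ℝ, tform κ G H z.1 z.2 = ∫ η, totalEvol κ G η * conj (totalEvol κ H η) := by
  simp only [tform_eq]
  rw [Measure.volume_eq_prod, integral_integral_swap (integrable_evol_mul hG hH)]
  refine integral_congr_ae (ae_of_all _ fun η => ?_)
  simp only
  rw [integral_prod_mul (fun s => evol κ G s η) (fun t => conj (evol κ H t η)), integral_conj]
  rfl

lemma integral_tform_left (hG : Tst G) (hH : Tst H) (t : ℝ) :
    ∫ s, tform κ G H s t = ∫ η, totalEvol κ G η * conj (evol κ H t η) := by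
  simp only [tform_eq]
  have : Integrable (Function.uncurry fun s η => evol κ G s η * conj (evol κ H t η))
      (volume.prod volume) := by
    refine integrable_prod_mul_conj (Ψ₁ := evol κ G) (Ψ₂ := fun _ => evol κ H t)
      (stronglyMeasurable_evol hG.meas) ?_ ?_
    · exact stronglyMeasurable_evol_comp hH.meas measurable_const
    · simp only [hG.eLpNorm_evol, hH.eLpNorm_evol]
      rw [lintegral_mul_const _ (measurable_nr hG.meas 2)]
      have h1 := hG.lintegral_nr_ne_top two_pos one_pos
      simp only [ENNReal.rpow_one] at h1
      exact ENNReal.mul_ne_top h1 ((hH.good t).nr_ne_top two_pos)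
  rw [integral_integral_swap this]
  refine integral_congr_ae (ae_of_all _ fun η => ?_)
  simp only
  rw [integral_mul_const]; rfl

lemma enorm_integral_mul_conj_le {f g : Ed d → ℂ} (hf : AEStronglyMeasurable f)
    (hg : AEStronglyMeasurable g) :
    ‖∫ η, f η * conj (g η)‖ₑ ≤ eLpNorm f 2 volume * eLpNorm g 2 volume := by
  refine (enorm_integral_le_lintegral_enorm _).trans (le_trans (le_of_eq ?_)
    (enorm_integral_mul_le hf hg))
  refine lintegral_congr fun η => ?_
  simp [enorm_mul]

lemma enorm_integral_tform_left_le (hG : Tst G) (hH : Tst H) (t : ℝ) :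
    ‖∫ s, tform κ G H s t‖ₑ ≤ eLpNorm (totalEvol κ G) 2 volume * nr 2 (H t) := by
  rw [integral_tform_left hG hH, ← hH.eLpNorm_evol (κ := κ)]
  exact enorm_integral_mul_conj_le (measurable_totalEvol hG.meas).aestronglyMeasurable
    (stronglyMeasurable_evol hH.meas).of_uncurry_left.aestronglyMeasurable

lemma enorm_integral_tform_le (hG : Tst G) (hH : Tst H) :
    ‖∫ z : ℝ × ℝ, tform κ G H z.1 z.2‖ₑ
      ≤ eLpNorm (totalEvol κ G) 2 volume * eLpNorm (totalEvol κ H) 2 volume := by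
  rw [integral_tform hG hH]
  exact enorm_integral_mul_conj_le (measurable_totalEvol hG.meas).aestronglyMeasurable
    (measurable_totalEvol hH.meas).aestronglyMeasurable

lemma eLpNorm_totalEvol_sq (hG : Tst G) :
    eLpNorm (totalEvol κ G) 2 volume ^ (2 : ℝ) = ‖∫ z : ℝ × ℝ, tform κ G G z.1 z.2‖ₑ := by
  have hint : Integrable fun η => ‖totalEvol κ G η‖ ^ 2 := by
    have h := (integrable_evol_mul (κ := κ) hG hG).integral_prod_right
    refine h.norm.congr (ae_of_all _ fun η => ?_)
    have e : ∫ z : ℝ × ℝ, (Function.uncurry fun (z : ℝ × ℝ) η =>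
        evol κ G z.1 η * conj (evol κ G z.2 η)) (z, η) ∂(volume.prod volume)
        = totalEvol κ G η * conj (totalEvol κ G η) := by
      simp only [Function.uncurry]
      rw [integral_prod_mul (fun s => evol κ G s η) (fun t => conj (evol κ G t η)), integral_conj]
      rfl
    simp only [e, norm_mul, RCLike.norm_conj, sq]
  rw [integral_tform hG hG]
  simp only [Complex.mul_conj, Complex.normSq_eq_norm_sq]
  rw [integral_complex_ofReal, ← ofReal_norm, Complex.norm_real, ofReal_norm,
    Real.enorm_of_nonneg (integral_nonneg fun _ => sq_nonneg _),
    ofReal_integral_eq_lintegral_ofReal hint (ae_of_all _ fun _ => sq_nonneg _),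
    ← nr_two, nr_rpow two_pos]
  refine lintegral_congr fun η => ?_
  rw [ENNReal.ofReal_pow (norm_nonneg _), ofReal_norm, ENNReal.rpow_ofNat]

lemma eLpNorm_totalEvol_sq_le (hG : Tst G) : eLpNorm (totalEvol κ G) 2 volume ^ (2 : ℝ)
    ≤ ∫⁻ t, ∫⁻ s, ‖tform κ G G s t‖ₑ := by
  rw [eLpNorm_totalEvol_sq hG]
  refine (enorm_integral_le_lintegral_enorm _).trans (le_of_eq ?_)
  rw [Measure.volume_eq_prod, lintegral_prod_symm]
  exact (stronglyMeasurable_tform hG.meas hG.meas).enorm.aemeasurable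

end

end Plate

namespace Plate

lemma lintegral_comp_abs_le {F : ℝ → ℝ≥0∞} (hF : Measurable F) :
    ∫⁻ x, F |x| ≤ 2 * ∫⁻ x in Set.Ioi 0, F x := by
  have h : ∀ᵐ x : ℝ, F |x| ≤ (Set.Ioi 0).indicator F x + (Set.Ioi 0).indicator F (-x) := by
    filter_upwards [compl_mem_ae_iff.2 (measure_singleton (0 : ℝ))] with x hx
    rcases lt_or_gt_of_ne (show x ≠ 0 from hx) with h | h
    · rw [abs_of_neg h, Set.indicator_of_mem (show -x ∈ Set.Ioi 0 by simpa using h)]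
      exact le_add_self
    · rw [abs_of_pos h, Set.indicator_of_mem (show x ∈ Set.Ioi 0 from h)]
      exact le_self_add
  have m : Measurable ((Set.Ioi (0 : ℝ)).indicator F) := hF.indicator measurableSet_Ioi
  refine (lintegral_mono_ae h).trans (le_of_eq ?_)
  rw [lintegral_add_left m, lintegral_neg_eq_self ((Set.Ioi (0 : ℝ)).indicator F), ← two_mul,
    lintegral_indicator measurableSet_Ioi]

lemma lintegral_near_le {γ R : ℝ} (h1 : γ < 1) (hR : 0 < R) :
    ∫⁻ u, (Set.Iio R).indicator (fun v => ENNReal.ofReal (v ^ (-γ))) |u|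
      ≤ 2 * ENNReal.ofReal (1 / (1 - γ)) * ENNReal.ofReal R ^ (1 - γ) := by
  have m : Measurable fun v : ℝ => ENNReal.ofReal (v ^ (-γ)) :=
    ENNReal.measurable_ofReal.comp (measurable_id.pow_const _)
  refine (lintegral_comp_abs_le (m.indicator measurableSet_Iio)).trans ?_
  rw [mul_assoc]
  gcongr
  rw [setLIntegral_indicator measurableSet_Iio, Set.Iio_inter_Ioi,
    ENNReal.ofReal_rpow_of_pos hR, ← ENNReal.ofReal_mul (by
      have : 0 < 1 - γ := by linarith
      positivity)]
  have hi : IntervalIntegrable (fun v : ℝ => v ^ (-γ)) volume 0 R :=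
    intervalIntegral.intervalIntegrable_rpow' (by linarith)
  rw [setLIntegral_congr Ioo_ae_eq_Ioc, ← ofReal_integral_eq_lintegral_ofReal
    ((intervalIntegrable_iff_integrableOn_Ioc_of_le hR.le).1 hi)]
  · rw [← intervalIntegral.integral_of_le hR.le, integral_rpow (Or.inl (by linarith)),
      Real.zero_rpow (by linarith)]
    refine ENNReal.ofReal_le_ofReal (le_of_eq ?_)
    have : -γ + 1 = 1 - γ := by ring
    rw [this]; ring
  · filter_upwards [ae_restrict_mem measurableSet_Ioc] with v hv
    exact Real.rpow_nonneg hv.1.le _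

lemma lintegral_far_le {R : ℝ} (hR : 0 < R) :
    ∫⁻ u, (Set.Ici R).indicator (fun v => ENNReal.ofReal (v ^ (-2 : ℝ))) |u|
      ≤ 2 * ENNReal.ofReal R ^ (-1 : ℝ) := by
  have m : Measurable fun v : ℝ => ENNReal.ofReal (v ^ (-2 : ℝ)) :=
    ENNReal.measurable_ofReal.comp (measurable_id.pow_const _)
  refine (lintegral_comp_abs_le (m.indicator measurableSet_Ici)).trans ?_
  gcongr
  rw [setLIntegral_indicator measurableSet_Ici, ENNReal.ofReal_rpow_of_pos hR]
  have e : Set.Ici R ∩ Set.Ioi 0 = Set.Ici R := by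
    ext x; simp only [Set.mem_inter_iff, Set.mem_Ici, Set.mem_Ioi]
    exact ⟨fun h => h.1, fun h => ⟨h, hR.trans_le h⟩⟩
  rw [e, setLIntegral_congr Ioi_ae_eq_Ici.symm, ← ofReal_integral_eq_lintegral_ofReal
    (integrableOn_Ioi_rpow_of_lt (by norm_num) hR)]
  · rw [integral_Ioi_rpow_of_lt (by norm_num) hR]
    refine ENNReal.ofReal_le_ofReal (le_of_eq ?_)
    norm_num
  · filter_upwards [ae_restrict_mem measurableSet_Ioi] with v hv
    exact Real.rpow_nonneg (hR.trans hv).le _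

lemma hls_slice {Q : ℝ} (h1 : 1 < Q) (h2 : Q < 2) {f : ℝ → ℝ≥0∞} (hf : Measurable f)
    {h N : ℝ≥0∞} (hh : h ≠ 0) (hh' : h ≠ ∞) (hN : N ≠ 0) (hN' : N ≠ ∞)
    (hNf : (∫⁻ s, f s ^ Q) ^ (1 / Q) = N) (t : ℝ) :
    ∫⁻ s, min (f s) h * ENNReal.ofReal (|s - t| ^ (-(2 - 2 / Q)))
      ≤ (2 * ENNReal.ofReal (1 / (1 - (2 - 2 / Q))) + 2 ^ (1 - 1 / Q)) *
        (h ^ (Q - 1) * N ^ (2 - Q)) := by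
  have hQ : 0 < Q := by linarith
  set γ := 2 - 2 / Q with hγ
  have hQ1 : 1 / Q < 1 := by rw [div_lt_one hQ]; exact h1
  have hQ2 : 1 / 2 < 1 / Q := one_div_lt_one_div_of_lt hQ h2
  have hγ1 : γ < 1 := by
    have : 2 / Q = 2 * (1 / Q) := by ring
    rw [hγ, this]; linarith
  have hq0 : 0 < 1 - 1 / Q := by linarith
  have hR0 : N / h ≠ 0 := ENNReal.div_ne_zero.2 ⟨hN, hh'⟩
  have hR1 : N / h ≠ ∞ := ENNReal.div_ne_top hN' hh
  have hRe : (N / h) ^ Q ≠ ∞ := ENNReal.rpow_ne_top_of_nonneg hQ.le hR1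
  have hRz : (N / h) ^ Q ≠ 0 := by simp [ENNReal.rpow_eq_zero_iff, hR0, hR1]
  set R := ((N / h) ^ Q).toReal with hR
  have hRpos : 0 < R := ENNReal.toReal_pos hRz hRe
  have hRR : ENNReal.ofReal R = (N / h) ^ Q := ENNReal.ofReal_toReal hRe
  have hdiv : ∀ y : ℝ, (N / h) ^ y = N ^ y * h ^ (-y) := fun y => by
    rw [ENNReal.div_eq_inv_mul, ENNReal.mul_rpow_of_ne_top (ENNReal.inv_ne_top.2 hh) hN',
      ENNReal.inv_rpow, ENNReal.rpow_neg, mul_comm]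
  set n : ℝ → ℝ≥0∞ := (Set.Iio R).indicator (fun v => ENNReal.ofReal (v ^ (-γ))) with hn
  set w : ℝ → ℝ≥0∞ := (Set.Ici R).indicator (fun v => ENNReal.ofReal (v ^ (-γ))) with hw
  have m : Measurable fun v : ℝ => ENNReal.ofReal (v ^ (-γ)) :=
    ENNReal.measurable_ofReal.comp (measurable_id.pow_const _)
  have mn : Measurable n := m.indicator measurableSet_Iio
  have mw : Measurable w := m.indicator measurableSet_Ici
  have hsplit : ∀ s, min (f s) h * ENNReal.ofReal (|s - t| ^ (-γ))
      ≤ h * n |s - t| + f s * w |s - t| := fun s => by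
    rcases lt_or_ge |s - t| R with hs | hs
    · refine le_trans ?_ le_self_add
      rw [hn, Set.indicator_of_mem (show |s - t| ∈ Set.Iio R from hs)]
      gcongr; exact min_le_right _ _
    · refine le_trans ?_ le_add_self
      rw [hw, Set.indicator_of_mem (show |s - t| ∈ Set.Ici R from hs)]
      gcongr; exact min_le_left _ _
  have mnt : Measurable fun s : ℝ => n |s - t| := mn.comp (by fun_prop)
  have mwt : Measurable fun s : ℝ => w |s - t| := mw.comp (by fun_prop)
  have e1 : ∫⁻ s, n |s - t| ≤ 2 * ENNReal.ofReal (1 / (1 - γ)) * ((N / h) ^ Q) ^ (1 - γ) := by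
    rw [lintegral_sub_right_eq_self (fun s => n |s|) t, ← hRR]
    exact lintegral_near_le hγ1 hRpos
  have e2 : ∫⁻ s, f s * w |s - t| ≤ N * (2 ^ (1 - 1 / Q) * ((N / h) ^ Q) ^ (-(1 - 1 / Q))) := by
    have hconj : Q.HolderConjugate (1 / (1 - 1 / Q)) := by
      rw [Real.holderConjugate_iff]
      refine ⟨h1, ?_⟩
      rw [one_div, one_div, inv_inv]; ring
    refine (ENNReal.lintegral_mul_le_Lp_mul_Lq volume hconj hf.aemeasurable
      mwt.aemeasurable).trans ?_
    rw [hNf, one_div_one_div]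
    gcongr
    have e3 : ∀ v, 0 ≤ v → w v ^ (1 / (1 - 1 / Q))
        = (Set.Ici R).indicator (fun v => ENNReal.ofReal (v ^ (-2 : ℝ))) v := fun v hv => by
      by_cases hv' : v ∈ Set.Ici R
      · have hv0 : 0 < v := hRpos.trans_le hv'
        rw [hw, Set.indicator_of_mem hv', Set.indicator_of_mem hv',
          ENNReal.ofReal_rpow_of_nonneg (by positivity) (by positivity), ← Real.rpow_mul hv]
        congr 2
        have : γ = 2 * (1 - 1 / Q) := by rw [hγ]; ring
        rw [this, neg_mul, mul_assoc, mul_one_div_cancel hq0.ne', mul_one]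
      · rw [hw, Set.indicator_of_notMem hv', Set.indicator_of_notMem hv',
          ENNReal.zero_rpow_of_pos (by positivity)]
    simp only [e3 _ (abs_nonneg _)]
    rw [lintegral_sub_right_eq_self (fun s => (Set.Ici R).indicator
      (fun v => ENNReal.ofReal (v ^ (-2 : ℝ))) |s|) t]
    refine (ENNReal.rpow_le_rpow (lintegral_far_le hRpos) hq0.le).trans (le_of_eq ?_)
    rw [ENNReal.mul_rpow_of_nonneg _ _ hq0.le, hRR, ← ENNReal.rpow_mul _ (-1)]
    congr 2; ring
  calc ∫⁻ s, min (f s) h * ENNReal.ofReal (|s - t| ^ (-γ))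
      ≤ ∫⁻ s, (h * n |s - t| + f s * w |s - t|) := lintegral_mono hsplit
    _ = (h * ∫⁻ s, n |s - t|) + ∫⁻ s, f s * w |s - t| := by
      rw [lintegral_add_left (mnt.const_mul h), lintegral_const_mul _ mnt]
    _ ≤ h * (2 * ENNReal.ofReal (1 / (1 - γ)) * ((N / h) ^ Q) ^ (1 - γ))
        + N * (2 ^ (1 - 1 / Q) * ((N / h) ^ Q) ^ (-(1 - 1 / Q))) :=
      add_le_add (mul_le_mul_right e1 h) e2
    _ = _ := by
      have a1 : Q * (1 - γ) = 2 - Q := by rw [hγ]; field_simp; ring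
      have a2 : Q * (-(1 - 1 / Q)) = 1 - Q := by field_simp; ring
      rw [← ENNReal.rpow_mul, ← ENNReal.rpow_mul, a1, a2, hdiv, hdiv]
      have b1 : h ^ (Q - 1) = h * h ^ (-(2 - Q)) := by
        nth_rw 2 [← ENNReal.rpow_one h]
        rw [← ENNReal.rpow_add _ _ hh hh']; congr 1; ring
      have b2 : N ^ (2 - Q) = N * N ^ (1 - Q) := by
        nth_rw 2 [← ENNReal.rpow_one N]
        rw [← ENNReal.rpow_add _ _ hN hN']; congr 1; ring
      have b3 : -(1 - Q) = Q - 1 := by ring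
      rw [add_mul, b3]
      congr 1
      · rw [b1]; ring
      · rw [b2]; ring

/-- A quadratic form of the one-dimensional Hardy–Littlewood–Sobolev inequality. -/
lemma exists_hls {Q : ℝ} (h1 : 1 < Q) (h2 : Q < 2) :
    ∃ C : ℝ≥0∞, C ≠ ∞ ∧ ∀ f : ℝ → ℝ≥0∞, Measurable f → (∀ t, f t ≠ ∞) → ∫⁻ t, f t ^ Q ≠ ∞ →
      ∫⁻ t, ∫⁻ s, f s * f t * ENNReal.ofReal (|s - t| ^ (-(2 - 2 / Q)))
        ≤ C * (∫⁻ t, f t ^ Q) ^ (2 / Q) := by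
  have hQ : 0 < Q := by linarith
  set C₀ : ℝ≥0∞ := 2 * ENNReal.ofReal (1 / (1 - (2 - 2 / Q))) + 2 ^ (1 - 1 / Q) with hC₀
  have hC₀t : C₀ ≠ ∞ := ENNReal.add_ne_top.2 ⟨ENNReal.mul_ne_top (by norm_num)
    ENNReal.ofReal_ne_top, two_rpow_ne_top _⟩
  refine ⟨2 * C₀, ENNReal.mul_ne_top (by norm_num) hC₀t, fun f hf hfin hint => ?_⟩
  set k : ℝ → ℝ → ℝ≥0∞ := fun s t => ENNReal.ofReal (|s - t| ^ (-(2 - 2 / Q))) with hk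
  have hksymm : ∀ s t, k s t = k t s := fun s t => by simp only [hk, abs_sub_comm]
  have mk : Measurable fun z : ℝ × ℝ => k z.1 z.2 :=
    ENNReal.measurable_ofReal.comp (Measurable.pow_const (by fun_prop) _)
  set N := (∫⁻ s, f s ^ Q) ^ (1 / Q) with hN
  have hNt : N ≠ ∞ := ENNReal.rpow_ne_top_of_nonneg (by positivity) hint
  have hNQ : N ^ Q = ∫⁻ s, f s ^ Q := by
    rw [hN, ← ENNReal.rpow_mul, one_div_mul_cancel hQ.ne', ENNReal.rpow_one]
  have half : ∫⁻ t, ∫⁻ s, min (f s) (f t) * f t * k s t ≤ C₀ * N ^ (2 : ℝ) := by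
    by_cases hN0 : N = 0
    · have : ∫⁻ s, f s ^ Q = 0 := by rw [← hNQ, hN0, ENNReal.zero_rpow_of_pos hQ]
      rw [lintegral_eq_zero_iff (hf.pow_const Q)] at this
      have hz : ∫⁻ t, ∫⁻ s, min (f s) (f t) * f t * k s t = 0 := by
        rw [← lintegral_zero (μ := (volume : Measure ℝ))]
        refine lintegral_congr_ae ?_
        filter_upwards [this] with t ht
        have : f t = 0 := by simpa [hQ, hQ.not_gt] using ht
        simp [this]
      rw [hz]; exact zero_le
    have slice : ∀ t, ∫⁻ s, min (f s) (f t) * f t * k s t ≤ C₀ * N ^ (2 - Q) * f t ^ Q := fun t => by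
      by_cases h0 : f t = 0
      · simp [h0]
      have e : ∫⁻ s, min (f s) (f t) * f t * k s t = f t * ∫⁻ s, min (f s) (f t) * k s t := by
        rw [← lintegral_const_mul' _ _ (hfin t)]
        refine lintegral_congr fun s => ?_
        ring
      rw [e]
      refine (mul_le_mul_right (hls_slice h1 h2 hf h0 (hfin t) hN0 hNt rfl t) _).trans
        (le_of_eq ?_)
      have : f t ^ Q = f t * f t ^ (Q - 1) := by
        nth_rw 2 [← ENNReal.rpow_one (f t)]
        rw [← ENNReal.rpow_add _ _ h0 (hfin t)]; congr 1; ring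
      rw [this, hC₀]; ring
    refine (lintegral_mono slice).trans (le_of_eq ?_)
    rw [lintegral_const_mul _ (hf.pow_const Q), ← hNQ, mul_assoc,
      ← ENNReal.rpow_add _ _ hN0 hNt]
    congr 2; ring
  have mF : Measurable (Function.uncurry fun t s => min (f s) (f t) * f t * k s t) :=
    (((hf.comp measurable_snd).min (hf.comp measurable_fst)).mul (hf.comp measurable_fst)).mul
      (mk.comp measurable_swap)
  have mF' : Measurable (Function.uncurry fun t s => min (f t) (f s) * f s * k t s) :=
    mF.comp measurable_swap
  calc ∫⁻ t, ∫⁻ s, f s * f t * k s t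
      ≤ ∫⁻ t, ∫⁻ s, (min (f s) (f t) * f t * k s t + min (f t) (f s) * f s * k t s) := by
        refine lintegral_mono fun t => lintegral_mono fun s => ?_
        rcases le_total (f s) (f t) with h | h
        · refine le_trans ?_ le_self_add
          rw [min_eq_left h]
        · refine le_trans ?_ le_add_self
          simp only
          rw [min_eq_left h, hksymm t s, mul_comm (f t)]
    _ = (∫⁻ t, ∫⁻ s, min (f s) (f t) * f t * k s t)
        + ∫⁻ t, ∫⁻ s, min (f t) (f s) * f s * k t s := by
        have mI : Measurable fun t => ∫⁻ s, min (f s) (f t) * f t * k s t :=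
          mF.lintegral_prod_right'
        rw [← lintegral_add_left mI]
        refine lintegral_congr fun t => ?_
        exact lintegral_add_left (mF.comp measurable_prodMk_left) _
    _ = 2 * ∫⁻ t, ∫⁻ s, min (f s) (f t) * f t * k s t := by
        rw [lintegral_lintegral_swap mF'.aemeasurable, two_mul]
    _ ≤ 2 * (C₀ * N ^ (2 : ℝ)) := by gcongr
    _ = 2 * C₀ * (∫⁻ t, f t ^ Q) ^ (2 / Q) := by
        rw [hN, ← ENNReal.rpow_mul, mul_assoc]; congr 3; ring

end Plate

namespace Plate

variable {d : ℕ}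

lemma exists_tform_le (d : ℕ) {p : ℝ} (h1 : 1 ≤ p) (h2 : p ≤ 2) :
    ∃ C : ℝ≥0∞, C ≠ ∞ ∧ ∀ κ : ℝ, Real.pi ≤ |κ| → ∀ G H : ℝ → Ed d → ℂ, Tst G → Tst H →
      ∀ s t : ℝ, s ≠ t → ‖tform κ G H s t‖ₑ
        ≤ C * ENNReal.ofReal (|s - t| ^ (-((d : ℝ) / 2 * (2 / p - 1)))) *
          (nr p (G s) * nr p (H t)) := by
  obtain ⟨C, hC, h⟩ := exists_propForm_interp d h1 h2
  refine ⟨C, hC, fun κ hκ G H hG hH s t hst => ?_⟩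
  have hst' : s - t ≠ 0 := sub_ne_zero.2 hst
  have hκ0 : 0 < |κ| := Real.pi_pos.trans_le hκ
  have hp : 0 ≤ 2 / p - 1 := by
    have : 1 ≤ 2 / p := by rw [le_div_iff₀ (by linarith)]; linarith
    linarith
  refine (h (κ * (s - t)) (mul_ne_zero (abs_pos.1 hκ0) hst') _ _ (hG.good s)
    (hH.good t)).trans ?_
  gcongr
  have ht : 0 < |s - t| := abs_pos.2 hst'
  have e : Real.pi / |κ * (s - t)| ≤ |s - t|⁻¹ := by
    rw [abs_mul, div_le_iff₀ (by positivity)]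
    calc Real.pi ≤ |κ| := hκ
      _ = |s - t|⁻¹ * (|κ| * |s - t|) := by field_simp
  rw [ENNReal.ofReal_rpow_of_nonneg (by positivity) hp]
  refine ENNReal.ofReal_le_ofReal ?_
  rw [Real.rpow_neg ht.le, ← Real.inv_rpow ht.le, Real.rpow_mul (by positivity)]
  gcongr

/-- Boundedness of `totalEvol` from `L^Q_t L^p_x` to `L²`, uniformly in `|κ| ≥ π`. -/
def EnergyBound (d : ℕ) (Q p : ℝ) : Prop :=
  ∃ C : ℝ≥0∞, C ≠ ∞ ∧ ∀ κ : ℝ, Real.pi ≤ |κ| → ∀ G : ℝ → Ed d → ℂ, Tst G →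
    eLpNorm (totalEvol κ G) 2 volume ≤ C * nrT Q p G

lemma energyBound_one_two (d : ℕ) : EnergyBound d 1 2 := by
  refine ⟨1, by norm_num, fun κ _ G hG => ?_⟩
  rw [← ENNReal.rpow_le_rpow_iff two_pos, one_mul]
  refine (eLpNorm_totalEvol_sq_le hG).trans ?_
  have hm := measurable_nr hG.meas 2
  calc ∫⁻ t, ∫⁻ s, ‖tform κ G G s t‖ₑ ≤ ∫⁻ t, ∫⁻ s, nr 2 (G s) * nr 2 (G t) :=
        lintegral_mono fun t => lintegral_mono fun s => propForm_energy _ (hG.good s) (hG.good t)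
    _ = (∫⁻ s, nr 2 (G s)) * ∫⁻ t, nr 2 (G t) := by
        simp_rw [lintegral_mul_const _ hm]
        rw [lintegral_const_mul _ hm]
    _ = nrT 1 2 G ^ (2 : ℝ) := by
        simp [nrT, sq]

lemma energyBound_of_hls (d : ℕ) {Q p : ℝ} (h1 : 1 ≤ p) (h2 : p < 2) (hQ1 : 1 < Q) (hQ2 : Q < 2)
    (he : 2 - 2 / Q = d / 2 * (2 / p - 1)) : EnergyBound d Q p := by
  obtain ⟨C₁, hC₁, H1⟩ := exists_tform_le d h1 h2.le
  obtain ⟨C₂, hC₂, H2⟩ := exists_hls hQ1 hQ2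
  have hQ : 0 < Q := by linarith
  have hp : 0 < p := by linarith
  refine ⟨(C₁ * C₂) ^ (1 / 2 : ℝ), ENNReal.rpow_ne_top_of_nonneg (by norm_num)
    (ENNReal.mul_ne_top hC₁ hC₂), fun κ hκ G hG => ?_⟩
  rw [← ENNReal.rpow_le_rpow_iff two_pos, ENNReal.mul_rpow_of_nonneg _ _ two_pos.le,
    ← ENNReal.rpow_mul, one_div_mul_cancel two_ne_zero, ENNReal.rpow_one]
  refine (eLpNorm_totalEvol_sq_le hG).trans ?_
  have key : ∫⁻ t, ∫⁻ s, ‖tform κ G G s t‖ₑ ≤ ∫⁻ t, ∫⁻ s, C₁ *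
      (nr p (G s) * nr p (G t) * ENNReal.ofReal (|s - t| ^ (-(2 - 2 / Q)))) := by
    refine lintegral_mono fun t => lintegral_mono_ae ?_
    filter_upwards [compl_mem_ae_iff.2 (measure_singleton t)] with s hs
    refine (H1 κ hκ G G hG hG s t hs).trans (le_of_eq ?_)
    rw [he]; ring
  refine key.trans ?_
  simp_rw [lintegral_const_mul' _ _ hC₁]
  rw [mul_assoc]
  gcongr
  refine (H2 _ (measurable_nr hG.meas p) (fun t => (hG.good t).nr_ne_top hp)
    (hG.lintegral_nr_ne_top hp hQ)).trans (le_of_eq ?_)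
  rw [nrT, ← ENNReal.rpow_mul]
  congr 2; ring

end Plate

namespace Plate

open scoped ComplexConjugate Topology

variable {d : ℕ}

/-- The `TT*` form restricted to a set of pairs of times. -/
def bform (κ : ℝ) (S : Set (ℝ × ℝ)) (G H : ℝ → Ed d → ℂ) : ℂ :=
  ∫ z in S, tform κ G H z.1 z.2

/-- Pairs of times with difference in `J`. -/
def band (J : Set ℝ) : Set (ℝ × ℝ) := {z | z.1 - z.2 ∈ J}

lemma measurableSet_band {J : Set ℝ} (hJ : MeasurableSet J) : MeasurableSet (band J) :=
  hJ.preimage (measurable_fst.sub measurable_snd)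

lemma lintegral_band_left {J : Set ℝ} (hJ : MeasurableSet J) {φ : ℝ → ℝ≥0∞} (hφ : Measurable φ) :
    ∫⁻ z in band J, φ z.1 = volume J * ∫⁻ s, φ s := by
  rw [← lintegral_indicator (measurableSet_band hJ), Measure.volume_eq_prod, lintegral_prod _
    (by exact ((hφ.comp measurable_fst).indicator (measurableSet_band hJ)).aemeasurable),
    ← lintegral_const_mul _ hφ]
  refine lintegral_congr fun s => ?_
  have e : ∀ t, (band J).indicator (fun z : ℝ × ℝ => φ z.1) (s, t)
      = ((fun t => s - t) ⁻¹' J).indicator (fun _ => φ s) t := fun t => by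
    by_cases h : s - t ∈ J
    · rw [Set.indicator_of_mem (show (s, t) ∈ band J from h), Set.indicator_of_mem (by exact h)]
    · rw [Set.indicator_of_notMem (show (s, t) ∉ band J from h),
        Set.indicator_of_notMem (by exact h)]
  simp only [e]
  have v : volume ((fun t => s - t) ⁻¹' J) = volume J :=
    (Measure.measurePreserving_sub_left volume s).measure_preimage hJ.nullMeasurableSet
  rw [lintegral_indicator_const (hJ.preimage (by fun_prop)), mul_comm, v]

lemma lintegral_band_right {J : Set ℝ} (hJ : MeasurableSet J) {φ : ℝ → ℝ≥0∞} (hφ : Measurable φ) :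
    ∫⁻ z in band J, φ z.2 = volume J * ∫⁻ s, φ s := by
  rw [← lintegral_indicator (measurableSet_band hJ), Measure.volume_eq_prod, lintegral_prod_symm _
    (by exact ((hφ.comp measurable_snd).indicator (measurableSet_band hJ)).aemeasurable),
    ← lintegral_const_mul _ hφ]
  refine lintegral_congr fun t => ?_
  have e : ∀ s, (band J).indicator (fun z : ℝ × ℝ => φ z.2) (s, t)
      = ((fun s => s - t) ⁻¹' J).indicator (fun _ => φ t) s := fun s => by
    by_cases h : s - t ∈ J
    · rw [Set.indicator_of_mem (show (s, t) ∈ band J from h), Set.indicator_of_mem (by exact h)]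
    · rw [Set.indicator_of_notMem (show (s, t) ∉ band J from h),
        Set.indicator_of_notMem (by exact h)]
  simp only [e]
  rw [lintegral_indicator_const (hJ.preimage (by fun_prop)), mul_comm,
    (measurePreserving_sub_right volume t).measure_preimage hJ.nullMeasurableSet]

variable {κ : ℝ} {G H : ℝ → Ed d → ℂ}

lemma propForm_zero_left (τ : ℝ) (h : Ed d → ℂ) : propForm τ 0 h = 0 := by
  simp [propForm, Real.fourier_eq']

lemma tform_indicator (A : Set ℝ) (s t : ℝ) :
    tform κ (A.indicator G) H s t = A.indicator (fun s => tform κ G H s t) s := by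
  by_cases h : s ∈ A
  · rw [Set.indicator_of_mem h, tform, Set.indicator_of_mem h, tform]
  · rw [Set.indicator_of_notMem h, tform, Set.indicator_of_notMem h, propForm_zero_left]

lemma Tst.integrableOn_tform (hG : Tst G) (hH : Tst H) (S : Set (ℝ × ℝ)) :
    IntegrableOn (fun z : ℝ × ℝ => tform κ G H z.1 z.2) S volume :=
  (integrable_tform hG hH).integrableOn

lemma enorm_bform_band_le (hG : Tst G) (hH : Tst H) {J : Set ℝ} (hJ : MeasurableSet J) :
    ‖bform κ (band J) G H‖ₑ ≤ ∫⁻ t,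
      eLpNorm (totalEvol κ (((fun s => s - t) ⁻¹' J).indicator G)) 2 volume * nr 2 (H t) := by
  have e : bform κ (band J) G H
      = ∫ t, ∫ s, tform κ (((fun s => s - t) ⁻¹' J).indicator G) H s t := by
    rw [bform, ← integral_indicator (measurableSet_band hJ), Measure.volume_eq_prod,
      integral_prod_symm _ (by exact (integrable_tform hG hH).indicator (measurableSet_band hJ))]
    refine integral_congr_ae (ae_of_all _ fun t => integral_congr_ae (ae_of_all _ fun s => ?_))
    simp only [tform_indicator]
    by_cases h : s - t ∈ J
    · rw [Set.indicator_of_mem (show (s, t) ∈ band J from h), Set.indicator_of_mem (by exact h)]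
    · rw [Set.indicator_of_notMem (show (s, t) ∉ band J from h),
        Set.indicator_of_notMem (by exact h)]
  rw [e]
  refine (enorm_integral_le_lintegral_enorm _).trans (lintegral_mono fun t => ?_)
  exact enorm_integral_tform_left_le (hG.cut (hJ.preimage (by fun_prop))) hH t

lemma nrT_indicator {Q p : ℝ} (hQ : 0 < Q) (hp : 0 < p) {A : Set ℝ} (hA : MeasurableSet A) :
    nrT Q p (A.indicator G) = (∫⁻ s in A, nr p (G s) ^ Q) ^ (1 / Q) := by
  rw [nrT, ← lintegral_indicator hA]
  congr 1
  refine lintegral_congr fun s => ?_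
  by_cases h : s ∈ A
  · rw [Set.indicator_of_mem h, Set.indicator_of_mem h]
  · rw [Set.indicator_of_notMem h, Set.indicator_of_notMem h]
    simp [nr, hp, hQ]

lemma nrT_indicator_le (hG : Tst G) {Q p : ℝ} (hQ : 0 < Q) (hQ2 : Q < 2) (hp : 0 < p) {A : Set ℝ}
    (hA : MeasurableSet A) : nrT Q p (A.indicator G)
      ≤ (∫⁻ s in A, nr p (G s) ^ (2 : ℝ)) ^ (1 / 2 : ℝ) * volume A ^ (1 / Q - 1 / 2) := by
  rw [nrT_indicator hQ hp hA]
  have hr : 0 < 1 / Q - 1 / 2 := by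
    have := one_div_lt_one_div_of_lt hQ hQ2; linarith
  have := ENNReal.lintegral_Lp_mul_le_Lq_mul_Lr (r := 1 / (1 / Q - 1 / 2)) hQ hQ2
    (by rw [one_div_one_div]; ring) (volume.restrict A)
    (measurable_nr hG.meas p).aemeasurable (g := fun _ => 1) aemeasurable_const
  simpa using this

lemma enorm_bform_band_energy (hG : Tst G) (hH : Tst H) {J : Set ℝ} (hJ : MeasurableSet J)
    {Q p : ℝ} (hQ : 0 < Q) (hQ2 : Q < 2) (hp : 0 < p) {C : ℝ≥0∞}
    (hC : ∀ G : ℝ → Ed d → ℂ, Tst G → eLpNorm (totalEvol κ G) 2 volume ≤ C * nrT Q p G) :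
    ‖bform κ (band J) G H‖ₑ ≤ C * volume J ^ (1 / Q) * (nrT 2 p G * nrT 2 2 H) := by
  have hr : 0 < 1 / Q - 1 / 2 := by
    have := one_div_lt_one_div_of_lt hQ hQ2; linarith
  have mA : ∀ t : ℝ, MeasurableSet ((fun s => s - t) ⁻¹' J) := fun t => hJ.preimage (by fun_prop)
  have vA : ∀ t : ℝ, volume ((fun s => s - t) ⁻¹' J) = volume J := fun t =>
    (measurePreserving_sub_right volume t).measure_preimage hJ.nullMeasurableSet
  set L : ℝ → ℝ≥0∞ := fun t => ∫⁻ s in (fun s => s - t) ⁻¹' J, nr p (G s) ^ (2 : ℝ) with hL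
  have eL : L = fun t => ∫⁻ s, (band J).indicator (fun z : ℝ × ℝ => nr p (G z.1) ^ (2 : ℝ)) (s, t) := by
    ext t
    simp only [hL]
    rw [← lintegral_indicator (mA t)]
    refine lintegral_congr fun s => ?_
    by_cases h : s - t ∈ J
    · rw [Set.indicator_of_mem (show (s, t) ∈ band J from h), Set.indicator_of_mem (by exact h)]
    · rw [Set.indicator_of_notMem (show (s, t) ∉ band J from h),
        Set.indicator_of_notMem (by exact h)]
  have mg : Measurable fun s => nr p (G s) ^ (2 : ℝ) := (measurable_nr hG.meas p).pow_const _
  have mi : Measurable ((band J).indicator (fun z : ℝ × ℝ => nr p (G z.1) ^ (2 : ℝ))) :=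
    (mg.comp measurable_fst).indicator (measurableSet_band hJ)
  have mL : Measurable L := by rw [eL]; exact mi.lintegral_prod_left'
  have iL : ∫⁻ t, L t = volume J * ∫⁻ s, nr p (G s) ^ (2 : ℝ) := by
    rw [← lintegral_band_left hJ mg, ← lintegral_indicator (measurableSet_band hJ),
      Measure.volume_eq_prod, lintegral_prod_symm' _ mi, eL]
  have step : ∫⁻ t, L t ^ (1 / 2 : ℝ) * nr 2 (H t)
      ≤ volume J ^ (1 / 2 : ℝ) * nrT 2 p G * nrT 2 2 H := by
    refine (ENNReal.lintegral_mul_le_Lp_mul_Lq volume Real.HolderConjugate.two_two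
      (mL.pow_const _).aemeasurable (measurable_nr hH.meas 2).aemeasurable).trans (le_of_eq ?_)
    have : ∀ t, (L t ^ (1 / 2 : ℝ)) ^ (2 : ℝ) = L t := fun t => by
      rw [← ENNReal.rpow_mul]; norm_num
    simp only [this]
    rw [iL, ENNReal.mul_rpow_of_nonneg _ _ (by norm_num)]
    rfl
  calc ‖bform κ (band J) G H‖ₑ
      ≤ ∫⁻ t, C * volume J ^ (1 / Q - 1 / 2) * (L t ^ (1 / 2 : ℝ) * nr 2 (H t)) := by
        refine (enorm_bform_band_le hG hH hJ).trans (lintegral_mono fun t => ?_)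
        refine (mul_le_mul_left ((hC _ (hG.cut (mA t))).trans
          (mul_le_mul_right (nrT_indicator_le hG hQ hQ2 hp (mA t)) C)) _).trans (le_of_eq ?_)
        rw [vA]; ring
    _ = C * volume J ^ (1 / Q - 1 / 2) * ∫⁻ t, L t ^ (1 / 2 : ℝ) * nr 2 (H t) :=
        lintegral_const_mul _ ((mL.pow_const _).mul (measurable_nr hH.meas 2))
    _ ≤ C * volume J ^ (1 / Q - 1 / 2) * (volume J ^ (1 / 2 : ℝ) * nrT 2 p G * nrT 2 2 H) := by
        gcongr
    _ = C * volume J ^ (1 / Q) * (nrT 2 p G * nrT 2 2 H) := by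
        have : volume J ^ (1 / Q) = volume J ^ (1 / Q - 1 / 2) * volume J ^ (1 / 2 : ℝ) := by
          rw [← ENNReal.rpow_add_of_nonneg _ _ hr.le (by norm_num)]; congr 1; ring
        rw [this]; ring

lemma conj_bform_band {J : Set ℝ} (hJ : MeasurableSet J) :
    conj (bform κ (band J) G H) = bform κ (band (-J)) H G := by
  rw [bform, bform, ← integral_conj, ← integral_indicator (measurableSet_band hJ),
    ← integral_indicator (measurableSet_band hJ.neg), Measure.volume_eq_prod,
    ← integral_prod_swap]
  refine integral_congr_ae (ae_of_all _ fun z => ?_)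
  simp only [conj_tform]
  have : z.swap ∈ band J ↔ z ∈ band (-J) := by simp [band]
  by_cases h : z ∈ band (-J)
  · rw [Set.indicator_of_mem h, Set.indicator_of_mem (this.2 h)]; rfl
  · rw [Set.indicator_of_notMem h, Set.indicator_of_notMem (fun h' => h (this.1 h'))]

lemma enorm_bform_band_energy' (hG : Tst G) (hH : Tst H) {J : Set ℝ} (hJ : MeasurableSet J)
    {Q p : ℝ} (hQ : 0 < Q) (hQ2 : Q < 2) (hp : 0 < p) {C : ℝ≥0∞}
    (hC : ∀ G : ℝ → Ed d → ℂ, Tst G → eLpNorm (totalEvol κ G) 2 volume ≤ C * nrT Q p G) :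
    ‖bform κ (band J) G H‖ₑ ≤ C * volume J ^ (1 / Q) * (nrT 2 2 G * nrT 2 p H) := by
  have h := enorm_bform_band_energy hH hG hJ.neg hQ hQ2 hp hC
  rw [← conj_bform_band hJ, Measure.measure_neg, mul_comm (nrT 2 p H)] at h
  simpa [RCLike.enorm_conj] using h

lemma enorm_bform_band_dispersive (hG : Tst G) (hH : Tst H) {J : Set ℝ} (hJ : MeasurableSet J)
    {δ σ : ℝ} (hδ : 0 < δ) (hσ : 0 ≤ σ) (hJδ : ∀ u ∈ J, δ ≤ |u|) {C : ℝ≥0∞}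
    (hC : ∀ s t : ℝ, s ≠ t → ‖tform κ G H s t‖ₑ
        ≤ C * ENNReal.ofReal (|s - t| ^ (-σ)) * (nr 1 (G s) * nr 1 (H t))) :
    ‖bform κ (band J) G H‖ₑ
      ≤ C * ENNReal.ofReal (δ ^ (-σ)) * volume J * (nrT 2 1 G * nrT 2 1 H) := by
  have mg := measurable_nr hG.meas 1
  have mh := measurable_nr hH.meas 1
  have m1 : Measurable fun z : ℝ × ℝ => nr 1 (G z.1) := mg.comp measurable_fst
  have m2 : Measurable fun z : ℝ × ℝ => nr 1 (H z.2) := mh.comp measurable_snd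
  have step : ∫⁻ z in band J, nr 1 (G z.1) * nr 1 (H z.2)
      ≤ volume J * (nrT 2 1 G * nrT 2 1 H) := by
    refine (ENNReal.lintegral_mul_le_Lp_mul_Lq _ Real.HolderConjugate.two_two m1.aemeasurable
      m2.aemeasurable).trans (le_of_eq ?_)
    rw [lintegral_band_left hJ (mg.pow_const _), lintegral_band_right hJ (mh.pow_const _),
      ENNReal.mul_rpow_of_nonneg _ _ (by norm_num), ENNReal.mul_rpow_of_nonneg _ _ (by norm_num)]
    have : volume J = volume J ^ (1 / 2 : ℝ) * volume J ^ (1 / 2 : ℝ) := by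
      rw [← ENNReal.rpow_add_of_nonneg _ _ (by norm_num) (by norm_num)]; norm_num
    nth_rw 3 [this]
    unfold nrT; ring
  calc ‖bform κ (band J) G H‖ₑ ≤ ∫⁻ z in band J, ‖tform κ G H z.1 z.2‖ₑ :=
        enorm_integral_le_lintegral_enorm _
    _ ≤ ∫⁻ z in band J, C * ENNReal.ofReal (δ ^ (-σ)) * (nr 1 (G z.1) * nr 1 (H z.2)) := by
        refine setLIntegral_mono ((m1.mul m2).const_mul _) fun z hz => ?_
        have hz' : δ ≤ |z.1 - z.2| := hJδ _ hz
        refine (hC z.1 z.2 fun h => ?_).trans ?_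
        · rw [h, sub_self, abs_zero] at hz'; linarith
        · gcongr C * ENNReal.ofReal ?_ * _
          rw [Real.rpow_neg hδ.le, Real.rpow_neg (hδ.le.trans hz')]
          gcongr
    _ = C * ENNReal.ofReal (δ ^ (-σ)) * ∫⁻ z in band J, nr 1 (G z.1) * nr 1 (H z.2) :=
        lintegral_const_mul _ (m1.mul m2)
    _ ≤ C * ENNReal.ofReal (δ ^ (-σ)) * (volume J * (nrT 2 1 G * nrT 2 1 H)) := by gcongr
    _ = _ := by ring

end Plate

namespace Plate

open scoped ComplexConjugate Topology

variable {d : ℕ} {κ : ℝ} {G H : ℝ → Ed d → ℂ} {p : ℝ}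

lemma measurableSet_lvl_time (hG : Measurable (Function.uncurry G)) (k : ℤ) :
    MeasurableSet {z : ℝ × Ed d | z.2 ∈ lvl p (G z.1) k} := by
  have m1 : Measurable fun z : ℝ × Ed d => nr p (G z.1) := (measurable_nr hG p).comp measurable_fst
  have m2 : Measurable fun z : ℝ × Ed d => ‖G z.1 z.2‖ₑ := hG.enorm
  exact (measurableSet_lt (m1.mul_const _) m2).inter (measurableSet_le m2 (m1.mul_const _))

/-- The atoms of all time slices at a given level. -/
def atomT (p : ℝ) (G : ℝ → Ed d → ℂ) (k : ℤ) (t : ℝ) : Ed d → ℂ := atom p (G t) k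

/-- The symmetric partial sums of the atomic decomposition of all time slices. -/
def atomSumT (p : ℝ) (G : ℝ → Ed d → ℂ) (K : ℕ) (t : ℝ) : Ed d → ℂ := atomSum p (G t) K

lemma measurable_atomT (hG : Measurable (Function.uncurry G)) (k : ℤ) :
    Measurable (Function.uncurry (atomT p G k)) := by
  have : Function.uncurry (atomT p G k)
      = {z : ℝ × Ed d | z.2 ∈ lvl p (G z.1) k}.indicator (Function.uncurry G) := by
    ext ⟨t, x⟩
    by_cases h : x ∈ lvl p (G t) k
    · rw [Set.indicator_of_mem (by exact h)]
      exact Set.indicator_of_mem h _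
    · rw [Set.indicator_of_notMem (by exact h)]
      exact Set.indicator_of_notMem h _
  rw [this]; exact hG.indicator (measurableSet_lvl_time hG k)

lemma Tst.atomT (hG : Tst G) (k : ℤ) : Tst (atomT p G k) :=
  hG.mono (measurable_atomT hG.meas k) fun _ _ => norm_indicator_le_norm_self _ _

lemma Tst.atomSumT (hG : Tst G) (K : ℕ) : Tst (atomSumT p G K) := by
  refine hG.mono ?_ fun _ _ => norm_atomSum_le _ _
  exact Finset.measurable_sum (Finset.Icc (-(K : ℤ)) K)
    (f := fun k => Function.uncurry (Plate.atomT p G k)) fun k _ => measurable_atomT hG.meas k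

/-- The time integral of the mass at a given level. -/
def massT (p : ℝ) (G : ℝ → Ed d → ℂ) (k : ℤ) : ℝ≥0∞ :=
  ∫⁻ t, nr p (G t) ^ (2 : ℝ) * mass p (G t) k

lemma measurable_mass (hG : Measurable (Function.uncurry G)) (k : ℤ) :
    Measurable fun t => mass p (G t) k := by
  unfold mass
  exact Measurable.const_mul (measurable_measure_prodMk_left (measurableSet_lvl_time hG k)) _

lemma measurable_nr_mul_mass (hG : Measurable (Function.uncurry G)) (k : ℤ) :
    Measurable fun t => nr p (G t) ^ (2 : ℝ) * mass p (G t) k :=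
  ((measurable_nr hG p).pow_const _).mul (measurable_mass hG k)

lemma tsum_massT_le (hG : Tst G) (hp : 0 < p) : ∑' k, massT p G k ≤ nrT 2 p G ^ (2 : ℝ) := by
  unfold massT
  rw [nrT_rpow two_pos, ← lintegral_tsum fun k =>
    (measurable_nr_mul_mass hG.meas k).aemeasurable]
  refine lintegral_mono fun t => ?_
  rw [ENNReal.tsum_mul_left]
  exact (mul_le_mul_right (tsum_mass_le (hG.good t) hp) _).trans (mul_one _).le

lemma nrT_atomT_le (hG : Tst G) (hp : 0 < p) {P : ℝ} (h1 : 1 ≤ P) (h2 : P ≤ 2) (k : ℤ) :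
    nrT 2 P (atomT p G k) ≤ 2 * massT p G k ^ (1 / 2 : ℝ) * 2 ^ ((k : ℝ) * (1 - p / P)) := by
  set c : ℝ≥0∞ := 2 * 2 ^ ((k : ℝ) * (1 - p / P)) with hc
  have h : ∫⁻ t, nr P (atomT p G k t) ^ (2 : ℝ) ≤ c ^ (2 : ℝ) * massT p G k := by
    rw [massT, ← lintegral_const_mul _ (measurable_nr_mul_mass hG.meas k)]
    refine lintegral_mono fun t => ?_
    refine (ENNReal.rpow_le_rpow (nr_atom_le (hG.good t) hp h1 h2 k) two_pos.le).trans
      (le_of_eq ?_)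
    have e : (mass p (G t) k ^ (1 / 2 : ℝ)) ^ (2 : ℝ) = mass p (G t) k := by
      rw [← ENNReal.rpow_mul]; norm_num
    simp only [hc, ENNReal.mul_rpow_of_nonneg _ _ (two_pos.le : (0 : ℝ) ≤ 2), e]
    ring
  refine (ENNReal.rpow_le_rpow h (by norm_num)).trans (le_of_eq ?_)
  rw [ENNReal.mul_rpow_of_nonneg _ _ (by norm_num), ← ENNReal.rpow_mul]
  norm_num [hc]
  ring

lemma bform_atomSumT (hG : Tst G) (hH : Tst H) (S : Set (ℝ × ℝ)) (K : ℕ) :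
    bform κ S (atomSumT p G K) (atomSumT p H K) = ∑ k ∈ Finset.Icc (-(K : ℤ)) K,
      ∑ l ∈ Finset.Icc (-(K : ℤ)) K, bform κ S (atomT p G k) (atomT p H l) := by
  unfold bform
  have e : ∀ z : ℝ × ℝ, tform κ (atomSumT p G K) (atomSumT p H K) z.1 z.2
      = ∑ k ∈ Finset.Icc (-(K : ℤ)) K, ∑ l ∈ Finset.Icc (-(K : ℤ)) K,
        tform κ (atomT p G k) (atomT p H l) z.1 z.2 := fun z =>
    propForm_atomSum _ (hG.good _) (hH.good _) K
  simp only [e]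
  have hi := fun k l => (hG.atomT (p := p) k).integrableOn_tform (κ := κ) (hH.atomT (p := p) l) S
  rw [integral_finsetSum _ fun k _ => integrable_finsetSum _ fun l _ => hi k l]
  exact Finset.sum_congr rfl fun k _ => integral_finsetSum _ fun l _ => hi k l

lemma tendsto_bform_atomSumT (hG : Tst G) (hH : Tst H) (hp : 0 < p) (S : Set (ℝ × ℝ)) :
    Tendsto (fun K => bform κ S (atomSumT p G K) (atomSumT p H K)) atTop (𝓝 (bform κ S G H)) := by
  have hn : ∀ {G : ℝ → Ed d → ℂ}, Tst G → ∀ K t, nr 2 (atomSumT p G K t) ≤ nr 2 (G t) :=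
    fun hG K t => nr_mono two_pos fun x => by
      rw [← ofReal_norm, ← ofReal_norm]
      exact ENNReal.ofReal_le_ofReal (norm_atomSum_le K x)
  have hint : Integrable (fun z : ℝ × ℝ => (nr 2 (G z.1)).toReal * (nr 2 (H z.2)).toReal)
      (volume.prod volume) := by
    have h : ∀ {G : ℝ → Ed d → ℂ}, Tst G → Integrable fun t => (nr 2 (G t)).toReal := fun hG =>
      integrable_toReal_of_lintegral_ne_top (measurable_nr hG.meas 2).aemeasurable
        (by simpa using hG.lintegral_nr_ne_top two_pos one_pos)
    exact (h hG).mul_prod (h hH)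
  refine tendsto_integral_of_dominated_convergence
    (fun z : ℝ × ℝ => (nr 2 (G z.1)).toReal * (nr 2 (H z.2)).toReal) (fun K => ?_)
    hint.integrableOn (fun K => ae_of_all _ fun z => ?_)
    (ae_of_all _ fun z => tendsto_propForm_atomSum _ (hG.good _) (hH.good _) hp)
  · exact (stronglyMeasurable_tform (hG.atomSumT K).meas (hH.atomSumT K).meas).aestronglyMeasurable
  · have h1 := (propForm_energy (κ * (z.1 - z.2)) ((hG.atomSumT (p := p) K).good z.1)
      ((hH.atomSumT (p := p) K).good z.2)).trans (mul_le_mul' (hn hG K _) (hn hH K _))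
    have h2 : nr 2 (G z.1) * nr 2 (H z.2) ≠ ∞ :=
      ENNReal.mul_ne_top ((hG.good _).nr_ne_top two_pos) ((hH.good _).nr_ne_top two_pos)
    rw [← ENNReal.toReal_mul, ← toReal_enorm]
    exact ENNReal.toReal_mono h2 h1

lemma enorm_bform_le_tsum_atoms (hG : Tst G) (hH : Tst H) (hp : 0 < p) (S : Set (ℝ × ℝ)) :
    ‖bform κ S G H‖ₑ ≤ ∑' k, ∑' l, ‖bform κ S (atomT p G k) (atomT p H l)‖ₑ := by
  refine le_of_tendsto (tendsto_bform_atomSumT hG hH hp S).enorm (Eventually.of_forall fun K => ?_)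
  rw [bform_atomSumT hG hH]
  refine (enorm_sum_le _ _).trans ((Finset.sum_le_sum fun _ _ => enorm_sum_le _ _).trans ?_)
  exact sum_sum_le_tsum _ _ _

/-- Dyadic intervals of negative time differences. -/
def dyad (j : ℤ) : Set ℝ := Set.Ioc (-(2 ^ ((j : ℝ) + 1))) (-(2 ^ (j : ℝ)))

lemma iUnion_dyad : ⋃ j, dyad j = Set.Iio 0 := by
  ext u
  simp only [Set.mem_iUnion, dyad, Set.mem_Ioc, Set.mem_Iio]
  constructor
  · rintro ⟨j, -, h⟩
    have : (0 : ℝ) < 2 ^ (j : ℝ) := by positivity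
    linarith
  · intro hu
    have hu' : 0 < -u := by linarith
    refine ⟨⌊Real.logb 2 (-u)⌋, ?_, ?_⟩
    · have := Int.lt_floor_add_one (Real.logb 2 (-u))
      rw [Real.logb_lt_iff_lt_rpow (by norm_num) hu'] at this
      linarith
    · have := Int.floor_le (Real.logb 2 (-u))
      rw [Real.le_logb_iff_rpow_le (by norm_num) hu'] at this
      linarith

lemma disjoint_dyad : Pairwise (Function.onFun Disjoint dyad) := by
  have aux : ∀ j l : ℤ, j < l → Disjoint (dyad j) (dyad l) := fun j l h => by
    refine Set.disjoint_left.2 fun u hu hu' => ?_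
    have h1 : ((j : ℝ) + 1) ≤ l := by exact_mod_cast h
    have h2 : (2 : ℝ) ^ ((j : ℝ) + 1) ≤ 2 ^ (l : ℝ) :=
      Real.rpow_le_rpow_of_exponent_le (by norm_num) h1
    have := hu.1
    have := hu'.2
    linarith
  intro j l h
  rcases lt_or_gt_of_ne h with h | h
  · exact aux j l h
  · exact (aux l j h).symm

lemma volume_dyad (j : ℤ) : volume (dyad j) = 2 ^ (j : ℝ) := by
  rw [dyad, Real.volume_Ioc, Real.rpow_add two_pos]
  have : -(2 : ℝ) ^ (j : ℝ) - -(2 ^ (j : ℝ) * 2 ^ (1 : ℝ)) = 2 ^ (j : ℝ) := by norm_num; ring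
  rw [this, ← ENNReal.ofReal_rpow_of_pos two_pos]; simp

lemma enorm_bform_le_tsum_dyad (hG : Tst G) (hH : Tst H) :
    ‖bform κ (band (Set.Iio 0)) G H‖ₑ ≤ ∑' j, ‖bform κ (band (dyad j)) G H‖ₑ := by
  have e : band (Set.Iio 0) = ⋃ j, band (dyad j) := by
    rw [← iUnion_dyad]; ext z; simp [band]
  have := hasSum_integral_iUnion (μ := volume) (f := fun z : ℝ × ℝ => tform κ G H z.1 z.2)
    (s := fun j => band (dyad j)) (fun j => measurableSet_band measurableSet_Ioc)
    (fun j l h => (disjoint_dyad h).preimage _) (hG.integrableOn_tform hH _)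
  rw [e, bform, ← this.tsum_eq]
  exact enorm_tsum_le_tsum_enorm

end Plate

namespace Plate

variable {d : ℕ}

lemma keelTao_exponent_le {c y z : ℝ} (hc : 1 / 2 ≤ c) :
    min (-(c * (y + z))) (min (y / 2 + z) (y + z / 2)) ≤ -(1 / 12 * |y|) + -(1 / 12 * |z|) := by
  by_cases h : (|y| + |z|) / 6 ≤ y + z
  · refine (min_le_left _ _).trans ?_
    have h0 : 0 ≤ y + z := le_trans (by positivity) h
    nlinarith
  · refine (min_le_right _ _).trans ?_
    push Not at h
    rcases le_total 0 y with hy | hy <;> rcases le_total 0 z with hz | hz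
    · rw [abs_of_nonneg hy, abs_of_nonneg hz] at h; linarith
    · refine (min_le_left _ _).trans ?_
      rw [abs_of_nonneg hy, abs_of_nonpos hz] at *; linarith
    · refine (min_le_right _ _).trans ?_
      rw [abs_of_nonpos hy, abs_of_nonneg hz] at *; linarith
    · refine (min_le_left _ _).trans ?_
      rw [abs_of_nonpos hy, abs_of_nonpos hz] at *; linarith

/-- The bilinear endpoint estimate of Keel and Tao. -/
lemma exists_endpoint (d : ℕ) (hd : 3 ≤ d) : ∃ C : ℝ≥0∞, C ≠ ∞ ∧ ∀ κ : ℝ, Real.pi ≤ |κ| →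
    ∀ G H : ℝ → Ed d → ℂ, Tst G → Tst H → ‖bform κ (band (Set.Iio 0)) G H‖ₑ
      ≤ C * (nrT 2 (2 * d / (d + 2)) G * nrT 2 (2 * d / (d + 2)) H) := by
  have hd' : (3 : ℝ) ≤ d := by exact_mod_cast hd
  have hd0 : (0 : ℝ) < d := by linarith
  set p : ℝ := 2 * d / (d + 2) with hpdef
  set P : ℝ := 2 * d / (d + 1) with hPdef
  set θ : ℝ := 2 / (d + 2) with hθ
  have hp : 0 < p := by positivity
  have hP : 0 < P := by positivity
  have hP1 : 1 ≤ P := by rw [hPdef, le_div_iff₀ (by positivity)]; linarith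
  have hP2 : P < 2 := by rw [hPdef, div_lt_iff₀ (by positivity)]; linarith
  have hθ0 : 0 < θ := by positivity
  obtain ⟨C₁, hC₁, H1⟩ := exists_tform_le d le_rfl one_le_two
  obtain ⟨C₂, hC₂, H2⟩ := energyBound_of_hls d (Q := 4 / 3) hP1 hP2 (by norm_num) (by norm_num)
    (by rw [hPdef]; field_simp; ring)
  obtain ⟨A, hA, HA⟩ := exists_tsum_abs_mul_add_le (c := 1 / 12) (a := θ) (by norm_num) hθ0
  obtain ⟨B, hB, HB⟩ := exists_tsum_abs_mul_add_le (c := 1 / 12) (a := 1 / 2) (by norm_num)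
    (by norm_num)
  refine ⟨4 * (C₁ + C₂) * (A * B), ENNReal.mul_ne_top (ENNReal.mul_ne_top (by norm_num)
    (ENNReal.add_ne_top.2 ⟨hC₁, hC₂⟩)) (ENNReal.mul_ne_top hA hB), fun κ hκ G H hG hH => ?_⟩
  have hterm : ∀ k l j : ℤ, ‖bform κ (band (dyad j)) (atomT p G k) (atomT p H l)‖ₑ ≤
      4 * (C₁ + C₂) * (2 ^ (-(1 / 12 * |(k : ℝ) * θ + j * (1 / 2)|)) *
        2 ^ (-(1 / 12 * |(l : ℝ) * θ + j * (1 / 2)|)) *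
          (massT p G k ^ (1 / 2 : ℝ) * massT p H l ^ (1 / 2 : ℝ))) := fun k l j => by
    have hGk := hG.atomT (p := p) k
    have hHl := hH.atomT (p := p) l
    set y : ℝ := k * θ + j * (1 / 2) with hy
    set z : ℝ := l * θ + j * (1 / 2) with hz
    set W := massT p G k ^ (1 / 2 : ℝ) * massT p H l ^ (1 / 2 : ℝ) with hW
    have v : volume (dyad j) ^ (1 / (4 / 3) : ℝ) = 2 ^ ((j : ℝ) * (3 / 4)) := by
      rw [volume_dyad, ← ENNReal.rpow_mul]; norm_num
    have mJ : MeasurableSet (dyad j) := measurableSet_Ioc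
    have b1 : ‖bform κ (band (dyad j)) (atomT p G k) (atomT p H l)‖ₑ
        ≤ 4 * (C₁ + C₂) * W * 2 ^ (-((d / 2 - 1) * (y + z))) := by
      have h2j : (0 : ℝ) < 2 ^ (j : ℝ) := by positivity
      refine (enorm_bform_band_dispersive hGk hHl mJ (σ := d / 2) h2j (by positivity)
        (fun u hu => ?_) (C := C₁) (fun s t hst => ?_)).trans ?_
      · rw [abs_of_nonpos (by have := hu.2; linarith)]; have := hu.2; linarith
      · have := H1 κ hκ _ _ hGk hHl s t hst
        norm_num at this ⊢
        exact this
      · have e : ENNReal.ofReal (((2 : ℝ) ^ (j : ℝ)) ^ (-((d : ℝ) / 2))) = 2 ^ (-((j : ℝ) * (d / 2))) := by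
          rw [← Real.rpow_mul two_pos.le, ← ENNReal.ofReal_rpow_of_pos two_pos]
          simp
        rw [e, volume_dyad]
        refine (mul_le_mul_right (mul_le_mul' (nrT_atomT_le hG hp le_rfl one_le_two k)
          (nrT_atomT_le hH hp le_rfl one_le_two l)) _).trans ?_
        have e2 : -(((d : ℝ) / 2 - 1) * (y + z))
            = -((j : ℝ) * (d / 2)) + j + k * (1 - p / 1) + l * (1 - p / 1) := by
          rw [hy, hz, hθ, hpdef]; field_simp; ring
        rw [e2, two_rpow_add, two_rpow_add, two_rpow_add]
        calc _ = 4 * C₁ * W * (2 ^ (-((j : ℝ) * (d / 2))) * 2 ^ (j : ℝ)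
              * 2 ^ ((k : ℝ) * (1 - p / 1)) * 2 ^ ((l : ℝ) * (1 - p / 1))) := by rw [hW]; ring
          _ ≤ _ := by gcongr; exact le_self_add
    have b2 : ‖bform κ (band (dyad j)) (atomT p G k) (atomT p H l)‖ₑ
        ≤ 4 * (C₁ + C₂) * W * 2 ^ (y / 2 + z) := by
      refine (enorm_bform_band_energy hGk hHl mJ (by norm_num) (by norm_num) hP
        (H2 κ hκ)).trans ?_
      rw [v]
      refine (mul_le_mul_right (mul_le_mul' (nrT_atomT_le hG hp hP1 hP2.le k)
        (nrT_atomT_le hH hp one_le_two le_rfl l)) _).trans ?_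
      have e2 : y / 2 + z = (j : ℝ) * (3 / 4) + k * (1 - p / P) + l * (1 - p / 2) := by
        rw [hy, hz, hθ, hpdef, hPdef]; field_simp; ring
      rw [e2, two_rpow_add, two_rpow_add]
      calc _ = 4 * C₂ * W * (2 ^ ((j : ℝ) * (3 / 4))
            * 2 ^ ((k : ℝ) * (1 - p / P)) * 2 ^ ((l : ℝ) * (1 - p / 2))) := by rw [hW]; ring
        _ ≤ _ := by gcongr; exact le_add_self
    have b3 : ‖bform κ (band (dyad j)) (atomT p G k) (atomT p H l)‖ₑ
        ≤ 4 * (C₁ + C₂) * W * 2 ^ (y + z / 2) := by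
      refine (enorm_bform_band_energy' hGk hHl mJ (by norm_num) (by norm_num) hP
        (H2 κ hκ)).trans ?_
      rw [v]
      refine (mul_le_mul_right (mul_le_mul' (nrT_atomT_le hG hp one_le_two le_rfl k)
        (nrT_atomT_le hH hp hP1 hP2.le l)) _).trans ?_
      have e2 : y + z / 2 = (j : ℝ) * (3 / 4) + k * (1 - p / 2) + l * (1 - p / P) := by
        rw [hy, hz, hθ, hpdef, hPdef]; field_simp; ring
      rw [e2, two_rpow_add, two_rpow_add]
      calc _ = 4 * C₂ * W * (2 ^ ((j : ℝ) * (3 / 4))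
            * 2 ^ ((k : ℝ) * (1 - p / 2)) * 2 ^ ((l : ℝ) * (1 - p / P))) := by rw [hW]; ring
        _ ≤ _ := by gcongr; exact le_add_self
    have b4 : ‖bform κ (band (dyad j)) (atomT p G k) (atomT p H l)‖ₑ ≤ 4 * (C₁ + C₂) * W *
        2 ^ (min (-((d / 2 - 1) * (y + z))) (min (y / 2 + z) (y + z / 2))) := by
      rcases min_choice (-(((d : ℝ) / 2 - 1) * (y + z))) (min (y / 2 + z) (y + z / 2)) with e | e
      · rw [e]; exact b1
      · rw [e]
        rcases min_choice (y / 2 + z) (y + z / 2) with e | e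
        · rw [e]; exact b2
        · rw [e]; exact b3
    refine (b4.trans (mul_le_mul_right (two_rpow_le (keelTao_exponent_le (by linarith))) _)).trans
      (le_of_eq ?_)
    rw [two_rpow_add]; ring
  calc ‖bform κ (band (Set.Iio 0)) G H‖ₑ
      ≤ ∑' k, ∑' l, ‖bform κ (band (Set.Iio 0)) (atomT p G k) (atomT p H l)‖ₑ :=
        enorm_bform_le_tsum_atoms hG hH hp _
    _ ≤ ∑' k, ∑' l, ∑' j, ‖bform κ (band (dyad j)) (atomT p G k) (atomT p H l)‖ₑ :=
        ENNReal.tsum_le_tsum fun k => ENNReal.tsum_le_tsum fun l =>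
          enorm_bform_le_tsum_dyad (hG.atomT k) (hH.atomT l)
    _ ≤ 4 * (C₁ + C₂) * ∑' k : ℤ, ∑' l : ℤ, (∑' j : ℤ,
        2 ^ (-(1 / 12 * |(k : ℝ) * θ + j * (1 / 2)|)) *
        2 ^ (-(1 / 12 * |(l : ℝ) * θ + j * (1 / 2)|))) *
          (massT p G k ^ (1 / 2 : ℝ) * massT p H l ^ (1 / 2 : ℝ)) := by
        simp only [← ENNReal.tsum_mul_left, ← ENNReal.tsum_mul_right]
        exact ENNReal.tsum_le_tsum fun k => ENNReal.tsum_le_tsum fun l =>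
          ENNReal.tsum_le_tsum fun j => hterm k l j
    _ ≤ 4 * (C₁ + C₂) * (A * B *
        ((∑' k, massT p G k) ^ (1 / 2 : ℝ) * (∑' l, massT p H l) ^ (1 / 2 : ℝ))) := by
        have row : ∀ k : ℤ, ∑' l : ℤ, ∑' j : ℤ,
            (2 : ℝ≥0∞) ^ (-(1 / 12 * |(k : ℝ) * θ + j * (1 / 2)|)) *
              2 ^ (-(1 / 12 * |(l : ℝ) * θ + j * (1 / 2)|)) ≤ A * B := fun k => by
          rw [ENNReal.tsum_comm]
          simp only [ENNReal.tsum_mul_left]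
          refine (ENNReal.tsum_le_tsum fun j => mul_le_mul_right (HA _) _).trans ?_
          rw [ENNReal.tsum_mul_right, mul_comm]
          refine mul_le_mul_right ?_ A
          simpa only [add_comm] using HB ((k : ℝ) * θ)
        refine mul_le_mul_right (tsum_weight_le row fun l => ?_) _
        refine le_trans (le_of_eq ?_) (row l)
        exact tsum_congr fun k => tsum_congr fun j => mul_comm _ _
    _ ≤ 4 * (C₁ + C₂) * (A * B * (nrT 2 p G * nrT 2 p H)) := by
        have e : ∀ x : ℝ≥0∞, (x ^ (2 : ℝ)) ^ (1 / 2 : ℝ) = x := fun x => by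
          rw [← ENNReal.rpow_mul]; norm_num
        have h1 := ENNReal.rpow_le_rpow (tsum_massT_le hG hp) (by norm_num : (0 : ℝ) ≤ 1 / 2)
        have h2 := ENNReal.rpow_le_rpow (tsum_massT_le hH hp) (by norm_num : (0 : ℝ) ≤ 1 / 2)
        rw [e] at h1 h2
        gcongr
    _ = _ := by ring

end Plate

namespace Plate

open FourierTransform
open scoped ComplexConjugate Topology

variable {d : ℕ} {G H : ℝ → Ed d → ℂ} {κ : ℝ}

lemma volume_band_zero : volume (band {0}) = 0 := by
  have := lintegral_band_left (measurableSet_singleton (0 : ℝ)) (φ := fun _ => 1) measurable_const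
  simpa using this

lemma integral_tform_split (hG : Tst G) (hH : Tst H) : ∫ z : ℝ × ℝ, tform κ G H z.1 z.2
    = bform κ (band (Set.Iio 0)) G H + bform κ (band (Set.Ioi 0)) G H := by
  have e : (Set.univ : Set (ℝ × ℝ))
      =ᵐ[volume] (band (Set.Iio 0) ∪ band (Set.Ioi 0) : Set (ℝ × ℝ)) := by
    have h : ∀ᵐ z : ℝ × ℝ, z ∉ band {0} := measure_eq_zero_iff_ae_notMem.1 volume_band_zero
    filter_upwards [h] with z hz
    have : z ∈ (band (Set.Iio 0) ∪ band (Set.Ioi 0) : Set (ℝ × ℝ)) := by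
      rcases lt_trichotomy (z.1 - z.2) 0 with h | h | h
      · exact Or.inl h
      · exact absurd h hz
      · exact Or.inr h
    exact propext ⟨fun _ => this, fun _ => trivial⟩
  rw [← setIntegral_univ, setIntegral_congr_set e, setIntegral_union _
    (measurableSet_band measurableSet_Ioi) (hG.integrableOn_tform hH _)
    (hG.integrableOn_tform hH _)]
  · rfl
  · refine Set.disjoint_left.2 fun z h1 h2 => ?_
    exact lt_asymm (show z.1 - z.2 < 0 from h1) (show 0 < z.1 - z.2 from h2)

lemma enorm_bform_Ioi : ‖bform κ (band (Set.Ioi 0)) G H‖ₑ = ‖bform κ (band (Set.Iio 0)) H G‖ₑ := by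
  have h := conj_bform_band (κ := κ) (G := G) (H := H) (measurableSet_Ioi (a := (0 : ℝ)))
  rw [Set.neg_Ioi, neg_zero] at h
  rw [← h, RCLike.enorm_conj]

lemma energyBound_endpoint (d : ℕ) (hd : 3 ≤ d) : EnergyBound d 2 (2 * d / (d + 2)) := by
  obtain ⟨C, hC, h⟩ := exists_endpoint d hd
  refine ⟨(2 * C) ^ (1 / 2 : ℝ), ENNReal.rpow_ne_top_of_nonneg (by norm_num)
    (ENNReal.mul_ne_top (by norm_num) hC), fun κ hκ G hG => ?_⟩
  rw [← ENNReal.rpow_le_rpow_iff two_pos, eLpNorm_totalEvol_sq hG, integral_tform_split hG hG,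
    ENNReal.mul_rpow_of_nonneg _ _ two_pos.le, ← ENNReal.rpow_mul]
  norm_num
  refine (enorm_add_le _ _).trans ?_
  rw [enorm_bform_Ioi, ← two_mul, mul_assoc, pow_two]
  exact mul_le_mul_right (h κ hκ G G hG hG) _

/-- Conjugates of admissible pairs. -/
structure DualAdm (d : ℕ) (Q p : ℝ) : Prop where
  one_le : 1 ≤ Q
  le_two : Q ≤ 2
  one_le' : 1 ≤ p
  le_two' : p ≤ 2
  scaling : 2 - 2 / Q = d / 2 * (2 / p - 1)
  not_excluded : ¬(Q = 2 ∧ p = 1 ∧ d = 2)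

lemma DualAdm.endpoint {p : ℝ} (h : DualAdm d 2 p) : 3 ≤ d ∧ p = 2 * d / (d + 2) := by
  have h1 := h.one_le'
  have hs := h.scaling
  have hp : 0 < p := by linarith
  have e : p * (d + 2) = 2 * d := by field_simp at hs; linarith
  have e2 : p = 2 * d / (d + 2) := by field_simp; exact e
  refine ⟨?_, e2⟩
  by_contra! hlt
  have : d ≤ 2 := by omega
  interval_cases d
  · norm_num at e; linarith
  · norm_num at e; linarith
  · refine h.not_excluded ⟨rfl, ?_, rfl⟩; norm_num at e; linarith

lemma DualAdm.energyBound {Q p : ℝ} (hd : 1 ≤ d) (h : DualAdm d Q p) : EnergyBound d Q p := by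
  have hd' : (0 : ℝ) < d := by exact_mod_cast hd
  have h1 := h.one_le'
  have hs := h.scaling
  have hp : 0 < p := by linarith
  have hQ := h.one_le
  rcases h.one_le.eq_or_lt with rfl | hQ1
  · have : p = 2 := by
      have : 2 / p - 1 = 0 := by
        rcases mul_eq_zero.1 (show (d : ℝ) / 2 * (2 / p - 1) = 0 by linarith) with h | h
        · linarith
        · exact h
      field_simp at this; linarith
    rw [this]; exact energyBound_one_two d
  rcases h.le_two.eq_or_lt with rfl | hQ2
  · obtain ⟨h3, rfl⟩ := h.endpoint
    exact energyBound_endpoint d h3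
  · refine energyBound_of_hls d h1 (h.le_two'.lt_of_ne ?_) hQ1 hQ2 hs
    rintro rfl
    field_simp at hs; linarith

end Plate

namespace Plate

open FourierTransform
open scoped ComplexConjugate Topology

variable {d : ℕ} {G H : ℝ → Ed d → ℂ} {κ : ℝ}

lemma rpow_add_rpow_le {x y β : ℝ} (hx : 0 ≤ x) (hy : 0 ≤ y) (h0 : 0 < β) (h1 : β ≤ 1) :
    x ^ β + y ^ β ≤ 2 ^ (1 - β) * (x + y) ^ β := by
  have h := (Real.concaveOn_rpow h0.le h1).2 (Set.mem_Ici.2 hx) (Set.mem_Ici.2 hy)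
    (by norm_num : (0 : ℝ) ≤ 1 / 2) (by norm_num : (0 : ℝ) ≤ 1 / 2) (by norm_num)
  simp only [smul_eq_mul] at h
  have e : (1 / 2 * x + 1 / 2 * y : ℝ) ^ β = 2 ^ (-β) * (x + y) ^ β := by
    rw [← mul_add, Real.mul_rpow (by norm_num) (by positivity), one_div,
      Real.inv_rpow (by norm_num), Real.rpow_neg (by norm_num)]
  rw [e] at h
  have e2 : (2 : ℝ) ^ (1 - β) = 2 * 2 ^ (-β) := by
    rw [sub_eq_add_neg, Real.rpow_add two_pos, Real.rpow_one]
  rw [e2]; linarith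

/-- One run of the bisection argument, with the error after `n` generations. -/
lemma bisection_step {A B : ℝ → ℝ} {η : ℝ} (hη : 0 < η) (hA : ∀ a b, a ≤ b → η * (b - a) ≤ A b - A a)
    (hAc : Continuous A) (hB : Monotone B) {T : ℝ → ℝ → ℝ} {C M K α β : ℝ} (hC : 0 ≤ C) (hM : 0 ≤ M)
    (hα : 0 < α) (hβ : 0 < β) (hβ1 : β ≤ 1) (hK0 : 0 ≤ K)
    (hK : 1 + K * 2 ^ (1 - α - β) ≤ K)
    (hT0 : ∀ a b, a ≤ b → T a b ≤ M * (b - a) ^ 2)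
    (hT : ∀ a c b, a ≤ c → c ≤ b →
      T a b ≤ T a c + T c b + C * ((A c - A a) ^ α * (B b - B c) ^ β)) (n : ℕ) :
    ∀ a b, a ≤ b → T a b ≤ C * K * ((A b - A a) ^ α * (B b - B a) ^ β)
      + M * (b - a) * ((A b - A a) / η) / 2 ^ n := by
  have mA : ∀ a b, a ≤ b → 0 ≤ A b - A a := fun a b hab =>
    (mul_nonneg hη.le (sub_nonneg.2 hab)).trans (hA a b hab)
  induction n with
  | zero =>
    intro a b hab
    have h1 : b - a ≤ (A b - A a) / η := by rw [le_div_iff₀ hη, mul_comm]; exact hA a b hab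
    have h2 : 0 ≤ C * K * ((A b - A a) ^ α * (B b - B a) ^ β) :=
      mul_nonneg (mul_nonneg hC hK0) (mul_nonneg (Real.rpow_nonneg (mA a b hab) _)
        (Real.rpow_nonneg (sub_nonneg.2 (hB hab)) _))
    have h3 : M * (b - a) * (b - a) ≤ M * (b - a) * ((A b - A a) / η) :=
      mul_le_mul_of_nonneg_left h1 (mul_nonneg hM (sub_nonneg.2 hab))
    have := hT0 a b hab
    rw [pow_zero, div_one]; nlinarith
  | succ n ih =>
    intro a b hab
    obtain ⟨c, ⟨hac, hcb⟩, hc⟩ : ∃ c ∈ Set.Icc a b, A c = (A a + A b) / 2 :=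
      intermediate_value_Icc hab hAc.continuousOn
        ⟨by linarith [mA a b hab], by linarith [mA a b hab]⟩
    have i1 := ih a c hac
    have i2 := ih c b hcb
    have e1 : A c - A a = (A b - A a) / 2 := by rw [hc]; ring
    have e2 : A b - A c = (A b - A a) / 2 := by rw [hc]; ring
    have i3 := hT a c b hac hcb
    rw [e1] at i1 i3
    rw [e2] at i2
    set X := A b - A a with hX
    have X0 : 0 ≤ X := mA a b hab
    have x1 : 0 ≤ B c - B a := sub_nonneg.2 (hB hac)
    have x2 : 0 ≤ B b - B c := sub_nonneg.2 (hB hcb)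
    have hs := rpow_add_rpow_le x1 x2 hβ hβ1
    rw [sub_add_sub_cancel'] at hs
    have hb : (B b - B c) ^ β ≤ (B b - B a) ^ β :=
      Real.rpow_le_rpow x2 (by linarith) hβ.le
    have p1 : (X / 2) ^ α = 2 ^ (-α) * X ^ α := by
      rw [Real.div_rpow X0 two_pos.le, Real.rpow_neg two_pos.le]; field_simp
    have p2 : (X / 2) ^ α ≤ X ^ α := Real.rpow_le_rpow (by linarith) (by linarith) hα.le
    have Y0 : 0 ≤ (B b - B a) ^ β := Real.rpow_nonneg (by linarith) _
    have Xα : 0 ≤ X ^ α := Real.rpow_nonneg X0 _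
    have m1 : C * K * ((X / 2) ^ α * (B c - B a) ^ β) + C * K * ((X / 2) ^ α * (B b - B c) ^ β)
        ≤ C * (K * 2 ^ (1 - α - β)) * (X ^ α * (B b - B a) ^ β) := by
      have e : (2 : ℝ) ^ (1 - α - β) = 2 ^ (-α) * 2 ^ (1 - β) := by
        rw [← Real.rpow_add two_pos]; ring_nf
      rw [e, p1, ← mul_add, ← mul_add]
      calc C * K * (2 ^ (-α) * X ^ α * ((B c - B a) ^ β + (B b - B c) ^ β))
          ≤ C * K * (2 ^ (-α) * X ^ α * (2 ^ (1 - β) * (B b - B a) ^ β)) := by gcongr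
        _ = _ := by ring
    have m2 : C * ((X / 2) ^ α * (B b - B c) ^ β) ≤ C * (X ^ α * (B b - B a) ^ β) := by
      have : 0 ≤ (B b - B c) ^ β := Real.rpow_nonneg x2 _
      gcongr
    have m3 : C * (1 + K * 2 ^ (1 - α - β)) * (X ^ α * (B b - B a) ^ β)
        ≤ C * K * (X ^ α * (B b - B a) ^ β) := by gcongr
    have er : M * (c - a) * (X / 2 / η) / 2 ^ n + M * (b - c) * (X / 2 / η) / 2 ^ n
        = M * (b - a) * (X / η) / 2 ^ (n + 1) := by rw [pow_succ]; field_simp; ring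
    linarith

/-- The bisection form of the Christ–Kiselev lemma. -/
lemma christ_kiselev {A B : ℝ → ℝ} (hA : Monotone A) (hAc : Continuous A) (hB : Monotone B)
    {T : ℝ → ℝ → ℝ} {C M K α β : ℝ} (hC : 0 ≤ C) (hM : 0 ≤ M)
    (hα : 0 < α) (hβ : 0 < β) (hβ1 : β ≤ 1) (hK0 : 0 ≤ K) (hK : 1 + K * 2 ^ (1 - α - β) ≤ K)
    (hT0 : ∀ a b, a ≤ b → T a b ≤ M * (b - a) ^ 2)
    (hT : ∀ a c b, a ≤ c → c ≤ b →
      T a b ≤ T a c + T c b + C * ((A c - A a) ^ α * (B b - B c) ^ β)) {a b : ℝ} (hab : a ≤ b) :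
    T a b ≤ C * K * ((A b - A a) ^ α * (B b - B a) ^ β) := by
  have key : ∀ η > 0, T a b ≤ C * K * ((A b + η * b - (A a + η * a)) ^ α * (B b - B a) ^ β) := by
    intro η hη
    have h : ∀ n : ℕ, T a b ≤ _ := fun n => bisection_step (A := fun t => A t + η * t) hη
      (fun a b hab => by linarith [hA hab]) (by fun_prop) hB hC hM hα hβ hβ1 hK0 hK hT0
      (fun a c b hac hcb => (hT a c b hac hcb).trans ?_) n a b hab
    · refine ge_of_tendsto' (x := atTop) (f := fun n : ℕ => C * K * ((A b + η * b - (A a + η * a)) ^ α *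
        (B b - B a) ^ β) + M * (b - a) * ((A b + η * b - (A a + η * a)) / η) / 2 ^ n) ?_ h
      have : Tendsto (fun n : ℕ => M * (b - a) * ((A b + η * b - (A a + η * a)) / η) / 2 ^ n)
          atTop (𝓝 0) :=
        tendsto_const_nhds.div_atTop (tendsto_pow_atTop_atTop_of_one_lt (by norm_num))
      simpa using this.const_add _
    · have h1 : 0 ≤ A c - A a := sub_nonneg.2 (hA hac)
      have h2 : 0 ≤ (B b - B c) ^ β := Real.rpow_nonneg (sub_nonneg.2 (hB hcb)) _
      have h3 : 0 ≤ η * (c - a) := mul_nonneg hη.le (sub_nonneg.2 hac)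
      have h4 : (A c - A a) ^ α ≤ (A c + η * c - (A a + η * a)) ^ α :=
        Real.rpow_le_rpow h1 (by linarith) hα.le
      gcongr
  have hc : Continuous fun η : ℝ =>
      C * K * ((A b + η * b - (A a + η * a)) ^ α * (B b - B a) ^ β) := by
    have : Continuous fun η : ℝ => (A b + η * b - (A a + η * a)) ^ α :=
      Continuous.rpow_const (by fun_prop) fun _ => Or.inr hα.le
    fun_prop
  have ht := (hc.tendsto 0).mono_left (nhdsWithin_le_nhds (s := Set.Ioi 0))
  simp only [zero_mul, add_zero] at ht
  exact ge_of_tendsto ht (eventually_nhdsWithin_of_forall key)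

end Plate

namespace Plate

open FourierTransform
open scoped ComplexConjugate Topology

variable {d : ℕ} {G H : ℝ → Ed d → ℂ} {κ : ℝ}

lemma tform_indicator_right (A : Set ℝ) (s t : ℝ) :
    tform κ G (A.indicator H) s t = A.indicator (fun t => tform κ G H s t) t := by
  rw [← conj_tform, tform_indicator]
  by_cases h : t ∈ A
  · simp only [Set.indicator_of_mem h, conj_tform]
  · simp only [Set.indicator_of_notMem h, map_zero]

lemma enorm_bform_prod_le (hG : Tst G) (hH : Tst H) {A B : Set ℝ} (hA : MeasurableSet A)
    (hB : MeasurableSet B) : ‖bform κ (A ×ˢ B) G H‖ₑ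
      ≤ eLpNorm (totalEvol κ (A.indicator G)) 2 volume
        * eLpNorm (totalEvol κ (B.indicator H)) 2 volume := by
  refine le_trans (le_of_eq ?_) (enorm_integral_tform_le (hG.cut hA) (hH.cut hB))
  rw [bform, ← integral_indicator (hA.prod hB)]
  congr 2
  ext ⟨s, t⟩
  rw [tform_indicator]
  simp only [tform_indicator_right]
  by_cases h1 : s ∈ A <;> by_cases h2 : t ∈ B <;> simp [h1, h2]

/-- The part of the retarded region with both times in `(a, b]`. -/
def tri (a b : ℝ) : Set (ℝ × ℝ) := Set.Ioc a b ×ˢ Set.Ioc a b ∩ band (Set.Iio 0)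

lemma mem_tri {a b : ℝ} {z : ℝ × ℝ} : z ∈ tri a b ↔ a < z.1 ∧ z.1 < z.2 ∧ z.2 ≤ b := by
  simp only [tri, band, Set.mem_inter_iff, Set.mem_prod, Set.mem_Ioc, Set.mem_ofPred_eq,
    Set.mem_Iio, sub_neg]
  constructor
  · rintro ⟨⟨⟨h1, -⟩, -, h2⟩, h3⟩; exact ⟨h1, h3, h2⟩
  · rintro ⟨h1, h2, h3⟩; exact ⟨⟨⟨h1, by linarith⟩, by linarith, h3⟩, h2⟩

lemma measurableSet_tri (a b : ℝ) : MeasurableSet (tri a b) :=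
  (measurableSet_Ioc.prod measurableSet_Ioc).inter (measurableSet_band measurableSet_Iio)

lemma tri_split {a c b : ℝ} (hac : a ≤ c) (hcb : c ≤ b) :
    tri a b = tri a c ∪ tri c b ∪ Set.Ioc a c ×ˢ Set.Ioc c b := by
  ext z
  simp only [Set.mem_union, mem_tri, Set.mem_prod, Set.mem_Ioc]
  constructor
  · rintro ⟨h1, h2, h3⟩
    rcases le_or_gt z.2 c with h | h
    · exact Or.inl (Or.inl ⟨h1, h2, h⟩)
    · rcases le_or_gt z.1 c with h' | h'
      · exact Or.inr ⟨⟨h1, h'⟩, h, h3⟩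
      · exact Or.inl (Or.inr ⟨h', h2, h3⟩)
  · rintro ((⟨h1, h2, h3⟩ | ⟨h1, h2, h3⟩) | ⟨⟨h1, h2⟩, h3, h4⟩)
    · exact ⟨h1, h2, h3.trans hcb⟩
    · exact ⟨hac.trans_lt h1, h2, h3⟩
    · exact ⟨h1, by linarith, h4⟩

lemma bform_tri_split (hG : Tst G) (hH : Tst H) {a c b : ℝ} (hac : a ≤ c) (hcb : c ≤ b) :
    bform κ (tri a b) G H = bform κ (tri a c) G H + bform κ (tri c b) G H
      + bform κ (Set.Ioc a c ×ˢ Set.Ioc c b) G H := by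
  rw [tri_split hac hcb, bform, setIntegral_union _ (measurableSet_Ioc.prod measurableSet_Ioc)
    (hG.integrableOn_tform hH _) (hG.integrableOn_tform hH _), setIntegral_union _
    (measurableSet_tri c b) (hG.integrableOn_tform hH _) (hG.integrableOn_tform hH _)]
  · rfl
  · refine Set.disjoint_left.2 fun z h1 h2 => ?_
    rw [mem_tri] at h1 h2; linarith
  · refine Set.disjoint_left.2 fun z h1 h2 => ?_
    simp only [Set.mem_union, mem_tri, Set.mem_prod, Set.mem_Ioc] at h1 h2
    rcases h1 with h1 | h1 <;> linarith

lemma Tst.norm_tform_le (hG : Tst G) (hH : Tst H) :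
    ∃ M : ℝ, 0 ≤ M ∧ ∀ s t, ‖tform κ G H s t‖ ≤ M := by
  obtain ⟨B, -, hB, h, -⟩ := hG.nr_bound two_pos
  obtain ⟨B', -, hB', h', -⟩ := hH.nr_bound two_pos
  refine ⟨(B * B').toReal, ENNReal.toReal_nonneg, fun s t => ?_⟩
  rw [← toReal_enorm]
  exact ENNReal.toReal_mono (ENNReal.mul_ne_top hB hB')
    ((propForm_energy _ (hG.good s) (hH.good t)).trans (mul_le_mul' (h s) (h' t)))

lemma norm_bform_tri_le {M : ℝ} (hM : ∀ s t, ‖tform κ G H s t‖ ≤ M) (hM0 : 0 ≤ M) {a b : ℝ}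
    (hab : a ≤ b) : ‖bform κ (tri a b) G H‖ ≤ M * (b - a) ^ 2 := by
  have hv : volume (Set.Ioc a b ×ˢ Set.Ioc a b) = ENNReal.ofReal ((b - a) ^ 2) := by
    rw [Measure.volume_eq_prod, Measure.prod_prod, Real.volume_Ioc,
      ← ENNReal.ofReal_mul (by linarith), pow_two]
  have hle : volume (tri a b) ≤ ENNReal.ofReal ((b - a) ^ 2) :=
    (measure_mono Set.inter_subset_left).trans_eq hv
  refine (norm_setIntegral_le_of_norm_le_const (hle.trans_lt ENNReal.ofReal_lt_top)
    fun z _ => hM z.1 z.2).trans ?_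
  refine mul_le_mul_of_nonneg_left ?_ hM0
  exact (ENNReal.toReal_mono ENNReal.ofReal_ne_top hle).trans_eq
    (ENNReal.toReal_ofReal (by positivity))

lemma Tst.exists_bform_tri_eq (hG : Tst G) (hH : Tst H) :
    ∃ R : ℝ, 0 ≤ R ∧ bform κ (band (Set.Iio 0)) G H = bform κ (tri (-R) R) G H := by
  obtain ⟨M, R, -, hR, -⟩ := hG.bdd
  obtain ⟨M', R', -, hR', -⟩ := hH.bdd
  refine ⟨max (|R| + 1) |R'|, by positivity, ?_⟩
  unfold bform tri
  refine setIntegral_eq_of_subset_of_forall_sdiff_eq_zero (E := ℂ)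
    (measurableSet_band measurableSet_Iio)
    Set.inter_subset_right fun z hz => ?_
  have hz1 : z.1 < z.2 := sub_neg.1 hz.1
  have hz2 : z ∉ tri _ _ := hz.2
  rw [mem_tri] at hz2
  by_contra hne
  have n1 : |z.1| ≤ R := by
    by_contra! h
    have : G z.1 = 0 := funext fun x => hR z.1 x h
    exact hne (by rw [tform, this, propForm_zero_left])
  have n2 : |z.2| ≤ R' := by
    by_contra! h
    have : H z.2 = 0 := funext fun x => hR' z.2 x h
    refine hne ?_
    rw [← conj_tform, tform, this, propForm_zero_left, map_zero]
  refine hz2 ⟨?_, hz1, ?_⟩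
  · have := neg_abs_le z.1
    have := le_abs_self R
    have := le_max_left (|R| + 1) |R'|
    linarith
  · exact (le_abs_self _).trans (n2.trans ((le_abs_self _).trans (le_max_right _ _)))

/-- The accumulated `Q`-th power of the spatial norm. -/
def accum (Q p : ℝ) (G : ℝ → Ed d → ℂ) (t : ℝ) : ℝ := ∫ s in (0 : ℝ)..t, (nr p (G s) ^ Q).toReal

section accum

variable {Q p : ℝ}

lemma Tst.integrable_accum (hG : Tst G) (hQ : 0 < Q) (hp : 0 < p) :
    Integrable fun s => (nr p (G s) ^ Q).toReal :=
  integrable_toReal_of_lintegral_ne_top ((measurable_nr hG.meas p).pow_const Q).aemeasurable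
    (hG.lintegral_nr_ne_top hp hQ)

lemma Tst.accum_sub (hG : Tst G) (hQ : 0 < Q) (hp : 0 < p) {a b : ℝ} (hab : a ≤ b) :
    ENNReal.ofReal (accum Q p G b - accum Q p G a) = ∫⁻ s in Set.Ioc a b, nr p (G s) ^ Q := by
  have hi := hG.integrable_accum hQ hp
  rw [accum, accum, intervalIntegral.integral_interval_sub_left hi.intervalIntegrable
    hi.intervalIntegrable, intervalIntegral.integral_of_le hab,
    ofReal_integral_eq_lintegral_ofReal hi.integrableOn (ae_of_all _ fun _ => ENNReal.toReal_nonneg)]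
  refine lintegral_congr fun s => ?_
  exact ENNReal.ofReal_toReal (ENNReal.rpow_ne_top_of_nonneg hQ.le ((hG.good s).nr_ne_top hp))

lemma Tst.accum_mono (hG : Tst G) (hQ : 0 < Q) (hp : 0 < p) : Monotone (accum Q p G) := by
  intro a b hab
  have hi := hG.integrable_accum hQ hp
  rw [← sub_nonneg, accum, accum, intervalIntegral.integral_interval_sub_left hi.intervalIntegrable
    hi.intervalIntegrable]
  exact intervalIntegral.integral_nonneg hab fun _ _ => ENNReal.toReal_nonneg

lemma Tst.accum_continuous (hG : Tst G) (hQ : 0 < Q) (hp : 0 < p) : Continuous (accum Q p G) :=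
  intervalIntegral.continuous_primitive (fun _ _ => (hG.integrable_accum hQ hp).intervalIntegrable) 0

lemma Tst.nrT_Ioc (hG : Tst G) (hQ : 0 < Q) (hp : 0 < p) {a b : ℝ} (hab : a ≤ b) :
    nrT Q p ((Set.Ioc a b).indicator G)
      = ENNReal.ofReal ((accum Q p G b - accum Q p G a) ^ (1 / Q)) := by
  rw [nrT_indicator hQ hp measurableSet_Ioc, ← hG.accum_sub hQ hp hab,
    ENNReal.ofReal_rpow_of_nonneg (sub_nonneg.2 (hG.accum_mono hQ hp hab)) (by positivity)]

lemma Tst.nrT_Ioc_le (hQ : 0 < Q) (hp : 0 < p) (a b : ℝ) :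
    nrT Q p ((Set.Ioc a b).indicator G) ≤ nrT Q p G := by
  rw [nrT_indicator hQ hp measurableSet_Ioc]
  exact ENNReal.rpow_le_rpow (setLIntegral_le_lintegral _ _) (by positivity)

end accum

lemma exists_retarded_of_energyBound {Q₁ p₁ Q₂ p₂ : ℝ} (h1 : EnergyBound d Q₁ p₁)
    (h2 : EnergyBound d Q₂ p₂) (hQ₁ : 0 < Q₁) (hp₁ : 0 < p₁) (hQ₂ : 1 ≤ Q₂) (hp₂ : 0 < p₂)
    (hQ : 1 < 1 / Q₁ + 1 / Q₂) :
    ∃ C : ℝ≥0∞, C ≠ ∞ ∧ ∀ κ : ℝ, Real.pi ≤ |κ| → ∀ G H : ℝ → Ed d → ℂ, Tst G → Tst H →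
      ‖bform κ (band (Set.Iio 0)) G H‖ₑ ≤ C * (nrT Q₁ p₁ G * nrT Q₂ p₂ H) := by
  obtain ⟨C₁, hC₁, H1⟩ := h1
  obtain ⟨C₂, hC₂, H2⟩ := h2
  have hQ₂' : 0 < Q₂ := by linarith
  set C : ℝ := (C₁ * C₂).toReal
  have hC12 : C₁ * C₂ ≠ ∞ := ENNReal.mul_ne_top hC₁ hC₂
  have hx1 : (2 : ℝ) ^ (1 - 1 / Q₁ - 1 / Q₂) < 1 :=
    Real.rpow_lt_one_of_one_lt_of_neg (by norm_num) (by linarith)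
  set K : ℝ := (1 - (2 : ℝ) ^ (1 - 1 / Q₁ - 1 / Q₂))⁻¹
  have hKp : 0 < K := inv_pos.2 (by linarith)
  refine ⟨ENNReal.ofReal (C * K), ENNReal.ofReal_ne_top, fun κ hκ G H hG hH => ?_⟩
  obtain ⟨M, hM0, hM⟩ := hG.norm_tform_le (κ := κ) hH
  obtain ⟨R, hR, e⟩ := hG.exists_bform_tri_eq (κ := κ) hH
  have key := christ_kiselev (A := accum Q₁ p₁ G) (B := accum Q₂ p₂ H)
    (T := fun a b => ‖bform κ (tri a b) G H‖) (C := C) (M := M) (K := K) (α := 1 / Q₁)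
    (β := 1 / Q₂) (hG.accum_mono hQ₁ hp₁) (hG.accum_continuous hQ₁ hp₁) (hH.accum_mono hQ₂' hp₂)
    ENNReal.toReal_nonneg hM0 (by positivity) (by positivity)
    ((div_le_one hQ₂').2 hQ₂) hKp.le ?_
    (fun a b hab => norm_bform_tri_le hM hM0 hab) ?_ (by linarith : -R ≤ R)
  · rw [e, ← ofReal_norm]
    refine (ENNReal.ofReal_le_ofReal key).trans ?_
    have m1 := hG.accum_mono hQ₁ hp₁ (by linarith : -R ≤ R)
    have m2 := hH.accum_mono hQ₂' hp₂ (by linarith : -R ≤ R)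
    rw [ENNReal.ofReal_mul (mul_nonneg ENNReal.toReal_nonneg hKp.le),
      ENNReal.ofReal_mul (Real.rpow_nonneg (sub_nonneg.2 m1) _),
      ← hG.nrT_Ioc hQ₁ hp₁ (by linarith), ← hH.nrT_Ioc hQ₂' hp₂ (by linarith)]
    gcongr
    · exact Tst.nrT_Ioc_le hQ₁ hp₁ _ _
    · exact Tst.nrT_Ioc_le hQ₂' hp₂ _ _
  · have : K * (1 - (2 : ℝ) ^ (1 - 1 / Q₁ - 1 / Q₂)) = 1 := inv_mul_cancel₀ (by linarith)
    linarith
  · intro a c b hac hcb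
    rw [bform_tri_split hG hH hac hcb]
    refine norm_add₃_le.trans ?_
    gcongr
    have m1 := hG.accum_mono hQ₁ hp₁ hac
    have m2 := hH.accum_mono hQ₂' hp₂ hcb
    have hn : 0 ≤ C * ((accum Q₁ p₁ G c - accum Q₁ p₁ G a) ^ (1 / Q₁) *
        (accum Q₂ p₂ H b - accum Q₂ p₂ H c) ^ (1 / Q₂)) :=
      mul_nonneg ENNReal.toReal_nonneg (mul_nonneg (Real.rpow_nonneg (sub_nonneg.2 m1) _)
        (Real.rpow_nonneg (sub_nonneg.2 m2) _))
    rw [← ENNReal.ofReal_le_ofReal_iff hn, ofReal_norm]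
    refine (enorm_bform_prod_le hG hH measurableSet_Ioc measurableSet_Ioc).trans ?_
    refine (mul_le_mul' (H1 κ hκ _ (hG.cut measurableSet_Ioc))
      (H2 κ hκ _ (hH.cut measurableSet_Ioc))).trans (le_of_eq ?_)
    rw [hG.nrT_Ioc hQ₁ hp₁ hac, hH.nrT_Ioc hQ₂' hp₂ hcb, ENNReal.ofReal_mul ENNReal.toReal_nonneg,
      ENNReal.ofReal_mul (Real.rpow_nonneg (sub_nonneg.2 m1) _), ENNReal.ofReal_toReal hC12]
    ring

theorem exists_retarded (hd : 1 ≤ d) {Q₁ p₁ Q₂ p₂ : ℝ} (h1 : DualAdm d Q₁ p₁)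
    (h2 : DualAdm d Q₂ p₂) :
    ∃ C : ℝ≥0∞, C ≠ ∞ ∧ ∀ κ : ℝ, Real.pi ≤ |κ| → ∀ G H : ℝ → Ed d → ℂ, Tst G → Tst H →
      ‖bform κ (band (Set.Iio 0)) G H‖ₑ ≤ C * (nrT Q₁ p₁ G * nrT Q₂ p₂ H) := by
  have a1 := h1.one_le
  have a2 := h2.one_le
  have b1 := h1.one_le'
  have b2 := h2.one_le'
  by_cases hQ : Q₁ = 2 ∧ Q₂ = 2
  · obtain ⟨rfl, rfl⟩ := hQ
    obtain ⟨h3, rfl⟩ := h1.endpoint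
    obtain ⟨-, rfl⟩ := h2.endpoint
    exact exists_endpoint d h3
  · refine exists_retarded_of_energyBound (h1.energyBound hd) (h2.energyBound hd) (by linarith)
      (by linarith) a2 (by linarith) ?_
    have c1 : 1 / 2 ≤ 1 / Q₁ := one_div_le_one_div_of_le (by linarith) h1.le_two
    have c2 : 1 / 2 ≤ 1 / Q₂ := one_div_le_one_div_of_le (by linarith) h2.le_two
    by_cases hQ' : Q₁ = 2
    · have : 1 / 2 < 1 / Q₂ :=
        one_div_lt_one_div_of_lt (by linarith) (h2.le_two.lt_of_ne fun h => hQ ⟨hQ', h⟩)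
      linarith
    · have : 1 / 2 < 1 / Q₁ := one_div_lt_one_div_of_lt (by linarith) (h1.le_two.lt_of_ne hQ')
      linarith

end Plate

namespace Plate

open FourierTransform
open scoped ComplexConjugate Topology

variable {d : ℕ} {w G H : ℝ → Ed d → ℂ}

lemma Tst.integrable (hw : Tst w) : Integrable (Function.uncurry w) := by
  obtain ⟨M, R, hM, hR, hR'⟩ := hw.bdd
  have hs : volume (Metric.closedBall (0 : ℝ) R ×ˢ Metric.closedBall (0 : Ed d) R) < ∞ := by
    rw [Measure.volume_eq_prod, Measure.prod_prod]
    exact ENNReal.mul_lt_top measure_closedBall_lt_top measure_closedBall_lt_top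
  have h0 : ∀ z : ℝ × Ed d, z ∉ Metric.closedBall (0 : ℝ) R ×ˢ Metric.closedBall (0 : Ed d) R →
      Function.uncurry w z = 0 := by
    intro z hz
    simp only [Set.mem_prod, mem_closedBall_zero_iff, Real.norm_eq_abs, not_and_or, not_le] at hz
    exact hz.elim (hR _ _) (hR' _ _)
  refine (integrableOn_iff_integrable_of_support_subset fun z hz => ?_).1
    (Measure.integrableOn_of_bounded (M := M) hs.ne hw.meas.aestronglyMeasurable
      (ae_of_all _ fun z => hM z.1 z.2))
  by_contra h; exact hz (h0 z h)

/-- The extremizer in the converse of Hölder's inequality in mixed norms. -/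
def dualFn (q r δ : ℝ) (w : ℝ → Ed d → ℂ) (t : ℝ) (x : Ed d) : ℂ :=
  {t | ENNReal.ofReal δ ≤ nr r (w t)}.indicator
    (fun t => ((‖w t x‖ ^ (r - 2) * (nr r (w t)).toReal ^ (q - r) : ℝ) : ℂ) * w t x) t

section dualFn

variable {q r δ : ℝ}

lemma measurableSet_le_nr (hw : Tst w) : MeasurableSet {t | ENNReal.ofReal δ ≤ nr r (w t)} :=
  measurableSet_le measurable_const (measurable_nr hw.meas r)

lemma Tst.dualFn (hw : Tst w) (hr : 2 ≤ r) (hδ : 0 < δ) : Tst (dualFn q r δ w) := by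
  obtain ⟨M, R, hM, hR, hR'⟩ := hw.bdd
  obtain ⟨B, -, hB, hN, -⟩ := hw.nr_bound (p := r) (by linarith)
  have hm : Measurable (Function.uncurry w) := hw.meas
  refine ⟨?_, M ^ (r - 2) * (δ ^ (q - r) + B.toReal ^ (q - r)) * M, R, fun t x => ?_,
    fun t x ht => ?_, fun t x hx => ?_⟩
  · have e : Function.uncurry (Plate.dualFn q r δ w)
        = (Prod.fst ⁻¹' {t | ENNReal.ofReal δ ≤ nr r (w t)}).indicator
          (fun z : ℝ × Ed d => ((‖Function.uncurry w z‖ ^ (r - 2)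
            * (nr r (w z.1)).toReal ^ (q - r) : ℝ) : ℂ) * Function.uncurry w z) := by
      ext ⟨t, x⟩; rfl
    rw [e]
    refine Measurable.indicator ?_ ((measurableSet_le_nr hw).preimage measurable_fst)
    have mN : Measurable fun z : ℝ × Ed d => nr r (w z.1) :=
      (measurable_nr hw.meas r).comp measurable_fst
    exact (Complex.measurable_ofReal.comp ((hm.norm.pow_const _).mul
      (mN.ennreal_toReal.pow_const _))).mul hm
  · have M0 : 0 ≤ M := (norm_nonneg _).trans (hM t x)
    unfold Plate.dualFn
    by_cases h : ENNReal.ofReal δ ≤ nr r (w t)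
    · rw [Set.indicator_of_mem (by exact h), norm_mul, Complex.norm_real, Real.norm_of_nonneg
        (by positivity)]
      have h1 : δ ≤ (nr r (w t)).toReal :=
        (ENNReal.ofReal_le_iff_le_toReal ((hw.good t).nr_ne_top (by linarith))).1 h
      have h2 : (nr r (w t)).toReal ≤ B.toReal := ENNReal.toReal_mono hB (hN t)
      have h3 : (nr r (w t)).toReal ^ (q - r) ≤ δ ^ (q - r) + B.toReal ^ (q - r) := by
        rcases le_total 0 (q - r) with h | h
        · have := Real.rpow_le_rpow (by linarith) h2 h
          have : 0 ≤ δ ^ (q - r) := by positivity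
          linarith
        · have := Real.rpow_le_rpow_of_nonpos hδ h1 h
          have : 0 ≤ B.toReal ^ (q - r) := by positivity
          linarith
      have h4 : ‖w t x‖ ^ (r - 2) ≤ M ^ (r - 2) :=
        Real.rpow_le_rpow (norm_nonneg _) (hM t x) (by linarith)
      have := hM t x
      gcongr
    · rw [Set.indicator_of_notMem (by exact h), norm_zero]; positivity
  · simp [Plate.dualFn, Set.indicator_apply, hR t x ht]
  · simp [Plate.dualFn, Set.indicator_apply, hR' t x hx]

lemma enorm_dualFn (hr : 2 ≤ r) (hδ : 0 < δ) (hw : Tst w) (t : ℝ) (x : Ed d) :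
    ‖dualFn q r δ w t x‖ₑ = {t | ENNReal.ofReal δ ≤ nr r (w t)}.indicator
      (fun t => ‖w t x‖ₑ ^ (r - 1) * nr r (w t) ^ (q - r)) t := by
  unfold dualFn
  by_cases h : ENNReal.ofReal δ ≤ nr r (w t)
  · have hN := (hw.good t).nr_ne_top (p := r) (by linarith)
    have hN0 : nr r (w t) ≠ 0 := ((ENNReal.ofReal_pos.2 hδ).trans_le h).ne'
    have e1 : ENNReal.ofReal (‖w t x‖ ^ (r - 2)) = ‖w t x‖ₑ ^ (r - 2) := by
      rw [← ofReal_norm, ENNReal.ofReal_rpow_of_nonneg (norm_nonneg _) (by linarith)]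
    have e2 : ENNReal.ofReal ((nr r (w t)).toReal ^ (q - r)) = nr r (w t) ^ (q - r) := by
      rw [← ENNReal.ofReal_rpow_of_pos (ENNReal.toReal_pos hN0 hN), ENNReal.ofReal_toReal hN]
    rw [Set.indicator_of_mem (by exact h), Set.indicator_of_mem (by exact h), ← ofReal_norm, norm_mul,
      Complex.norm_real, Real.norm_of_nonneg (by positivity), ENNReal.ofReal_mul (by positivity),
      ENNReal.ofReal_mul (by positivity), e1, e2, ofReal_norm, mul_right_comm]
    congr 1
    nth_rewrite 2 [← ENNReal.rpow_one ‖w t x‖ₑ]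
    rw [← ENNReal.rpow_add_of_nonneg _ _ (by linarith) zero_le_one]
    ring_nf
  · rw [Set.indicator_of_notMem (by exact h), Set.indicator_of_notMem (by exact h), enorm_zero]

lemma nrT_dualFn (hq : 1 < q) (hr : 2 ≤ r) (hδ : 0 < δ) (hw : Tst w) :
    nrT (q / (q - 1)) (r / (r - 1)) (dualFn q r δ w)
      = (∫⁻ t in {t | ENNReal.ofReal δ ≤ nr r (w t)}, nr r (w t) ^ q) ^ ((q - 1) / q) := by
  have hr1 : 0 < r - 1 := by linarith
  have hq1 : 0 < q - 1 := by linarith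
  rw [nrT, ← lintegral_indicator (measurableSet_le_nr hw), one_div_div]
  congr 1
  refine lintegral_congr fun t => ?_
  by_cases h : ENNReal.ofReal δ ≤ nr r (w t)
  · have hN := (hw.good t).nr_ne_top (p := r) (by linarith)
    have hN0 : nr r (w t) ≠ 0 := ((ENNReal.ofReal_pos.2 hδ).trans_le h).ne'
    rw [Set.indicator_of_mem (by exact h)]
    have e : ∫⁻ x, ‖dualFn q r δ w t x‖ₑ ^ (r / (r - 1))
        = nr r (w t) ^ ((q - 1) * (r / (r - 1))) := by
      have e' : ∀ x, ‖dualFn q r δ w t x‖ₑ ^ (r / (r - 1))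
          = ‖w t x‖ₑ ^ r * nr r (w t) ^ ((q - r) * (r / (r - 1))) := by
        intro x
        rw [enorm_dualFn hr hδ hw, Set.indicator_of_mem (by exact h),
          ENNReal.mul_rpow_of_nonneg _ _ (by positivity), ← ENNReal.rpow_mul, ← ENNReal.rpow_mul,
          mul_div_cancel₀ _ hr1.ne']
      have hm : Measurable fun x => ‖w t x‖ₑ ^ r := ((hw.good t).meas.enorm.pow_const r)
      rw [lintegral_congr e', lintegral_mul_const _ hm, ← nr_rpow (by linarith),
        ← ENNReal.rpow_add _ _ hN0 hN]
      congr 1; field_simp; ring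
    rw [nr, e, ← ENNReal.rpow_mul, ← ENNReal.rpow_mul]
    congr 1; field_simp
  · rw [Set.indicator_of_notMem (by exact h)]
    have : dualFn q r δ w t = fun _ => 0 := by
      ext x; unfold dualFn; exact Set.indicator_of_notMem (by exact h) _
    have hr' : 0 < r := by linarith
    have hq' : 0 < q := by linarith
    simp only [nr, this, enorm_zero]
    rw [ENNReal.zero_rpow_of_pos (by positivity), lintegral_zero, ENNReal.zero_rpow_of_pos
      (by positivity), ENNReal.zero_rpow_of_pos (by positivity)]

lemma enorm_integral_dualFn (hr : 2 ≤ r) (hδ : 0 < δ) (hw : Tst w) :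
    ‖∫ z : ℝ × Ed d, w z.1 z.2 * conj (dualFn q r δ w z.1 z.2)‖ₑ
      = ∫⁻ t in {t | ENNReal.ofReal δ ≤ nr r (w t)}, nr r (w t) ^ q := by
  have hG : Tst (dualFn q r δ w) := hw.dualFn hr hδ
  have e : ∀ z : ℝ × Ed d, w z.1 z.2 * conj (dualFn q r δ w z.1 z.2)
      = ((‖w z.1 z.2‖ * ‖dualFn q r δ w z.1 z.2‖ : ℝ) : ℂ) := by
    intro z
    unfold dualFn
    by_cases h : ENNReal.ofReal δ ≤ nr r (w z.1)
    · rw [Set.indicator_of_mem (by exact h), map_mul, conj_ofReal, norm_mul, Complex.norm_real,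
        Real.norm_of_nonneg (by positivity), mul_left_comm, mul_conj, Complex.normSq_eq_norm_sq]
      push_cast; ring
    · rw [Set.indicator_of_notMem (by exact h)]; simp
  obtain ⟨M, R, hM, -⟩ := hw.bdd
  have hi : Integrable fun z : ℝ × Ed d => ‖w z.1 z.2‖ * ‖dualFn q r δ w z.1 z.2‖ := by
    refine hG.integrable.norm.bdd_mul (c := M) hw.meas.norm.aestronglyMeasurable
      (ae_of_all _ fun z => ?_)
    rw [norm_norm]; exact hM z.1 z.2
  simp only [e]
  rw [integral_complex_ofReal, ← ofReal_norm, Complex.norm_real,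
    Real.norm_of_nonneg (integral_nonneg fun z => by positivity),
    ofReal_integral_eq_lintegral_ofReal hi (ae_of_all _ fun z => by positivity),
    ← lintegral_indicator (measurableSet_le_nr hw), Measure.volume_eq_prod,
    lintegral_prod _ (hi.1.aemeasurable.ennreal_ofReal)]
  refine lintegral_congr fun t => ?_
  by_cases h : ENNReal.ofReal δ ≤ nr r (w t)
  · have hN := (hw.good t).nr_ne_top (p := r) (by linarith)
    have hN0 : nr r (w t) ≠ 0 := ((ENNReal.ofReal_pos.2 hδ).trans_le h).ne'
    have e' : ∀ x, ENNReal.ofReal (‖w t x‖ * ‖dualFn q r δ w t x‖)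
        = ‖w t x‖ₑ ^ r * nr r (w t) ^ (q - r) := by
      intro x
      rw [ENNReal.ofReal_mul (norm_nonneg _), ofReal_norm, ofReal_norm, enorm_dualFn hr hδ hw,
        Set.indicator_of_mem (by exact h), ← mul_assoc]
      congr 1
      nth_rewrite 1 [← ENNReal.rpow_one ‖w t x‖ₑ]
      rw [← ENNReal.rpow_add_of_nonneg _ _ zero_le_one (by linarith)]
      ring_nf
    have hm : Measurable fun x => ‖w t x‖ₑ ^ r := ((hw.good t).meas.enorm.pow_const r)
    rw [Set.indicator_of_mem (by exact h)]
    simp only [e']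
    rw [lintegral_mul_const _ hm, ← nr_rpow (by linarith), ← ENNReal.rpow_add _ _ hN0 hN]
    ring_nf
  · have : dualFn q r δ w t = fun _ => 0 := by
      ext x; unfold dualFn; exact Set.indicator_of_notMem (by exact h) _
    rw [Set.indicator_of_notMem (by exact h)]
    simp [this]

/-- Converse of Hölder's inequality in mixed norms, for finite exponents. -/
lemma Tst.nrT_le_of_forall (hq : 1 < q) (hr : 2 ≤ r) (hw : Tst w) {A : ℝ≥0∞}
    (h : ∀ G : ℝ → Ed d → ℂ, Tst G → (∀ t x, w t x = 0 → G t x = 0) →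
      ‖∫ z : ℝ × Ed d, w z.1 z.2 * conj (G z.1 z.2)‖ₑ
        ≤ A * nrT (q / (q - 1)) (r / (r - 1)) G) : nrT q r w ≤ A := by
  have hq0 : 0 < q := by linarith
  have key : ∀ n : ℕ, ∫⁻ t in {t | ENNReal.ofReal (1 / (n + 1)) ≤ nr r (w t)}, nr r (w t) ^ q
      ≤ A ^ q := by
    intro n
    have hδ : (0 : ℝ) < 1 / (n + 1) := by positivity
    have h1 := h _ (hw.dualFn (q := q) hr hδ) fun t x hx => by simp [Plate.dualFn, hx]
    rw [enorm_integral_dualFn hr hδ hw, nrT_dualFn hq hr hδ hw] at h1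
    set X := ∫⁻ t in {t | ENNReal.ofReal (1 / (n + 1)) ≤ nr r (w t)}, nr r (w t) ^ q
    have hX : X ≠ ∞ := ((setLIntegral_le_lintegral _ _).trans_lt
      (hw.lintegral_nr_ne_top (by linarith) hq0).lt_top).ne
    rcases eq_or_ne X 0 with h0 | h0
    · rw [h0]; exact zero_le
    have e : X = X ^ (1 / q) * X ^ ((q - 1) / q) := by
      rw [← ENNReal.rpow_add _ _ h0 hX, ← add_div, add_sub_cancel, div_self hq0.ne',
        ENNReal.rpow_one]
    nth_rewrite 1 [e] at h1
    have hc0 : X ^ ((q - 1) / q) ≠ 0 := by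
      rw [Ne, ENNReal.rpow_eq_zero_iff]; push Not
      exact ⟨fun h => absurd h h0, fun h => absurd h hX⟩
    have h2 := (ENNReal.mul_le_mul_iff_left hc0 (ENNReal.rpow_ne_top_of_nonneg
      (div_nonneg (by linarith) hq0.le) hX)).1 h1
    rw [one_div] at h2
    exact (ENNReal.rpow_inv_le_iff hq0).1 h2
  rw [nrT, one_div, ENNReal.rpow_inv_le_iff hq0]
  have hU : ∫⁻ t, nr r (w t) ^ q
      = ∫⁻ t in ⋃ n : ℕ, {t | ENNReal.ofReal (1 / (n + 1)) ≤ nr r (w t)}, nr r (w t) ^ q := by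
    rw [← lintegral_indicator (MeasurableSet.iUnion fun n => measurableSet_le_nr hw)]
    refine lintegral_congr fun t => ?_
    by_cases h : t ∈ ⋃ n : ℕ, {t | ENNReal.ofReal (1 / ((n : ℝ) + 1)) ≤ nr r (w t)}
    · rw [Set.indicator_of_mem h]
    · rw [Set.indicator_of_notMem h]
      simp only [Set.mem_iUnion, Set.mem_ofPred_eq, not_exists, not_le] at h
      have h0 : nr r (w t) ≤ 0 := by
        refine ge_of_tendsto' (x := atTop) (f := fun n : ℕ => ENNReal.ofReal (1 / ((n : ℝ) + 1)))
          ?_ fun n => (h n).le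
        have := ENNReal.tendsto_ofReal (tendsto_one_div_add_atTop_nhds_zero_nat (𝕜 := ℝ))
        rwa [ENNReal.ofReal_zero] at this
      rw [nonpos_iff_eq_zero.1 h0, ENNReal.zero_rpow_of_pos hq0]
  rw [hU, setLIntegral_iUnion_of_directed _ (Monotone.directed_le fun m n hmn t ht => ?_)]
  · exact iSup_le key
  · refine le_trans (ENNReal.ofReal_le_ofReal ?_) (by exact ht)
    exact one_div_le_one_div_of_le (by positivity) (by have : (m : ℝ) ≤ n := by exact_mod_cast hmn
                                                       linarith)

end dualFn

end Plate

namespace Plate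

open FourierTransform
open scoped ComplexConjugate Topology

variable {d : ℕ} {w : ℝ → Ed d → ℂ} {I : Set ℝ}

/-- The region on which the `n`-th truncation keeps `w`. -/
def cutSet (I : Set ℝ) (w : ℝ → Ed d → ℂ) (n : ℕ) : Set (ℝ × Ed d) :=
  {z | z.1 ∈ I ∧ |z.1| ≤ n ∧ ‖z.2‖ ≤ n ∧ ‖w z.1 z.2‖ ≤ n}

/-- Truncation of `w` in time, space and size. -/
def cutFn (I : Set ℝ) (w : ℝ → Ed d → ℂ) (n : ℕ) (t : ℝ) (x : Ed d) : ℂ :=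
  (cutSet I w n).indicator (Function.uncurry w) (t, x)

lemma measurableSet_cutSet (hI : MeasurableSet I) (hw : Measurable (Function.uncurry w)) (n : ℕ) :
    MeasurableSet (cutSet I w n) := by
  have h1 : MeasurableSet {z : ℝ × Ed d | z.1 ∈ I} := hI.preimage measurable_fst
  have h2 : MeasurableSet {z : ℝ × Ed d | |z.1| ≤ n} :=
    measurableSet_le measurable_fst.norm measurable_const
  have h3 : MeasurableSet {z : ℝ × Ed d | ‖z.2‖ ≤ n} :=
    measurableSet_le measurable_snd.norm measurable_const
  have h4 : MeasurableSet {z : ℝ × Ed d | ‖Function.uncurry w z‖ ≤ n} :=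
    measurableSet_le hw.norm measurable_const
  exact h1.inter (h2.inter (h3.inter h4))

lemma cutSet_mono : Monotone (cutSet I w) := by
  rintro m n hmn z ⟨h1, h2, h3, h4⟩
  have : (m : ℝ) ≤ n := by exact_mod_cast hmn
  exact ⟨h1, h2.trans this, h3.trans this, h4.trans this⟩

lemma eventually_mem_cutSet {t : ℝ} (ht : t ∈ I) (x : Ed d) :
    ∀ᶠ n : ℕ in atTop, (t, x) ∈ cutSet I w n := by
  obtain ⟨N, hN⟩ := exists_nat_ge (max |t| (max ‖x‖ ‖w t x‖))
  filter_upwards [eventually_ge_atTop N] with n hn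
  have hn' : (N : ℝ) ≤ n := by exact_mod_cast hn
  have h := max_le_iff.1 (hN.trans hn')
  have h' := max_le_iff.1 h.2
  exact ⟨ht, h.1, h'.1, h'.2⟩

lemma tst_cutFn (hI : MeasurableSet I) (hw : Measurable (Function.uncurry w)) (n : ℕ) :
    Tst (cutFn I w n) := by
  refine ⟨hw.indicator (measurableSet_cutSet hI hw n), n, n, fun t x => ?_, fun t x ht => ?_,
    fun t x hx => ?_⟩
  · by_cases h : (t, x) ∈ cutSet I w n
    · rw [cutFn, Set.indicator_of_mem h]; exact h.2.2.2
    · rw [cutFn, Set.indicator_of_notMem h, norm_zero]; positivity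
  · exact Set.indicator_of_notMem (fun h => absurd h.2.1 (not_le.2 ht)) _
  · exact Set.indicator_of_notMem (fun h => absurd h.2.2.1 (not_le.2 hx)) _

lemma integral_cutFn_mul {G : ℝ → Ed d → ℂ} {n : ℕ} (hG : ∀ t x, cutFn I w n t x = 0 → G t x = 0) :
    ∫ z : ℝ × Ed d, cutFn I w n z.1 z.2 * conj (G z.1 z.2)
      = ∫ z : ℝ × Ed d, w z.1 z.2 * conj (G z.1 z.2) := by
  refine integral_congr_ae (ae_of_all _ fun z => ?_)
  by_cases h : z ∈ cutSet I w n
  · have : cutFn I w n z.1 z.2 = w z.1 z.2 := Set.indicator_of_mem (by exact h) _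
    simp only [this]
  · have h0 : cutFn I w n z.1 z.2 = 0 := Set.indicator_of_notMem (by exact h) _
    simp [h0, hG z.1 z.2 h0]

lemma cutFn_of_notMem {t : ℝ} (ht : t ∉ I) (n : ℕ) (x : Ed d) : cutFn I w n t x = 0 :=
  Set.indicator_of_notMem (fun h => ht h.1) _

lemma enorm_cutFn_le (n : ℕ) (t : ℝ) (x : Ed d) : ‖cutFn I w n t x‖ₑ ≤ ‖w t x‖ₑ :=
  enorm_indicator_le_enorm_self _ _

lemma enorm_cutFn_mono (t : ℝ) (x : Ed d) : Monotone fun n => ‖cutFn I w n t x‖ₑ := by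
  intro m n hmn
  simp only [cutFn, enorm_indicator_eq_indicator_enorm]
  exact Set.indicator_le_indicator_of_subset (cutSet_mono hmn) (fun _ => zero_le) _

lemma tendsto_nr_cutFn (hw : Measurable (Function.uncurry w)) (hI : MeasurableSet I) {r : ℝ}
    (hr : 0 < r) {t : ℝ} (ht : t ∈ I) :
    Tendsto (fun n => nr r (cutFn I w n t)) atTop (𝓝 (nr r (w t))) := by
  refine (ENNReal.continuous_rpow_const.tendsto _).comp ?_
  refine lintegral_tendsto_of_tendsto_of_monotone
    (fun n => (((tst_cutFn hI hw n).good t).meas.enorm.pow_const r).aemeasurable)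
    (ae_of_all _ fun x m n hmn => ENNReal.rpow_le_rpow (enorm_cutFn_mono t x hmn) hr.le)
    (ae_of_all _ fun x => tendsto_const_nhds.congr' ?_)
  filter_upwards [eventually_mem_cutSet (w := w) ht x] with n hn
  rw [cutFn, Set.indicator_of_mem hn]; rfl

section

variable {q r Q p : ℝ} {A : ℝ≥0∞}

/-- `w` restricted to times in `I` obeys the dual bound with constant `A`. -/
def PairBound (I : Set ℝ) (w : ℝ → Ed d → ℂ) (Q p : ℝ) (A : ℝ≥0∞) : Prop :=
  ∀ G : ℝ → Ed d → ℂ, Tst G → (∀ t ∉ I, ∀ x, G t x = 0) →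
    ‖∫ z : ℝ × Ed d, w z.1 z.2 * conj (G z.1 z.2)‖ₑ ≤ A * nrT Q p G

lemma PairBound.cutFn (h : PairBound I w Q p A) {G : ℝ → Ed d → ℂ} (hG : Tst G) {n : ℕ}
    (hG0 : ∀ t x, cutFn I w n t x = 0 → G t x = 0) :
    ‖∫ z : ℝ × Ed d, Plate.cutFn I w n z.1 z.2 * conj (G z.1 z.2)‖ₑ ≤ A * nrT Q p G := by
  rw [integral_cutFn_mul hG0]
  exact h G hG fun t ht x => hG0 t x (cutFn_of_notMem ht n x)

lemma PairBound.nrT_le (hI : MeasurableSet I) (hw : Measurable (Function.uncurry w)) (hq : 1 < q)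
    (hr : 2 ≤ r) (h : PairBound I w (q / (q - 1)) (r / (r - 1)) A) :
    (∫⁻ t in I, nr r (w t) ^ q) ^ (1 / q) ≤ A := by
  have hq0 : 0 < q := by linarith
  have hn : ∀ n, ∫⁻ t in I, nr r (Plate.cutFn I w n t) ^ q ≤ A ^ q := by
    intro n
    have h1 := (tst_cutFn hI hw n).nrT_le_of_forall hq hr fun G hG hG0 => h.cutFn hG hG0
    rw [nrT, one_div, ENNReal.rpow_inv_le_iff hq0] at h1
    exact (setLIntegral_le_lintegral _ _).trans h1
  rw [one_div, ENNReal.rpow_inv_le_iff hq0]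
  refine le_of_tendsto' (lintegral_tendsto_of_tendsto_of_monotone
    (fun n => ((measurable_nr (tst_cutFn hI hw n).meas r).pow_const q).aemeasurable)
    (ae_of_all _ fun t m n hmn => ?_) ?_) hn
  · exact ENNReal.rpow_le_rpow (nr_mono (by linarith) fun x => enorm_cutFn_mono t x hmn) hq0.le
  · filter_upwards [ae_restrict_mem hI] with t ht
    exact (ENNReal.continuous_rpow_const.tendsto _).comp (tendsto_nr_cutFn hw hI (by linarith) ht)

lemma PairBound.ae_le (hI : MeasurableSet I) (hw : Measurable (Function.uncurry w))
    (h : PairBound I w 1 2 A) : ∀ᵐ t ∂volume.restrict I, nr 2 (w t) ≤ A := by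
  have hn : ∀ n, ∀ᵐ t, nr 2 (Plate.cutFn I w n t) ≤ A := by
    intro n
    set v := Plate.cutFn I w n with hv
    have hT : Tst v := tst_cutFn hI hw n
    have mN := measurable_nr hT.meas 2
    set E : Set ℝ := {t | A < nr 2 (v t)} with hE
    have mE : MeasurableSet E := measurableSet_lt measurable_const mN
    have h1 := h.cutFn (n := n) (hT.cut mE) fun t x hx => by
      by_cases ht : t ∈ E
      · rw [Set.indicator_of_mem ht]; exact hx
      · rw [Set.indicator_of_notMem ht]; rfl
    have e1 : ‖∫ z : ℝ × Ed d, v z.1 z.2 * conj (E.indicator v z.1 z.2)‖ₑ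
        = ∫⁻ t in E, nr 2 (v t) ^ (2 : ℝ) := by
      have e : ∀ z : ℝ × Ed d, v z.1 z.2 * conj (E.indicator v z.1 z.2)
          = ((‖E.indicator v z.1 z.2‖ * ‖E.indicator v z.1 z.2‖ : ℝ) : ℂ) := by
        intro z
        by_cases ht : z.1 ∈ E
        · rw [Set.indicator_of_mem ht, mul_conj, Complex.normSq_eq_norm_sq, pow_two]
        · rw [Set.indicator_of_notMem ht]; simp
      have hTE := hT.cut mE
      obtain ⟨M, R, hM, -⟩ := hTE.bdd
      have hi : Integrable fun z : ℝ × Ed d => ‖E.indicator v z.1 z.2‖ * ‖E.indicator v z.1 z.2‖ := by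
        refine hTE.integrable.norm.bdd_mul (c := M) hTE.meas.norm.aestronglyMeasurable
          (ae_of_all _ fun z => ?_)
        rw [norm_norm]; exact hM z.1 z.2
      simp only [e]
      rw [integral_complex_ofReal, ← ofReal_norm, Complex.norm_real,
        Real.norm_of_nonneg (integral_nonneg fun z => by positivity),
        ofReal_integral_eq_lintegral_ofReal hi (ae_of_all _ fun z => by positivity),
        ← lintegral_indicator mE, Measure.volume_eq_prod,
        lintegral_prod _ (hi.1.aemeasurable.ennreal_ofReal)]
      refine lintegral_congr fun t => ?_
      by_cases ht : t ∈ E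
      · simp only [Set.indicator_of_mem ht]
        rw [nr_rpow two_pos]
        refine lintegral_congr fun x => ?_
        rw [ENNReal.ofReal_mul (norm_nonneg _), ofReal_norm, ENNReal.rpow_two, pow_two]
      · simp [Set.indicator_of_notMem ht]
    have hfin : ∫⁻ t in E, nr 2 (v t) ^ (2 : ℝ) ≠ ∞ :=
      ((setLIntegral_le_lintegral _ _).trans_lt (hT.lintegral_nr_ne_top two_pos two_pos).lt_top).ne
    rw [e1, nrT_indicator one_pos two_pos mE] at h1
    simp only [ENNReal.rpow_one, div_one] at h1
    have h2 : ∀ t ∈ E, A * nr 2 (v t) < nr 2 (v t) ^ (2 : ℝ) := by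
      intro t ht
      have h0 : nr 2 (v t) ≠ 0 := (zero_le.trans_lt (show A < _ from ht)).ne'
      rw [ENNReal.rpow_two, pow_two]
      exact ENNReal.mul_lt_mul_left h0 ((hT.good t).nr_ne_top two_pos) ht
    rw [← lintegral_const_mul _ mN] at h1
    have h3 : volume E = 0 := by
      by_contra hne
      have hpos := setLIntegral_strict_mono (μ := volume) mE hne (mN.pow_const 2)
        (ne_top_of_le_ne_top hfin (setLIntegral_mono (mN.pow_const 2) fun t ht => (h2 t ht).le))
        (ae_of_all _ h2)
      exact absurd h1 (not_le.2 hpos)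
    filter_upwards [measure_eq_zero_iff_ae_notMem.1 h3] with t ht
    exact not_lt.1 ht
  filter_upwards [ae_restrict_mem hI, ae_restrict_of_ae (ae_all_iff.2 hn)] with t ht h
  exact le_of_tendsto' (tendsto_nr_cutFn hw hI two_pos ht) h

end

end Plate

namespace Plate

open scoped ComplexConjugate Topology

variable {d : ℕ} {w : ℝ → Ed d → ℂ} {I : Set ℝ}

lemma tendsto_const_rpow_one_div {c : ℝ≥0∞} (h0 : c ≠ 0) (ht : c ≠ ∞) {r : ℕ → ℝ}
    (hr : Tendsto r atTop atTop) : Tendsto (fun n => c ^ (1 / r n)) atTop (𝓝 1) := by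
  lift c to NNReal using ht
  have h0' : (c : ℝ) ≠ 0 := by exact_mod_cast h0
  have h1 : Tendsto (fun n => 1 / r n) atTop (𝓝 0) := by
    simp only [one_div]
    exact tendsto_inv_atTop_zero.comp hr
  have h2 : Tendsto (fun n => (c : ℝ) ^ (1 / r n)) atTop (𝓝 1) := by
    have := (Real.continuousAt_const_rpow (b := 0) h0').tendsto.comp h1
    rwa [Real.rpow_zero] at this
  have h3 := ENNReal.tendsto_ofReal h2
  rw [ENNReal.ofReal_one] at h3
  refine h3.congr fun n => ?_
  have := ENNReal.ofReal_rpow_of_pos (lt_of_le_of_ne c.2 h0'.symm) (p := 1 / r n)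
  rw [← ENNReal.ofReal_coe_nnreal]
  exact this.symm

lemma eLpNorm_top_le_liminf {t : ℝ} (ht : t ∈ I) (hI : MeasurableSet I)
    (hw : Measurable (Function.uncurry w)) {r : ℕ → ℝ} (hr0 : ∀ n, 0 < r n)
    (hr : Tendsto r atTop atTop) :
    eLpNorm (w t) ∞ volume ≤ liminf (fun n => nr (r n) (cutFn I w n t)) atTop := by
  refine le_of_forall_lt fun a ha => ?_
  obtain ⟨b, hab, hb⟩ := exists_between ha
  have hm : ∃ m, volume {x | b < ‖cutFn I w m t x‖ₑ} ≠ 0 := by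
    by_contra! h
    have hU := measure_iUnion_null h
    refine absurd hb (not_lt.2 ?_)
    rw [eLpNorm_exponent_top]
    refine essSup_le_of_ae_le _ ?_
    filter_upwards [measure_eq_zero_iff_ae_notMem.1 hU] with x hx
    obtain ⟨m, hm⟩ := (eventually_mem_cutSet (w := w) ht x).exists
    have hx' := fun h => hx (Set.mem_iUnion.2 ⟨m, h⟩)
    rw [Set.mem_ofPred_eq, cutFn, Set.indicator_of_mem hm] at hx'
    exact not_lt.1 hx'
  obtain ⟨m, hm⟩ := hm
  set v := min (volume {x | b < ‖cutFn I w m t x‖ₑ}) 1 with hv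
  have hv0 : v ≠ 0 := (lt_min (pos_iff_ne_zero.2 hm) one_pos).ne'
  have hv1 : v ≠ ∞ := ((min_le_right _ _).trans_lt ENNReal.one_lt_top).ne
  have hlim : Tendsto (fun n => b * v ^ (1 / r n)) atTop (𝓝 b) := by
    simpa using ENNReal.Tendsto.const_mul (a := b) (tendsto_const_rpow_one_div hv0 hv1 hr)
      (Or.inl one_ne_zero)
  refine hab.trans_le (hlim.liminf_eq.symm.trans_le (liminf_le_liminf ?_))
  filter_upwards [eventually_ge_atTop m] with n hn
  have h1 : b ^ r n * volume {x | b < ‖cutFn I w m t x‖ₑ}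
      ≤ ∫⁻ x, ‖cutFn I w n t x‖ₑ ^ r n := by
    have mm : Measurable fun x => ‖cutFn I w n t x‖ₑ ^ r n :=
      ((tst_cutFn hI hw n).good t).meas.enorm.pow_const _
    refine le_trans ?_ (mul_meas_ge_le_lintegral mm (b ^ r n))
    gcongr with x
    intro hx
    exact ENNReal.rpow_le_rpow ((le_of_lt hx).trans (enorm_cutFn_mono t x hn)) (hr0 n).le
  rw [← nr_rpow (hr0 n)] at h1
  have h2 : (b * v ^ (1 / r n)) ^ r n ≤ nr (r n) (cutFn I w n t) ^ r n := by
    rw [ENNReal.mul_rpow_of_nonneg _ _ (hr0 n).le, ← ENNReal.rpow_mul, one_div_mul_cancel (hr0 n).ne',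
      ENNReal.rpow_one]
    exact (mul_le_mul_right (min_le_left _ _) _).trans h1
  exact (ENNReal.rpow_le_rpow_iff (hr0 n)).1 h2

lemma nr_one_le_mul {g : Ed d → ℂ} (hg : Measurable g) {R r : ℝ} (hr : 2 ≤ r)
    (h : ∀ x, R < ‖x‖ → g x = 0) :
    nr 1 g ≤ nr (r / (r - 1)) g * volume (Metric.closedBall (0 : Ed d) R) ^ (1 / r) := by
  have hr1 : 0 < r - 1 := by linarith
  have hr' : 1 ≤ r / (r - 1) := by rw [le_div_iff₀ hr1]; linarith
  have hs : Function.support g ⊆ Metric.closedBall (0 : Ed d) R := by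
    intro x hx
    by_contra hx'
    exact hx (h x (by simpa using hx'))
  rw [nr_one, nr_eq_eLpNorm (by linarith), ← eLpNorm_restrict_eq_of_support_subset hs,
    ← eLpNorm_restrict_eq_of_support_subset (p := ENNReal.ofReal _) hs]
  refine (eLpNorm_le_eLpNorm_mul_rpow_measure_univ (p := 1) (q := ENNReal.ofReal (r / (r - 1)))
    (by rw [← ENNReal.ofReal_one]; exact ENNReal.ofReal_le_ofReal hr')
    hg.aestronglyMeasurable).trans (le_of_eq ?_)
  rw [Measure.restrict_apply_univ, ENNReal.toReal_ofReal (by linarith), ENNReal.toReal_one]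
  congr 2
  have : r ≠ 0 := by linarith
  field_simp
  ring

lemma PairBound.eLpNorm_top_le (hI : MeasurableSet I) (hw : Measurable (Function.uncurry w))
    {q : ℝ} (hq : 1 < q) {A : ℝ≥0∞} (h : PairBound I w (q / (q - 1)) 1 A) :
    (∫⁻ t in I, eLpNorm (w t) ∞ volume ^ q) ^ (1 / q) ≤ A := by
  have hq0 : 0 < q := by linarith
  have hq1 : 0 < q - 1 := by linarith
  have hQ : 0 < q / (q - 1) := by positivity
  have key : ∀ (n : ℕ) (r : ℝ), 2 ≤ r → nrT q r (Plate.cutFn I w n)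
      ≤ A * volume (Metric.closedBall (0 : Ed d) n) ^ (1 / r) := by
    intro n r hr
    refine (tst_cutFn hI hw n).nrT_le_of_forall hq hr fun G hG hG0 => (h.cutFn hG hG0).trans ?_
    rw [mul_assoc]
    refine mul_le_mul_right ?_ _
    set c := volume (Metric.closedBall (0 : Ed d) n) ^ (1 / r) with hc
    have h1 : ∀ t, nr 1 (G t) ^ (q / (q - 1))
        ≤ c ^ (q / (q - 1)) * nr (r / (r - 1)) (G t) ^ (q / (q - 1)) := by
      intro t
      rw [← ENNReal.mul_rpow_of_nonneg _ _ hQ.le, mul_comm]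
      refine ENNReal.rpow_le_rpow (nr_one_le_mul (hG.good t).meas hr fun x hx => hG0 t x ?_) hQ.le
      exact Set.indicator_of_notMem (fun h => absurd h.2.2.1 (not_le.2 hx)) _
    have m1 := (measurable_nr hG.meas (r / (r - 1))).pow_const (q / (q - 1))
    have h2 := lintegral_mono h1 (μ := volume)
    rw [lintegral_const_mul _ m1] at h2
    refine (ENNReal.rpow_le_rpow h2 (by positivity)).trans (le_of_eq ?_)
    rw [ENNReal.mul_rpow_of_nonneg _ _ (by positivity), ← ENNReal.rpow_mul,
      mul_one_div_cancel hQ.ne', ENNReal.rpow_one, nrT]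
  have hr : ∀ n : ℕ, ∃ r : ℝ, (n : ℝ) + 2 ≤ r ∧
      volume (Metric.closedBall (0 : Ed d) n) ^ (1 / r) ≤ 1 + ENNReal.ofReal (1 / (n + 1)) := by
    intro n
    set c := volume (Metric.closedBall (0 : Ed d) n) + 1 with hc
    have hc1 : c ≠ ∞ := ENNReal.add_ne_top.2 ⟨measure_closedBall_lt_top.ne, ENNReal.one_ne_top⟩
    have hlim := tendsto_const_rpow_one_div (c := c) (by simp [hc]) hc1
      tendsto_natCast_atTop_atTop
    have hlt : (1 : ℝ≥0∞) < 1 + ENNReal.ofReal (1 / (n + 1)) :=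
      ENNReal.lt_add_right ENNReal.one_ne_top (by simp; positivity)
    obtain ⟨N, hN1, hN2⟩ := ((hlim.eventually_lt_const hlt).and
      (eventually_ge_atTop (n + 2))).exists
    refine ⟨N, by exact_mod_cast hN2, le_trans ?_ hN1.le⟩
    exact ENNReal.rpow_le_rpow le_self_add (by positivity)
  choose r hr1 hr2 using hr
  have hr3 : ∀ n, 2 ≤ r n := fun n => by
    have := hr1 n
    have : (0 : ℝ) ≤ n := n.cast_nonneg
    linarith
  have hlim : Tendsto r atTop atTop := tendsto_atTop_mono (fun n => by linarith [hr1 n])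
    (tendsto_natCast_atTop_atTop (R := ℝ))
  have hA : Tendsto (fun n : ℕ => (A * (1 + ENNReal.ofReal (1 / ((n : ℝ) + 1)))) ^ q) atTop
      (𝓝 (A ^ q)) := by
    refine (ENNReal.continuous_rpow_const.tendsto _).comp ?_
    have h1 := ENNReal.tendsto_ofReal (tendsto_one_div_add_atTop_nhds_zero_nat (𝕜 := ℝ))
    have h2 := h1.const_add (1 : ℝ≥0∞)
    rw [ENNReal.ofReal_zero, add_zero] at h2
    simpa using ENNReal.Tendsto.const_mul (a := A) h2 (Or.inl one_ne_zero)
  rw [one_div, ENNReal.rpow_inv_le_iff hq0]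
  calc ∫⁻ t in I, eLpNorm (w t) ∞ volume ^ q
      ≤ ∫⁻ t in I, liminf (fun n => nr (r n) (Plate.cutFn I w n t) ^ q) atTop := by
        refine setLIntegral_mono_ae' hI (ae_of_all _ fun t ht => ?_)
        refine (ENNReal.rpow_le_rpow (eLpNorm_top_le_liminf ht hI hw
          (fun n => by linarith [hr3 n]) hlim) hq0.le).trans (le_of_eq ?_)
        exact (ENNReal.monotone_rpow_of_nonneg hq0.le).map_liminf_of_continuousAt
          _ ENNReal.continuous_rpow_const.continuousAt
    _ ≤ liminf (fun n => ∫⁻ t in I, nr (r n) (Plate.cutFn I w n t) ^ q) atTop :=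
        lintegral_liminf_le fun n => (measurable_nr (tst_cutFn hI hw n).meas _).pow_const q
    _ ≤ liminf (fun n : ℕ => (A * (1 + ENNReal.ofReal (1 / ((n : ℝ) + 1)))) ^ q) atTop := by
        refine liminf_le_liminf (Eventually.of_forall fun n => ?_)
        have h1 := (key n (r n) (hr3 n)).trans (mul_le_mul_right (hr2 n) A)
        rw [nrT, one_div, ENNReal.rpow_inv_le_iff hq0] at h1
        exact (setLIntegral_le_lintegral _ _).trans h1
    _ = A ^ q := hA.liminf_eq

end Plate

namespace Plate

open FourierTransform
open scoped ComplexConjugate Topology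

variable {d : ℕ} {I : Set ℝ} {m m' G : ℝ → Ed d → ℂ} {Q p κ : ℝ} {A A' : ℝ≥0∞}

/-- A family of frequency-side functions dominated locally uniformly in time. -/
structure Fam (m : ℝ → Ed d → ℂ) : Prop where
  meas : Measurable (Function.uncurry m)
  bdd : ∀ R : ℝ, ∃ maj : Ed d → ℝ, Integrable maj ∧ ∀ t, |t| ≤ R → ∀ η, ‖m t η‖ ≤ maj η

lemma stronglyMeasurable_fourier (hG : Measurable (Function.uncurry G)) :
    StronglyMeasurable fun z : ℝ × Ed d => 𝓕 (G z.1) z.2 := by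
  have h := stronglyMeasurable_evol (κ := 0) hG
  have e : Function.uncurry (evol 0 G) = fun z : ℝ × Ed d => 𝓕 (G z.1) z.2 := by
    ext ⟨t, η⟩
    simp [evol]
  rwa [e] at h

lemma Tst.exists_fourier_bound (hG : Tst G) : ∃ B : ℝ, 0 ≤ B ∧ ∀ t η, ‖𝓕 (G t) η‖ ≤ B := by
  obtain ⟨B, R, hB, h, -⟩ := hG.nr_bound one_pos
  refine ⟨B.toReal, ENNReal.toReal_nonneg, fun t η => (norm_fourier_le _ _).trans ?_⟩
  rw [integral_norm_eq_lintegral_enorm (hG.good t).meas.aestronglyMeasurable,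
    ← eLpNorm_one_eq_lintegral_enorm, ← nr_one]
  exact ENNReal.toReal_mono hB (h t)

lemma fourierInv_conj (g : Ed d → ℂ) (η : Ed d) :
    𝓕⁻ (fun x => conj (g x)) η = conj (𝓕 g η) := by
  rw [conj_fourier, Real.fourierInv_eq_fourier_comp_neg]

lemma Tst.fourier_eq_zero {R : ℝ} (hR : ∀ t x, R < |t| → G t x = 0) {t : ℝ} (ht : R < |t|)
    (η : Ed d) : 𝓕 (G t) η = 0 := by
  have : G t = fun _ => 0 := funext fun x => hR t x ht
  rw [this, Real.fourier_eq']
  simp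

namespace Fam

lemma integrable (hm : Fam m) (t : ℝ) : Integrable (m t) := by
  obtain ⟨maj, h1, h2⟩ := hm.bdd |t|
  exact h1.mono' hm.meas.of_uncurry_left.aestronglyMeasurable (ae_of_all _ (h2 t le_rfl))

lemma add (hm : Fam m) (hm' : Fam m') : Fam fun t η => m t η + m' t η := by
  refine ⟨hm.meas.add hm'.meas, fun R => ?_⟩
  obtain ⟨maj, h1, h2⟩ := hm.bdd R
  obtain ⟨maj', h1', h2'⟩ := hm'.bdd R
  exact ⟨fun η => maj η + maj' η, h1.add h1', fun t ht η =>
    (norm_add_le _ _).trans (add_le_add (h2 t ht η) (h2' t ht η))⟩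

lemma const_mul (hm : Fam m) (c : ℂ) : Fam fun t η => c * m t η := by
  refine ⟨hm.meas.const_mul c, fun R => ?_⟩
  obtain ⟨maj, h1, h2⟩ := hm.bdd R
  refine ⟨fun η => ‖c‖ * maj η, h1.const_mul _, fun t ht η => ?_⟩
  rw [norm_mul]
  exact mul_le_mul_of_nonneg_left (h2 t ht η) (norm_nonneg _)

lemma measurable_fourierInv (hm : Fam m) : Measurable (Function.uncurry fun t => 𝓕⁻ (m t)) := by
  have h : StronglyMeasurable (fun z : ℝ × Ed d => 𝓕⁻ (m z.1) z.2) := by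
    simp only [Real.fourierInv_eq']
    refine StronglyMeasurable.integral_prod_right
      (f := fun (z : ℝ × Ed d) v => cexp (↑(2 * Real.pi * ⟪v, z.2⟫) * Complex.I) • m z.1 v) ?_
    refine Measurable.stronglyMeasurable ?_
    have a : Measurable fun z : (ℝ × Ed d) × Ed d => m z.1.1 z.2 :=
      hm.meas.comp (by fun_prop : Measurable fun z : (ℝ × Ed d) × Ed d => (z.1.1, z.2))
    have b : Measurable fun z : (ℝ × Ed d) × Ed d =>
        cexp (↑(2 * Real.pi * ⟪z.2, z.1.2⟫) * Complex.I) := by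
      refine Continuous.measurable ?_
      fun_prop
    exact b.smul a
  exact h.measurable

lemma integrable_mul (hm : Fam m) (hG : Tst G) :
    Integrable fun z : ℝ × Ed d => m z.1 z.2 * conj (𝓕 (G z.1) z.2) := by
  obtain ⟨-, R, -, hR, -⟩ := hG.bdd
  obtain ⟨B, hB, hB'⟩ := hG.exists_fourier_bound
  obtain ⟨maj, h1, h2⟩ := hm.bdd R
  have hi : Integrable ((Set.Icc (-R) R).indicator fun _ : ℝ => (1 : ℝ)) :=
    (integrable_indicator_iff measurableSet_Icc).2 (by simp)
  refine (hi.mul_prod (h1.mul_const B)).mono' ?_ (ae_of_all _ fun z => ?_)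
  · exact hm.meas.aestronglyMeasurable.mul
      (continuous_conj.comp_stronglyMeasurable (stronglyMeasurable_fourier hG.meas)).aestronglyMeasurable
  · by_cases ht : |z.1| ≤ R
    · rw [Set.indicator_of_mem (show z.1 ∈ Set.Icc (-R) R from abs_le.1 ht), one_mul, norm_mul, RCLike.norm_conj]
      exact mul_le_mul (h2 _ ht _) (hB' _ _) (norm_nonneg _) ((norm_nonneg _).trans (h2 _ ht z.2))
    · rw [Tst.fourier_eq_zero hR (not_le.1 ht),
        Set.indicator_of_notMem (show z.1 ∉ Set.Icc (-R) R from fun h => ht (abs_le.2 h))]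
      simp

lemma integrable_fourierInv_mul (hm : Fam m) (hG : Tst G) :
    Integrable fun z : ℝ × Ed d => 𝓕⁻ (m z.1) z.2 * conj (G z.1 z.2) := by
  obtain ⟨-, R, -, hR, -⟩ := hG.bdd
  obtain ⟨maj, h1, h2⟩ := hm.bdd R
  refine (hG.integrable.norm.const_mul (∫ η, maj η)).mono' ?_ (ae_of_all _ fun z => ?_)
  · exact hm.measurable_fourierInv.aestronglyMeasurable.mul
      (continuous_conj.comp_stronglyMeasurable hG.meas.stronglyMeasurable).aestronglyMeasurable
  · by_cases ht : |z.1| ≤ R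
    · rw [norm_mul, RCLike.norm_conj]
      refine mul_le_mul_of_nonneg_right ((norm_fourierInv_le _ _).trans ?_) (norm_nonneg _)
      exact integral_mono (hm.integrable _).norm h1 (h2 _ ht)
    · have h0 : G z.1 z.2 = 0 := hR _ _ (not_le.1 ht)
      simp [h0, Function.uncurry]

lemma integral_fourierInv_mul (hm : Fam m) (hG : Tst G) :
    ∫ z : ℝ × Ed d, 𝓕⁻ (m z.1) z.2 * conj (G z.1 z.2)
      = ∫ z : ℝ × Ed d, m z.1 z.2 * conj (𝓕 (G z.1) z.2) := by
  rw [Measure.volume_eq_prod, integral_prod _ (hm.integrable_fourierInv_mul hG),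
    integral_prod _ (hm.integrable_mul hG)]
  refine integral_congr_ae (ae_of_all _ fun t => ?_)
  have hc : Integrable fun x => conj (G t x) :=
    (hG.good t).integrable.norm.mono'
      (continuous_conj.comp_stronglyMeasurable
        (hG.good t).meas.stronglyMeasurable).aestronglyMeasurable
      (ae_of_all _ fun x => (RCLike.norm_conj _).le)
  simp only
  rw [Plate.integral_fourierInv_mul (hm.integrable t) hc]
  simp only [fourierInv_conj]

end Fam

/-- The frequency-side version of `PairBound`. -/
def FreqBound (I : Set ℝ) (m : ℝ → Ed d → ℂ) (Q p : ℝ) (A : ℝ≥0∞) : Prop :=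
  ∀ G : ℝ → Ed d → ℂ, Tst G → (∀ t ∉ I, ∀ x, G t x = 0) →
    ‖∫ z : ℝ × Ed d, m z.1 z.2 * conj (𝓕 (G z.1) z.2)‖ₑ ≤ A * nrT Q p G

lemma FreqBound.pairBound (h : FreqBound I m Q p A) (hm : Fam m) :
    PairBound I (fun t => 𝓕⁻ (m t)) Q p A := by
  intro G hG hG0
  rw [hm.integral_fourierInv_mul hG]
  exact h G hG hG0

lemma FreqBound.add (h : FreqBound I m Q p A) (h' : FreqBound I m' Q p A') (hm : Fam m)
    (hm' : Fam m') : FreqBound I (fun t η => m t η + m' t η) Q p (A + A') := by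
  intro G hG hG0
  simp only [add_mul]
  rw [integral_add (hm.integrable_mul hG) (hm'.integrable_mul hG)]
  exact (enorm_add_le _ _).trans (add_le_add (h G hG hG0) (h' G hG hG0))

lemma FreqBound.const_mul (h : FreqBound I m Q p A) {c : ℂ} (hc : ‖c‖ ≤ 1) :
    FreqBound I (fun t η => c * m t η) Q p A := by
  intro G hG hG0
  simp only [mul_assoc]
  rw [integral_const_mul, enorm_mul]
  refine (mul_le_of_le_one_left' ?_).trans (h G hG hG0)
  rw [← ofReal_norm, ← ENNReal.ofReal_one]
  exact ENNReal.ofReal_le_ofReal hc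

lemma fam_exp_mul {h : Ed d → ℂ} (hh : Integrable h) (mh : Measurable h) (κ : ℝ) :
    Fam fun t η => cexp (Complex.I * (κ * t * ‖η‖ ^ 2 : ℝ)) * h η := by
  refine ⟨?_, fun R => ⟨fun η => ‖h η‖, hh.norm, fun t _ η => ?_⟩⟩
  · have a : Measurable fun z : ℝ × Ed d => cexp (Complex.I * (κ * z.1 * ‖z.2‖ ^ 2 : ℝ)) := by
      refine Continuous.measurable ?_
      fun_prop
    exact a.mul (mh.comp measurable_snd)
  · rw [norm_mul, norm_exp_I_mul, one_mul]

lemma freqBound_exp_mul {h : Ed d → ℂ} (hh : Integrable h) (mh : Measurable h) {C : ℝ≥0∞}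
    (hC : ∀ G : ℝ → Ed d → ℂ, Tst G → eLpNorm (totalEvol (-κ) G) 2 volume ≤ C * nrT Q p G) :
    FreqBound I (fun t η => cexp (Complex.I * (κ * t * ‖η‖ ^ 2 : ℝ)) * h η) Q p
      (eLpNorm h 2 volume * C) := by
  intro G hG _
  have e : ∀ t η, cexp (Complex.I * (κ * t * ‖η‖ ^ 2 : ℝ)) * h η * conj (𝓕 (G t) η)
      = h η * conj (evol (-κ) G t η) := by
    intro t η
    have : Complex.I * ((κ * t * ‖η‖ ^ 2 : ℝ) : ℂ)
        = -Complex.I * ((-κ * t * ‖η‖ ^ 2 : ℝ) : ℂ) := by push_cast; ring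
    simp only [evol, map_mul, ← Complex.exp_conj, conj_I, conj_ofReal, this]
    ring
  have hi := (fam_exp_mul hh mh κ).integrable_mul hG
  simp only [e] at hi ⊢
  rw [Measure.volume_eq_prod, integral_prod_symm _ hi]
  simp only [integral_const_mul, integral_conj]
  change ‖∫ η, h η * conj (totalEvol (-κ) G η)‖ₑ ≤ _
  rw [mul_assoc]
  exact (enorm_integral_mul_conj_le hh.1 (measurable_totalEvol hG.meas).aestronglyMeasurable).trans
    (mul_le_mul_right (hC G hG) _)

end Plate

namespace Plate

open FourierTransform
open scoped ComplexConjugate Topology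

variable {d : ℕ} {I : Set ℝ} {w k : ℝ → Ed d → ℂ} {Q p Q' p' κ : ℝ} {C : ℝ≥0∞}

lemma tendsto_propForm {k h : Ed d → ℂ} (hk : Integrable k) (hk2 : MemLp (𝓕⁻ k) 2) (hh : Good h)
    {g : ℕ → Ed d → ℂ} (hg : ∀ n, Good (g n))
    (hlim : Tendsto (fun n => eLpNorm (g n - 𝓕⁻ k) 2 volume) atTop (𝓝 0)) (τ : ℝ) :
    Tendsto (fun n => propForm τ (g n) h) atTop
      (𝓝 (∫ η, cexp (Complex.I * (τ * ‖η‖ ^ 2 : ℝ)) * (k η * conj (𝓕 h η)))) := by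
  have mh : AEStronglyMeasurable (𝓕 h) := (continuous_fourier hh.integrable).aestronglyMeasurable
  have mE : AEStronglyMeasurable fun η : Ed d => cexp (Complex.I * (τ * ‖η‖ ^ 2 : ℝ)) := by
    refine Continuous.aestronglyMeasurable ?_
    fun_prop
  have hk' : Integrable fun η => cexp (Complex.I * (τ * ‖η‖ ^ 2 : ℝ)) * (k η * conj (𝓕 h η)) := by
    refine (hk.norm.mul_const (∫ y, ‖h y‖)).mono'
      (mE.mul (hk.1.mul (continuous_conj.comp_aestronglyMeasurable mh))) (ae_of_all _ fun η => ?_)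
    rw [norm_mul, norm_exp_I_mul, one_mul, norm_mul, RCLike.norm_conj]
    exact mul_le_mul_of_nonneg_left (norm_fourier_le _ _) (norm_nonneg _)
  rw [tendsto_iff_edist_tendsto_0]
  have hlim' : Tendsto (fun n => eLpNorm (g n - 𝓕⁻ k) 2 volume * nr 2 h) atTop (𝓝 0) := by
    simpa using ENNReal.Tendsto.mul_const hlim (Or.inr (hh.nr_ne_top two_pos))
  refine tendsto_of_tendsto_of_tendsto_of_le_of_le tendsto_const_nhds hlim' (fun _ => zero_le)
    fun n => ?_
  simp only
  rw [edist_eq_enorm_sub, propForm, ← integral_sub (integrable_propForm τ (hg n) hh) hk',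
    ← eLpNorm_fourier_sub (hg n).integrable (hg n).memLp_two hk hk2, nr_two,
    ← eLpNorm_fourier hh.integrable hh.memLp_two]
  refine (enorm_integral_le_lintegral_enorm _).trans (le_trans (le_of_eq ?_)
    (enorm_integral_mul_le
      ((continuous_fourier (hg n).integrable).aestronglyMeasurable.sub hk.1) mh))
  refine lintegral_congr fun η => ?_
  rw [← mul_sub, ← sub_mul, enorm_mul, enorm_exp_I_mul, one_mul, enorm_mul, RCLike.enorm_conj]
  rfl

lemma tendsto_eLpNorm_cutFn_sub (hI : MeasurableSet I) (hw : Measurable (Function.uncurry w))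
    {t : ℝ} (ht : t ∈ I) (h : MemLp (w t) 2) :
    Tendsto (fun n => eLpNorm (cutFn I w n t - w t) 2 volume) atTop (𝓝 0) := by
  simp only [← nr_two]
  unfold nr
  have h0 : (0 : ℝ≥0∞) ^ (1 / 2 : ℝ) = 0 := by simp
  rw [← h0]
  refine (ENNReal.continuous_rpow_const.tendsto _).comp ?_
  have hz : (0 : ℝ≥0∞) = ∫⁻ _ : Ed d, 0 := by simp
  rw [hz]
  refine tendsto_lintegral_of_dominated_convergence' (fun x => ‖w t x‖ₑ ^ (2 : ℝ))
    (fun n => ?_) (fun n => ae_of_all _ fun x => ?_) ?_ (ae_of_all _ fun x => ?_)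
  · exact ((((tst_cutFn hI hw n).good t).meas.sub hw.of_uncurry_left).enorm.pow_const _).aemeasurable
  · refine ENNReal.rpow_le_rpow ?_ two_pos.le
    by_cases hx : (t, x) ∈ cutSet I w n
    · simp [cutFn, hx, Function.uncurry]
    · simp [cutFn, hx]
  · rw [← nr_rpow two_pos, nr_two]
    exact ENNReal.rpow_ne_top_of_nonneg two_pos.le h.2.ne
  · refine tendsto_const_nhds.congr' ?_
    filter_upwards [eventually_mem_cutSet (w := w) ht x] with n hn
    simp [cutFn, hn, Function.uncurry]

/-- The frequency-side Duhamel integral for the phase `κ`. -/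
def duhamel (κ : ℝ) (k : ℝ → Ed d → ℂ) (t : ℝ) (η : Ed d) : ℂ :=
  ∫ σ in Set.Ico 0 t, cexp (Complex.I * (κ * (σ - t) * ‖η‖ ^ 2 : ℝ)) * k σ η

section

variable {maj : Ed d → ℝ}

lemma fam_of_bound (mk : Measurable (Function.uncurry k)) (hmaj : Integrable maj)
    (hk : ∀ σ η, ‖k σ η‖ ≤ maj η) : Fam k :=
  ⟨mk, fun _ => ⟨maj, hmaj, fun t _ η => hk t η⟩⟩

lemma measurable_duhamel_integrand (mk : Measurable (Function.uncurry k)) :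
    Measurable fun z : (ℝ × Ed d) × ℝ => (Set.Ico 0 z.1.1).indicator
      (fun σ => cexp (Complex.I * (κ * (σ - z.1.1) * ‖z.1.2‖ ^ 2 : ℝ)) * k σ z.1.2) z.2 := by
  have a : Measurable fun z : (ℝ × Ed d) × ℝ => k z.2 z.1.2 :=
    mk.comp (by fun_prop : Measurable fun z : (ℝ × Ed d) × ℝ => (z.2, z.1.2))
  have b : Measurable fun z : (ℝ × Ed d) × ℝ =>
      cexp (Complex.I * (κ * (z.2 - z.1.1) * ‖z.1.2‖ ^ 2 : ℝ)) := by
    refine Continuous.measurable ?_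
    fun_prop
  have s : MeasurableSet {z : (ℝ × Ed d) × ℝ | 0 ≤ z.2 ∧ z.2 < z.1.1} :=
    (measurableSet_le measurable_const measurable_snd).inter
      (measurableSet_lt measurable_snd (by fun_prop))
  exact (b.mul a).indicator s

lemma fam_duhamel (mk : Measurable (Function.uncurry k)) (hmaj : Integrable maj)
    (hk : ∀ σ η, ‖k σ η‖ ≤ maj η) (κ : ℝ) : Fam (duhamel κ k) := by
  refine ⟨?_, fun R => ⟨fun η => R * maj η, hmaj.const_mul R, fun t ht η => ?_⟩⟩
  · have h := (measurable_duhamel_integrand (κ := κ) mk).stronglyMeasurable.integral_prod_right'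
      (ν := volume)
    have e : Function.uncurry (duhamel κ k) = fun z : ℝ × Ed d => ∫ σ, (Set.Ico 0 z.1).indicator
        (fun σ => cexp (Complex.I * (κ * (σ - z.1) * ‖z.2‖ ^ 2 : ℝ)) * k σ z.2) σ := by
      ext z
      rw [integral_indicator measurableSet_Ico]
      rfl
    rw [e]
    exact h.measurable
  · have h0 : 0 ≤ maj η := (norm_nonneg _).trans (hk 0 η)
    refine (norm_setIntegral_le_of_norm_le_const (C := maj η) (by simp) fun σ _ => ?_).trans ?_
    · rw [norm_mul, norm_exp_I_mul, one_mul]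
      exact hk σ η
    · rw [mul_comm, measureReal_def, Real.volume_Ico, sub_zero]
      refine mul_le_mul_of_nonneg_right ?_ h0
      rcases le_total 0 t with h | h
      · rw [ENNReal.toReal_ofReal h]; exact (le_abs_self t).trans ht
      · rw [ENNReal.ofReal_of_nonpos h]; exact (abs_nonneg t).trans ht

/-- The Duhamel kernel tested against a space-time function. -/
def duhamelForm (κ : ℝ) (k G : ℝ → Ed d → ℂ) (σ t : ℝ) : ℂ :=
  ∫ η, cexp (Complex.I * (κ * (σ - t) * ‖η‖ ^ 2 : ℝ)) * (k σ η * conj (𝓕 (G t) η))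

variable {G : ℝ → Ed d → ℂ}

lemma stronglyMeasurable_duhamelForm (mk : Measurable (Function.uncurry k)) (hG : Tst G) :
    StronglyMeasurable (Function.uncurry (duhamelForm κ k G)) := by
  have c : StronglyMeasurable fun z : (ℝ × ℝ) × Ed d => 𝓕 (G z.1.2) z.2 := by
    refine (stronglyMeasurable_fourier hG.meas).comp_measurable
      (g := fun z : (ℝ × ℝ) × Ed d => (z.1.2, z.2)) ?_
    fun_prop
  have m : StronglyMeasurable fun z : (ℝ × ℝ) × Ed d =>
      cexp (Complex.I * (κ * (z.1.1 - z.1.2) * ‖z.2‖ ^ 2 : ℝ)) *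
        (k z.1.1 z.2 * conj (𝓕 (G z.1.2) z.2)) := by
    refine StronglyMeasurable.mul ?_ (StronglyMeasurable.mul ?_ ?_)
    · refine Continuous.stronglyMeasurable ?_
      fun_prop
    · exact (mk.comp (by fun_prop :
        Measurable fun z : (ℝ × ℝ) × Ed d => (z.1.1, z.2))).stronglyMeasurable
    · exact Complex.continuous_conj.comp_stronglyMeasurable c
  have e : Function.uncurry (duhamelForm κ k G) = fun z : ℝ × ℝ => ∫ η : Ed d,
      cexp (Complex.I * (κ * (z.1 - z.2) * ‖η‖ ^ 2 : ℝ)) *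
        (k z.1 η * conj (𝓕 (G z.2) η)) := by
    ext ⟨σ, t⟩
    simp only [Function.uncurry, duhamelForm]
  rw [e]
  exact m.integral_prod_right' (ν := volume)

lemma norm_duhamelForm_le (hmaj : Integrable maj) (hk : ∀ σ η, ‖k σ η‖ ≤ maj η) {B : ℝ}
    (hB : ∀ t η, ‖𝓕 (G t) η‖ ≤ B) (σ t : ℝ) : ‖duhamelForm κ k G σ t‖ ≤ ∫ η, maj η * B := by
  refine norm_integral_le_of_norm_le (hmaj.mul_const B) (ae_of_all _ fun η => ?_)
  rw [norm_mul, norm_exp_I_mul, one_mul, norm_mul, RCLike.norm_conj]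
  exact mul_le_mul (hk σ η) (hB t η) (norm_nonneg _) ((norm_nonneg _).trans (hk σ η))

lemma duhamelForm_eq_zero {R : ℝ} (hR : ∀ t x, R < |t| → G t x = 0) {t : ℝ} (ht : R < |t|) (σ : ℝ) :
    duhamelForm κ k G σ t = 0 := by
  simp [duhamelForm, Tst.fourier_eq_zero hR ht]

/-- The pairs of times at which the Duhamel integral acts. -/
def duhamelRegion : Set (ℝ × ℝ) := {z | 0 ≤ z.1 ∧ z.1 < z.2}

lemma measurableSet_duhamelRegion : MeasurableSet duhamelRegion :=
  (measurableSet_le measurable_const measurable_fst).inter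
    (measurableSet_lt measurable_fst measurable_snd)

lemma integral_duhamel_mul (mk : Measurable (Function.uncurry k)) (hmaj : Integrable maj)
    (hk : ∀ σ η, ‖k σ η‖ ≤ maj η) (hG : Tst G) :
    ∫ z : ℝ × Ed d, duhamel κ k z.1 z.2 * conj (𝓕 (G z.1) z.2)
      = ∫ z, duhamelRegion.indicator (Function.uncurry (duhamelForm κ k G)) z := by
  obtain ⟨-, R, -, hR, -⟩ := hG.bdd
  obtain ⟨B, hB, hB'⟩ := hG.exists_fourier_bound
  have hi : Integrable (duhamelRegion.indicator (Function.uncurry (duhamelForm κ k G))) := by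
    have hR1 : Integrable ((Set.Icc (-R) R).indicator fun _ : ℝ => (1 : ℝ)) :=
      (integrable_indicator_iff measurableSet_Icc).2 (by simp)
    refine (hR1.mul_prod (hR1.mul_const (∫ η, maj η * B))).mono'
      ((stronglyMeasurable_duhamelForm mk hG).indicator
        measurableSet_duhamelRegion).aestronglyMeasurable (ae_of_all _ fun z => ?_)
    have hnn : 0 ≤ ∫ η, maj η * B := integral_nonneg fun η =>
      mul_nonneg ((norm_nonneg _).trans (hk 0 η)) hB
    have hz0 : ∀ z : ℝ × ℝ, 0 ≤ (Set.Icc (-R) R).indicator (fun _ : ℝ => (1 : ℝ)) z.1 *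
        ((Set.Icc (-R) R).indicator (fun _ : ℝ => (1 : ℝ)) z.2 * ∫ η, maj η * B) := fun z =>
      mul_nonneg (Set.indicator_nonneg (fun _ _ => zero_le_one) _)
        (mul_nonneg (Set.indicator_nonneg (fun _ _ => zero_le_one) _) hnn)
    by_cases hz : z ∈ duhamelRegion
    · rw [Set.indicator_of_mem hz]
      by_cases ht : |z.2| ≤ R
      · have h2 : z.2 ∈ Set.Icc (-R) R := abs_le.1 ht
        have h1 : z.1 ∈ Set.Icc (-R) R := ⟨by linarith [hz.1, h2.2, hz.2], hz.2.le.trans h2.2⟩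
        rw [Set.indicator_of_mem h1, Set.indicator_of_mem h2, one_mul, one_mul]
        exact norm_duhamelForm_le hmaj hk hB' _ _
      · have : Function.uncurry (duhamelForm κ k G) z = 0 :=
          duhamelForm_eq_zero hR (not_le.1 ht) _
        rw [this, norm_zero]
        exact hz0 z
    · rw [Set.indicator_of_notMem hz, norm_zero]
      exact hz0 z
  rw [Measure.volume_eq_prod, integral_prod _ ((fam_duhamel mk hmaj hk κ).integrable_mul hG),
    Measure.volume_eq_prod, integral_prod_symm _ hi]
  refine integral_congr_ae (ae_of_all _ fun t => ?_)
  simp only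
  have hs : Integrable (fun z : ℝ × Ed d =>
      cexp (Complex.I * (κ * (z.1 - t) * ‖z.2‖ ^ 2 : ℝ)) * k z.1 z.2 * conj (𝓕 (G t) z.2))
      ((volume.restrict (Set.Ico 0 t)).prod volume) := by
    have h1 : Integrable (fun _ : ℝ => (1 : ℝ)) (volume.restrict (Set.Ico 0 t)) := by simp
    refine (h1.mul_prod (hmaj.mul_const B)).mono' ?_ (ae_of_all _ fun z => ?_)
    · have b : Measurable fun z : ℝ × Ed d =>
          cexp (Complex.I * (κ * (z.1 - t) * ‖z.2‖ ^ 2 : ℝ)) := by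
        refine Continuous.measurable ?_
        fun_prop
      have c : Measurable fun z : ℝ × Ed d => 𝓕 (G t) z.2 :=
        (continuous_fourier (hG.good t).integrable).measurable.comp measurable_snd
      exact ((b.mul mk).mul (Complex.continuous_conj.measurable.comp c)).aestronglyMeasurable
    · rw [norm_mul, norm_mul, norm_exp_I_mul, one_mul, one_mul, RCLike.norm_conj]
      exact mul_le_mul (hk _ _) (hB' _ _) (norm_nonneg _) ((norm_nonneg _).trans (hk z.1 z.2))
  simp only [duhamel, ← integral_mul_const]
  rw [← integral_integral_swap (f := fun σ η =>
    cexp (Complex.I * (κ * (σ - t) * ‖η‖ ^ 2 : ℝ)) * k σ η * conj (𝓕 (G t) η)) hs,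
    ← integral_indicator measurableSet_Ico]
  refine integral_congr_ae (ae_of_all _ fun σ => ?_)
  by_cases h : σ ∈ Set.Ico 0 t
  · have h' : (σ, t) ∈ duhamelRegion := h
    simp only [Set.indicator_of_mem h, Set.indicator_of_mem h', Function.uncurry, duhamelForm,
      mul_assoc]
  · have h' : (σ, t) ∉ duhamelRegion := h
    simp only [Set.indicator_of_notMem h, Set.indicator_of_notMem h']

end

end Plate

namespace Plate

open FourierTransform
open scoped ComplexConjugate Topology

variable {d : ℕ} {I : Set ℝ} {k G H : ℝ → Ed d → ℂ} {Q p Q' p' κ : ℝ} {C N : ℝ≥0∞}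

lemma fourier_zero_fun : 𝓕 (0 : Ed d → ℂ) = 0 := by
  ext η
  simp [Real.fourier_eq']

lemma tform_eq_zero_left {s : ℝ} (h : ∀ x, G s x = 0) (t : ℝ) : tform κ G H s t = 0 := by
  have : G s = 0 := funext h
  simp [tform, propForm, this, fourier_zero_fun]

lemma tform_eq_zero_right {t : ℝ} (h : ∀ x, H t x = 0) (s : ℝ) : tform κ G H s t = 0 := by
  have : H t = 0 := funext h
  simp [tform, propForm, this, fourier_zero_fun]

lemma lintegral_nr_two_ne_top {f : ℝ → Ed d → ℂ} (mf : Measurable (Function.uncurry f)) {M : ℝ}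
    (hM : ∀ σ x, ‖f σ x‖ ≤ M) (hp : 0 < p) (hp2 : p ≤ 2) (hQ : 1 ≤ Q) {S : Set ℝ}
    (hS : volume S ≠ ∞) (h : ∫⁻ σ in S, nr p (f σ) ^ Q ≠ ∞) :
    ∫⁻ σ in S, nr 2 (f σ) ≠ ∞ := by
  have hpow : ∀ y : ℝ≥0∞, y ^ (p / 2) ≤ 1 + y ^ Q := by
    intro y
    rcases le_total y 1 with hy | hy
    · exact (ENNReal.rpow_le_one hy (by positivity)).trans le_self_add
    · exact (ENNReal.rpow_le_rpow_of_exponent_le hy (by linarith)).trans le_add_self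
  have hle : ∀ σ, nr 2 (f σ) ≤ ENNReal.ofReal M ^ (1 - p / 2) * (1 + nr p (f σ) ^ Q) := by
    intro σ
    have h1 := eLpNorm_two_le_of_bound (μ := volume) (hM σ) hp hp2
    rw [nr_two, nr_eq_eLpNorm hp]
    refine h1.trans (mul_le_mul_right (hpow _) _)
  refine ne_top_of_le_ne_top ?_ (lintegral_mono hle)
  have m : Measurable fun σ => 1 + nr p (f σ) ^ Q :=
    ((measurable_nr mf p).pow_const Q).const_add 1
  rw [lintegral_const_mul _ m, lintegral_add_left measurable_const]
  refine ENNReal.mul_ne_top (ENNReal.rpow_ne_top_of_nonneg (by linarith) ENNReal.ofReal_ne_top)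
    (ENNReal.add_ne_top.2 ⟨?_, h⟩)
  simpa using hS

lemma freqBound_duhamel {maj : Ed d → ℝ} (hI : MeasurableSet I) (hord : I.OrdConnected)
    (h0 : (0 : ℝ) ∈ I) (hI0 : I ⊆ Set.Ici 0) (mk : Measurable (Function.uncurry k))
    (hmaj : Integrable maj) (hk : ∀ σ η, ‖k σ η‖ ≤ maj η) (hp : 0 < p') (hp2 : p' ≤ 2)
    (hQ : 1 ≤ Q') (hN : (∫⁻ σ in I, nr p' (𝓕⁻ (k σ)) ^ Q') ^ (1 / Q') ≤ N) (hN' : N ≠ ∞)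
    (hC : ∀ G H : ℝ → Ed d → ℂ, Tst G → Tst H →
      ‖bform κ (band (Set.Iio 0)) G H‖ₑ ≤ C * (nrT Q' p' G * nrT Q p H)) :
    FreqBound I (duhamel κ k) Q p (C * N) := by
  intro G hG hG0
  have hQ0 : 0 < Q' := by linarith
  rw [integral_duhamel_mul mk hmaj hk hG]
  set f : ℝ → Ed d → ℂ := fun σ => 𝓕⁻ (k σ) with hf
  have mf : Measurable (Function.uncurry f) := (fam_of_bound mk hmaj hk).measurable_fourierInv
  have ki : ∀ σ, Integrable (k σ) := (fam_of_bound mk hmaj hk).integrable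
  have hM : ∀ σ x, ‖f σ x‖ ≤ ∫ η, maj η := fun σ x =>
    (norm_fourierInv_le _ _).trans (integral_mono (ki σ).norm hmaj (hk σ))
  obtain ⟨-, R, -, hR, -⟩ := hG.bdd
  have hfn : ∀ n, nrT Q' p' (cutFn I f n) ≤ N := by
    intro n
    refine le_trans (ENNReal.rpow_le_rpow ?_ (by positivity)) hN
    rw [← lintegral_indicator hI]
    refine lintegral_mono fun σ => ?_
    by_cases hσ : σ ∈ I
    · rw [Set.indicator_of_mem hσ]
      exact ENNReal.rpow_le_rpow (nr_mono hp (enorm_cutFn_le n σ)) hQ0.le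
    · have : nr p' (cutFn I f n σ) = 0 := by
        simp [nr, cutFn_of_notMem hσ, hp]
      simp [this, hQ0]
  set A : ℝ → ℝ≥0∞ := (I ∩ Set.Icc 0 R).indicator fun σ => nr 2 (f σ) with hA
  have mA : Measurable A := (measurable_nr mf 2).indicator (hI.inter measurableSet_Icc)
  have hAi : ∫⁻ σ, A σ ≠ ∞ := by
    rw [lintegral_indicator (hI.inter measurableSet_Icc)]
    refine lintegral_nr_two_ne_top mf hM hp hp2 hQ ?_ ?_
    · exact measure_ne_top_of_subset Set.inter_subset_right (by simp)
    · have h1 : ∫⁻ σ in I, nr p' (f σ) ^ Q' ≠ ∞ := by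
        intro h
        rw [h, ENNReal.top_rpow_of_pos (by positivity)] at hN
        exact hN' (top_le_iff.1 hN)
      exact ne_top_of_le_ne_top h1 (lintegral_mono_set Set.inter_subset_left)
  have hAe : ∀ᵐ z : ℝ × ℝ, A z.1 < ∞ :=
    Measure.quasiMeasurePreserving_fst.ae (ae_lt_top mA hAi)
  obtain ⟨B, R', hB, hB1, hB2⟩ := hG.nr_bound two_pos
  have hbi : Integrable fun z : ℝ × ℝ => (A z.1).toReal * (nr 2 (G z.2)).toReal := by
    refine (integrable_toReal_of_lintegral_ne_top mA.aemeasurable hAi).mul_prod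
      (integrable_toReal_of_lintegral_ne_top (measurable_nr hG.meas 2).aemeasurable ?_)
    have := hG.lintegral_nr_ne_top two_pos one_pos
    simpa using this
  have lim : Tendsto (fun n => bform κ (band (Set.Iio 0)) (cutFn I f n) G) atTop
      (𝓝 (∫ z, duhamelRegion.indicator (Function.uncurry (duhamelForm κ k G)) z)) := by
    simp only [bform]
    simp only [← integral_indicator (measurableSet_band measurableSet_Iio)]
    refine tendsto_integral_of_dominated_convergence _ (fun n => ?_) hbi (fun n => ?_) ?_
    · exact ((stronglyMeasurable_tform (tst_cutFn hI mf n).meas hG.meas).indicator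
        (measurableSet_band measurableSet_Iio)).aestronglyMeasurable
    · filter_upwards [hAe] with z hz
      have hnn : 0 ≤ (A z.1).toReal * (nr 2 (G z.2)).toReal := by positivity
      by_cases hb : z ∈ band (Set.Iio (0 : ℝ))
      · rw [Set.indicator_of_mem hb]
        by_cases hz1 : z.1 ∈ I
        · by_cases hz2 : |z.2| ≤ R
          · have hlt : z.1 < z.2 := by
              have : z.1 - z.2 < 0 := hb
              linarith
            have hm : z.1 ∈ I ∩ Set.Icc 0 R :=
              ⟨hz1, hI0 hz1, hlt.le.trans ((le_abs_self _).trans hz2)⟩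
            rw [← ENNReal.toReal_mul, ← toReal_enorm]
            refine ENNReal.toReal_mono (ENNReal.mul_ne_top hz.ne
              (ne_top_of_le_ne_top hB (hB1 _))) ?_
            refine (propForm_energy _ ((tst_cutFn hI mf n).good _) (hG.good _)).trans ?_
            rw [hA, Set.indicator_of_mem hm]
            exact mul_le_mul_left (nr_mono two_pos (enorm_cutFn_le n z.1)) _
          · rw [tform_eq_zero_right (fun x => hR _ x (not_le.1 hz2)), norm_zero]
            exact hnn
        · rw [tform_eq_zero_left (fun x => cutFn_of_notMem hz1 n x), norm_zero]
          exact hnn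
      · rw [Set.indicator_of_notMem hb, norm_zero]
        exact hnn
    · filter_upwards [hAe] with z hz
      by_cases hb : z ∈ band (Set.Iio (0 : ℝ))
      · simp only [Set.indicator_of_mem hb]
        have hlt : z.1 < z.2 := by
          have : z.1 - z.2 < 0 := hb
          linarith
        by_cases hz2 : z.2 ∈ I ∧ |z.2| ≤ R
        · by_cases hz0 : 0 ≤ z.1
          · have hr : z ∈ duhamelRegion := ⟨hz0, hlt⟩
            have hz1 : z.1 ∈ I := hord.out h0 hz2.1 ⟨hz0, hlt.le⟩
            have hm : z.1 ∈ I ∩ Set.Icc 0 R :=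
              ⟨hz1, hz0, hlt.le.trans ((le_abs_self _).trans hz2.2)⟩
            rw [Set.indicator_of_mem hr]
            have h2 : MemLp (f z.1) 2 := by
              refine ⟨mf.of_uncurry_left.aestronglyMeasurable, ?_⟩
              rwa [hA, Set.indicator_of_mem hm, nr_two] at hz
            exact tendsto_propForm (ki z.1) h2 (hG.good z.2)
              (fun n => (tst_cutFn hI mf n).good z.1)
              (tendsto_eLpNorm_cutFn_sub hI mf hz1 h2) _
          · have hr : z ∉ duhamelRegion := fun h => hz0 h.1
            rw [Set.indicator_of_notMem hr]
            refine tendsto_const_nhds.congr fun n => ?_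
            exact (tform_eq_zero_left (fun x => cutFn_of_notMem (fun h => hz0 (hI0 h)) n x) _).symm
        · have hGz : ∀ x, G z.2 x = 0 := by
            intro x
            by_cases h : z.2 ∈ I
            · exact hR _ x (not_le.1 fun h' => hz2 ⟨h, h'⟩)
            · exact hG0 _ h x
          have e : duhamelRegion.indicator (Function.uncurry (duhamelForm κ k G)) z = 0 := by
            have : G z.2 = 0 := funext hGz
            refine Set.indicator_apply_eq_zero.2 fun _ => ?_
            simp [Function.uncurry, duhamelForm, this, fourier_zero_fun]
          rw [e]
          refine tendsto_const_nhds.congr fun n => ?_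
          exact (tform_eq_zero_right hGz _).symm
      · have hr : z ∉ duhamelRegion := fun h => hb (by
          show z.1 - z.2 < 0
          linarith [h.2])
        simp only [Set.indicator_of_notMem hb, Set.indicator_of_notMem hr]
        exact tendsto_const_nhds
  refine le_of_tendsto lim.enorm (Eventually.of_forall fun n => ?_)
  rw [mul_assoc]
  exact (hC _ G (tst_cutFn hI mf n) hG).trans
    (mul_le_mul_right (mul_le_mul_left (hfn n) _) _)

end Plate

namespace Plate

open FourierTransform
open scoped ComplexConjugate Topology

variable {d : ℕ} {I : Set ℝ} {h₀ h₁ : Ed d → ℂ} {k : ℝ → Ed d → ℂ} {Q p Q' p' κ : ℝ}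
  {maj : Ed d → ℝ}

/-- Free evolution on the frequency side with phase `κ`. -/
def freeEvol (κ : ℝ) (h : Ed d → ℂ) (t : ℝ) (η : Ed d) : ℂ :=
  cexp (Complex.I * (κ * t * ‖η‖ ^ 2 : ℝ)) * h η

/-- The frequency-side plate solution as a combination of half-waves. -/
def plateFreq (κ : ℝ) (h₀ h₁ : Ed d → ℂ) (k : ℝ → Ed d → ℂ) (t : ℝ) (η : Ed d) : ℂ :=
  (1 / 2 * freeEvol κ h₀ t η + 1 / 2 * freeEvol (-κ) h₀ t η)
    + (-Complex.I / 2 * freeEvol κ h₁ t η + Complex.I / 2 * freeEvol (-κ) h₁ t η)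
    + (-Complex.I / 2 * duhamel (-κ) k t η + Complex.I / 2 * duhamel κ k t η)

lemma fam_plateFreq (i₀ : Integrable h₀) (m₀ : Measurable h₀) (i₁ : Integrable h₁)
    (m₁ : Measurable h₁) (mk : Measurable (Function.uncurry k)) (hmaj : Integrable maj)
    (hk : ∀ σ η, ‖k σ η‖ ≤ maj η) (κ : ℝ) : Fam (plateFreq κ h₀ h₁ k) :=
  ((((fam_exp_mul i₀ m₀ κ).const_mul _).add ((fam_exp_mul i₀ m₀ (-κ)).const_mul _)).add
    (((fam_exp_mul i₁ m₁ κ).const_mul _).add ((fam_exp_mul i₁ m₁ (-κ)).const_mul _))).add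
    (((fam_duhamel mk hmaj hk (-κ)).const_mul _).add ((fam_duhamel mk hmaj hk κ).const_mul _))

theorem exists_freqBound_plateFreq (hd : 1 ≤ d) (h : DualAdm d Q p) (h' : DualAdm d Q' p')
    (hκ : Real.pi ≤ |κ|) :
    ∃ C : ℝ≥0∞, C ≠ ∞ ∧ ∀ I : Set ℝ, MeasurableSet I → I.OrdConnected → (0 : ℝ) ∈ I →
      I ⊆ Set.Ici 0 → ∀ (h₀ h₁ : Ed d → ℂ) (k : ℝ → Ed d → ℂ) (maj : Ed d → ℝ),
      Integrable h₀ → Measurable h₀ → Integrable h₁ → Measurable h₁ →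
      Measurable (Function.uncurry k) → Integrable maj → (∀ σ η, ‖k σ η‖ ≤ maj η) →
      (∫⁻ σ in I, nr p' (𝓕⁻ (k σ)) ^ Q') ^ (1 / Q') ≠ ∞ →
      FreqBound I (plateFreq κ h₀ h₁ k) Q p (C * (eLpNorm h₀ 2 volume + eLpNorm h₁ 2 volume
        + (∫⁻ σ in I, nr p' (𝓕⁻ (k σ)) ^ Q') ^ (1 / Q'))) := by
  obtain ⟨C, hC, H⟩ := h.energyBound hd
  obtain ⟨D, hD, K⟩ := exists_retarded hd h' h
  refine ⟨C + C + (D + D), by simp [hC, hD], fun I hI hord h0 hI0 h₀ h₁ k maj i₀ m₀ i₁ m₁ mk hmaj hk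
    hN => ?_⟩
  have hκ' : Real.pi ≤ |-κ| := by rwa [abs_neg]
  have hκ'' : Real.pi ≤ |- -κ| := by rwa [neg_neg]
  have n1 : ‖(1 / 2 : ℂ)‖ ≤ 1 := by norm_num
  have n2 : ‖-Complex.I / 2‖ ≤ 1 := by norm_num
  have n3 : ‖Complex.I / 2‖ ≤ 1 := by norm_num
  have f₀ := fam_exp_mul i₀ m₀
  have f₁ := fam_exp_mul i₁ m₁
  have fk := fam_duhamel mk hmaj hk
  have b₀ := (((freqBound_exp_mul (I := I) i₀ m₀ (H _ hκ')).const_mul n1).add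
    ((freqBound_exp_mul (I := I) i₀ m₀ (H _ hκ'')).const_mul n1)
    ((f₀ _).const_mul _) ((f₀ _).const_mul _))
  have b₁ := (((freqBound_exp_mul (I := I) i₁ m₁ (H _ hκ')).const_mul n2).add
    ((freqBound_exp_mul (I := I) i₁ m₁ (H _ hκ'')).const_mul n3)
    ((f₁ _).const_mul _) ((f₁ _).const_mul _))
  have hp : 0 < p' := by linarith [h'.one_le']
  have bk := ((freqBound_duhamel hI hord h0 hI0 mk hmaj hk hp h'.le_two' h'.one_le le_rfl hN
      (K _ hκ')).const_mul n2).add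
    ((freqBound_duhamel hI hord h0 hI0 mk hmaj hk hp h'.le_two' h'.one_le le_rfl hN
      (K _ hκ)).const_mul n3) ((fk _).const_mul _) ((fk _).const_mul _)
  have b := (b₀.add b₁ (((f₀ _).const_mul _).add ((f₀ _).const_mul _))
    (((f₁ _).const_mul _).add ((f₁ _).const_mul _))).add bk
    ((((f₀ _).const_mul _).add ((f₀ _).const_mul _)).add
      (((f₁ _).const_mul _).add ((f₁ _).const_mul _)))
    (((fk _).const_mul _).add ((fk _).const_mul _))
  intro G hG hG0
  refine (b G hG hG0).trans (mul_le_mul_left ?_ _)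
  set a₀ := eLpNorm h₀ 2 volume
  set a₁ := eLpNorm h₁ 2 volume
  set N := (∫⁻ σ in I, nr p' (𝓕⁻ (k σ)) ^ Q') ^ (1 / Q')
  calc a₀ * C + a₀ * C + (a₁ * C + a₁ * C) + (D * N + D * N)
      = (C + C) * (a₀ + a₁) + (D + D) * N := by ring
    _ ≤ (C + C + (D + D)) * (a₀ + a₁) + (C + C + (D + D)) * N := by
        exact add_le_add (mul_le_mul_left le_self_add _) (mul_le_mul_left le_add_self _)
    _ = _ := by ring

lemma plateFreq_eq (mk : Measurable (Function.uncurry k)) (hk : ∀ σ η, ‖k σ η‖ ≤ maj η) (κ t : ℝ)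
    (η : Ed d) : plateFreq κ h₀ h₁ k t η
      = (Real.cos (κ * t * ‖η‖ ^ 2) : ℝ) * h₀ η + (Real.sin (κ * t * ‖η‖ ^ 2) : ℝ) * h₁ η
        + ∫ σ in Set.Ico 0 t, (Real.sin (κ * (t - σ) * ‖η‖ ^ 2) : ℝ) * k σ η := by
  have hi : ∀ κ : ℝ, IntegrableOn
      (fun σ => cexp (Complex.I * (κ * (σ - t) * ‖η‖ ^ 2 : ℝ)) * k σ η) (Set.Ico 0 t) := by
    intro κ
    refine Integrable.mono' (g := fun _ => maj η) (by simp) ?_ (ae_of_all _ fun σ => ?_)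
    · have a : Measurable fun σ : ℝ => cexp (Complex.I * (κ * (σ - t) * ‖η‖ ^ 2 : ℝ)) := by
        refine Continuous.measurable ?_
        fun_prop
      exact (a.mul (mk.comp (by fun_prop : Measurable fun σ : ℝ => (σ, η)))).aestronglyMeasurable
    · rw [norm_mul, norm_exp_I_mul, one_mul]
      exact hk σ η
  have e : ∀ x : ℝ, cexp (Complex.I * (x : ℂ)) = Complex.cos x + Complex.sin x * Complex.I := by
    intro x
    rw [mul_comm, Complex.exp_mul_I]
  have e' : ∀ x : ℝ, cexp (Complex.I * -(x : ℂ))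
      = Complex.cos x - Complex.sin x * Complex.I := by
    intro x
    rw [← ofReal_neg, e, ofReal_neg, Complex.cos_neg, Complex.sin_neg]
    ring
  have hI2 : Complex.I * Complex.I = -1 := Complex.I_mul_I
  have e3 : -Complex.I / 2 * duhamel (-κ) k t η + Complex.I / 2 * duhamel κ k t η
      = ∫ σ in Set.Ico 0 t, (Real.sin (κ * (t - σ) * ‖η‖ ^ 2) : ℝ) * k σ η := by
    rw [duhamel, duhamel, ← integral_const_mul, ← integral_const_mul,
      ← integral_add ((hi _).const_mul _) ((hi _).const_mul _)]
    refine integral_congr_ae (ae_of_all _ fun σ => ?_)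
    have h1 : -κ * (σ - t) * ‖η‖ ^ 2 = κ * (t - σ) * ‖η‖ ^ 2 := by ring
    have h2 : κ * (σ - t) * ‖η‖ ^ 2 = -(κ * (t - σ) * ‖η‖ ^ 2) := by ring
    simp only [h1, h2, e, e', ofReal_neg, ofReal_sin]
    linear_combination (-(Complex.sin ((κ * (t - σ) * ‖η‖ ^ 2 : ℝ) : ℂ)) * k σ η) * hI2
  rw [plateFreq, e3]
  congr 1
  have h2 : -κ * t * ‖η‖ ^ 2 = -(κ * t * ‖η‖ ^ 2) := by ring
  simp only [freeEvol, h2, e, e', ofReal_neg, ofReal_sin, ofReal_cos]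
  linear_combination (-(Complex.sin ((κ * t * ‖η‖ ^ 2 : ℝ) : ℂ)) * h₁ η) * hI2

end Plate

namespace Plate

open FourierTransform

variable {d : ℕ} {I : Set ℝ} {q r q' : ℝ≥0∞} {m : ℝ → Ed d → ℂ} {A : ℝ≥0∞}

/-- The conjugate exponent, as a real number. -/
def dualExp (q : ℝ≥0∞) : ℝ := (1 - (q⁻¹).toReal)⁻¹

lemma dualExp_top : dualExp ∞ = 1 := by simp [dualExp]

lemma inv_toReal_le_half (hq : 2 ≤ q) : (q⁻¹).toReal ≤ 1 / 2 := by
  have h := ENNReal.toReal_mono (by simp) (ENNReal.inv_le_inv.2 hq)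
  simpa using h

lemma dualExp_eq_div (hq : 2 ≤ q) (hq' : q ≠ ∞) : dualExp q = q.toReal / (q.toReal - 1) := by
  have h2 : 2 ≤ q.toReal := by simpa using ENNReal.toReal_mono hq' hq
  have : q.toReal - 1 ≠ 0 := by linarith
  rw [dualExp, ENNReal.toReal_inv]
  have h0 : q.toReal ≠ 0 := by linarith
  field_simp

lemma one_le_dualExp (hq : 2 ≤ q) : 1 ≤ dualExp q := by
  have := inv_toReal_le_half hq
  have := ENNReal.toReal_nonneg (a := q⁻¹)
  exact (one_le_inv₀ (by linarith)).2 (by linarith)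

lemma dualExp_le_two (hq : 2 ≤ q) : dualExp q ≤ 2 := by
  have := inv_toReal_le_half hq
  rw [dualExp, inv_le_comm₀ (by linarith) two_pos]
  linarith

lemma eq_ofReal_dualExp (hq : 2 ≤ q) (h : 1 / q + 1 / q' = 1) :
    q' = ENNReal.ofReal (dualExp q) := by
  rw [one_div, one_div] at h
  have h1 : q'⁻¹ ≠ ∞ := by
    rintro h'
    simp [h'] at h
  have h2 : q⁻¹ ≠ ∞ := by
    rintro h'
    simp [h'] at h
  have h3 : (q'⁻¹).toReal = 1 - (q⁻¹).toReal := by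
    have := congrArg ENNReal.toReal h
    rw [ENNReal.toReal_add h2 h1, ENNReal.toReal_one] at this
    linarith
  have := inv_toReal_le_half hq
  rw [dualExp, ← h3, ENNReal.ofReal_inv_of_pos (by linarith), ENNReal.ofReal_toReal h1, inv_inv]

lemma scaling_toReal (hr : 2 ≤ r) (hq : 2 ≤ q) (h : 2 / q + d / r = (d : ℝ≥0∞) / 2) :
    2 * (q⁻¹).toReal + d * (r⁻¹).toReal = (d : ℝ) / 2 := by
  have h1 : ∀ x : ℝ≥0∞, 2 ≤ x → x⁻¹ ≠ ∞ := fun x hx =>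
    ENNReal.inv_ne_top.2 (zero_lt_two.trans_le hx).ne'
  have := congrArg ENNReal.toReal h
  rw [div_eq_mul_inv, div_eq_mul_inv, ENNReal.toReal_add (ENNReal.mul_ne_top (by simp) (h1 q hq))
    (ENNReal.mul_ne_top (by simp) (h1 r hr)), ENNReal.toReal_mul, ENNReal.toReal_mul] at this
  simpa using this

lemma eq_top_of_inv_toReal (hq : 2 ≤ q) (h : (q⁻¹).toReal = 0) : q = ∞ := by
  rcases (ENNReal.toReal_eq_zero_iff _).1 h with h | h
  · exact ENNReal.inv_eq_zero.1 h
  · have := ENNReal.inv_eq_top.1 h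
    rw [this] at hq
    simp at hq

lemma eq_two_of_inv_toReal (h : (q⁻¹).toReal = 1 / 2) : q = 2 := by
  have h1 : q⁻¹ ≠ ∞ := by
    intro h'
    norm_num [h'] at h
  have : q⁻¹ = 2⁻¹ := by
    rw [← ENNReal.toReal_eq_toReal_iff' h1 (by simp), h]
    simp
  exact inv_injective this

lemma dualAdm_of_admissible (h : Admissible d q r) : DualAdm d (dualExp q) (dualExp r) := by
  obtain ⟨hq, hr, hs, hn⟩ := h
  refine ⟨one_le_dualExp hq, dualExp_le_two hq, one_le_dualExp hr, dualExp_le_two hr, ?_, ?_⟩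
  · have := scaling_toReal hr hq hs
    simp only [dualExp, div_inv_eq_mul]
    linarith
  · rintro ⟨h1, h2, h3⟩
    refine hn ⟨eq_two_of_inv_toReal ?_, eq_top_of_inv_toReal hr ?_, h3⟩
    · rw [dualExp, inv_eq_iff_eq_inv] at h1
      linarith
    · rw [dualExp, inv_eq_iff_eq_inv, inv_one] at h2
      linarith

lemma mixedNorm_fourierInv_le (hd : 1 ≤ d) (h : Admissible d q r) (hI : MeasurableSet I)
    (hm : Fam m) (hb : FreqBound I m (dualExp q) (dualExp r) A) :
    mixedNorm q I (fun t => eLpNorm (𝓕⁻ (m t)) r volume) ≤ A := by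
  obtain ⟨hq, hr, hs, hn⟩ := h
  have hs' := scaling_toReal hr hq hs
  have hd' : (0 : ℝ) < d := by exact_mod_cast hd
  have mw := hm.measurable_fourierInv
  have hpb := hb.pairBound hm
  have one_lt : q ≠ ∞ → 1 < q.toReal := fun h => by
    have : 2 ≤ q.toReal := by simpa using ENNReal.toReal_mono h hq
    linarith
  by_cases hq' : q = ∞
  · subst hq'
    have : r = 2 := by
      refine eq_two_of_inv_toReal ?_
      simp only [ENNReal.inv_top, ENNReal.toReal_zero, mul_zero, zero_add] at hs'
      field_simp at hs'
      linarith
    subst this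
    have e2 : dualExp 2 = 2 := by norm_num [dualExp]
    rw [dualExp_top, e2] at hpb
    rw [mixedNorm, if_pos rfl]
    simp only [← nr_two]
    exact essSup_le_of_ae_le _ (hpb.ae_le hI mw)
  rw [mixedNorm, if_neg hq']
  rw [dualExp_eq_div hq hq'] at hpb
  by_cases hr' : r = ∞
  · subst hr'
    rw [dualExp_top] at hpb
    exact hpb.eLpNorm_top_le hI mw (one_lt hq')
  · rw [dualExp_eq_div hr hr'] at hpb
    have h2 : 2 ≤ r.toReal := by simpa using ENNReal.toReal_mono hr' hr
    have := hpb.nrT_le hI mw (one_lt hq') h2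
    simpa only [nr_eq_eLpNorm (zero_lt_two.trans_le h2), ENNReal.ofReal_toReal hr'] using this

end Plate

namespace Plate

open FourierTransform

variable {d : ℕ}

lemma integrable_decay {n : ℕ} (hn : d < n) :
    Integrable fun x : Ed d => (1 + ‖x‖) ^ (-(n : ℝ)) := by
  refine integrable_one_add_norm ?_
  rw [finrank_euclideanSpace, Fintype.card_fin]
  exact_mod_cast hn

lemma exists_fourier_decay (d n : ℕ) (B : ℝ) : ∃ C : ℝ, ∀ f : Ed d → ℂ, ContDiff ℝ (n : ℕ∞) f →
    (∀ j ≤ n, ∀ x, ‖iteratedFDeriv ℝ j f x‖ ≤ B * (1 + ‖x‖) ^ (-((d + 1 : ℕ) : ℝ))) →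
    ∀ η, ‖𝓕 f η‖ ≤ C * (1 + ‖η‖) ^ (-(n : ℝ)) := by
  set J : ℝ := ∫ x : Ed d, B * (1 + ‖x‖) ^ (-((d + 1 : ℕ) : ℝ)) with hJ
  refine ⟨2 ^ n * (J + 2 ^ n * ((n + 1) * J)), fun f hf hb η => ?_⟩
  have hi : Integrable fun x : Ed d => B * (1 + ‖x‖) ^ (-((d + 1 : ℕ) : ℝ)) :=
    (integrable_decay (Nat.lt_succ_self d)).const_mul B
  have hji : ∀ j ≤ n, Integrable fun x => ‖iteratedFDeriv ℝ j f x‖ := by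
    intro j hj
    refine hi.mono' ?_ (ae_of_all _ fun x => by rw [norm_norm]; exact hb j hj x)
    exact (hf.continuous_iteratedFDeriv (by exact_mod_cast hj)).norm.aestronglyMeasurable
  have hjb : ∀ j ≤ n, ∫ x, ‖iteratedFDeriv ℝ j f x‖ ≤ J := fun j hj =>
    integral_mono (hji j hj) hi (hb j hj)
  have h1 : ‖𝓕 f η‖ ≤ J := by
    refine (norm_fourier_le f η).trans (le_trans (le_of_eq ?_) (hjb 0 (Nat.zero_le n)))
    simp only [norm_iteratedFDeriv_zero]
  have h2 : ‖η‖ ^ n * ‖𝓕 f η‖ ≤ 2 ^ n * ((n + 1) * J) := by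
    have := Real.pow_mul_norm_iteratedFDeriv_fourier_le (K := 0) (N := n) (k := 0) (n := n) hf
      (fun k j hk hj => by
        have : k = 0 := by simpa using hk
        simpa [this] using hji j (by exact_mod_cast hj)) le_rfl le_rfl η
    simp only [norm_iteratedFDeriv_zero] at this
    refine this.trans ?_
    rw [Finset.sum_product]
    simp only [pow_zero, CharP.cast_eq_zero, mul_zero, zero_add, one_mul, Finset.range_one,
      Finset.sum_singleton]
    refine mul_le_mul_of_nonneg_left ?_ (by positivity)
    refine (Finset.sum_le_card_nsmul _ _ J fun j hj =>
      hjb j (Nat.lt_succ_iff.1 (Finset.mem_range.1 hj))).trans (le_of_eq ?_)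
    simp
  rw [Real.rpow_neg (by positivity), ← div_eq_mul_inv, le_div_iff₀ (by positivity),
    Real.rpow_natCast, mul_comm]
  have h3 : (1 + ‖η‖) ^ n ≤ 2 ^ n * (1 + ‖η‖ ^ n) := by
    rcases le_total ‖η‖ 1 with h | h
    · calc (1 + ‖η‖) ^ n ≤ 2 ^ n := pow_le_pow_left₀ (by positivity) (by linarith) n
        _ ≤ _ := le_mul_of_one_le_right (by positivity) (by linarith [pow_nonneg (norm_nonneg η) n])
    · calc (1 + ‖η‖) ^ n ≤ (2 * ‖η‖) ^ n := pow_le_pow_left₀ (by positivity) (by linarith) n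
        _ = 2 ^ n * ‖η‖ ^ n := mul_pow _ _ _
        _ ≤ _ := by gcongr; linarith
  calc (1 + ‖η‖) ^ n * ‖𝓕 f η‖ ≤ 2 ^ n * (1 + ‖η‖ ^ n) * ‖𝓕 f η‖ := by gcongr
    _ = 2 ^ n * (‖𝓕 f η‖ + ‖η‖ ^ n * ‖𝓕 f η‖) := by ring
    _ ≤ 2 ^ n * (J + 2 ^ n * ((n + 1) * J)) := by
      have : (1 : ℝ) ≤ 2 ^ n := one_le_pow₀ one_le_two
      gcongr

lemma exists_iteratedFDeriv_decay {E : Type*} [NormedAddCommGroup E] [NormedSpace ℝ E]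
    (u : SchwartzMap E ℂ) (m n : ℕ) : ∃ B : ℝ, 0 ≤ B ∧ ∀ j ≤ n, ∀ x,
      ‖iteratedFDeriv ℝ j u x‖ ≤ B * (1 + ‖x‖) ^ (-(m : ℝ)) := by
  refine ⟨2 ^ m * (Finset.Iic (m, n)).sup (fun m => SchwartzMap.seminorm ℝ m.1 m.2) u,
    mul_nonneg (by positivity) (apply_nonneg _ _), fun j hj x => ?_⟩
  rw [Real.rpow_neg (by positivity), ← div_eq_mul_inv, le_div_iff₀ (by positivity),
    Real.rpow_natCast, mul_comm]
  exact SchwartzMap.one_add_le_sup_seminorm_apply (𝕜 := ℝ) (m := (m, n)) le_rfl hj u x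

lemma exists_fourier_schwartz_decay (u : SchwartzMap (Ed d) ℂ) (n : ℕ) :
    ∃ C : ℝ, ∀ η, ‖𝓕 (fun x => u x) η‖ ≤ C * (1 + ‖η‖) ^ (-(n : ℝ)) := by
  obtain ⟨B, -, hB⟩ := exists_iteratedFDeriv_decay u (d + 1) n
  obtain ⟨C, hC⟩ := exists_fourier_decay d n B
  exact ⟨C, hC _ (u.smooth _) hB⟩

lemma exists_fourier_slice_decay (F : SchwartzMap (ℝ × Ed d) ℂ) (n : ℕ) :
    ∃ C : ℝ, ∀ σ η, ‖𝓕 (fun x => F (σ, x)) η‖ ≤ C * (1 + ‖η‖) ^ (-(n : ℝ)) := by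
  obtain ⟨B, hB0, hB⟩ := exists_iteratedFDeriv_decay F (d + 1) n
  obtain ⟨C, hC⟩ := exists_fourier_decay d n B
  refine ⟨C, fun σ => hC _ ((F.smooth n).comp (by fun_prop)) fun j hj x => ?_⟩
  set L := ContinuousLinearMap.inr ℝ ℝ (Ed d) with hL
  have e : (fun x => F (σ, x)) = (fun z => F ((σ, 0) + z)) ∘ L := by
    ext x
    simp [hL]
  have hs : ContDiff ℝ (n : ℕ∞) fun z => F ((σ, 0) + z) := (F.smooth n).comp (by fun_prop)
  rw [e, L.iteratedFDeriv_comp_right hs x (i := j) (by exact_mod_cast hj),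
    iteratedFDeriv_comp_add_left]
  have hLn : ‖L‖ ≤ 1 := ContinuousLinearMap.opNorm_le_bound _ zero_le_one fun x => by
    simp [hL, Prod.norm_def]
  refine (ContinuousMultilinearMap.norm_compContinuousLinearMap_le _ _).trans ?_
  rw [Finset.prod_const]
  refine (mul_le_of_le_one_right (norm_nonneg _) (pow_le_one₀ (norm_nonneg _) hLn)).trans ?_
  refine (hB j hj _).trans (mul_le_mul_of_nonneg_left ?_ hB0)
  refine Real.rpow_le_rpow_of_nonpos (by positivity) ?_ (neg_nonpos.2 (Nat.cast_nonneg _))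
  have : ‖x‖ ≤ ‖((σ, 0) + L x : ℝ × Ed d)‖ := by
    simp [hL, Prod.norm_def]
  linarith

lemma integrable_weight (hd : 1 ≤ d) {a : ℝ} (ha : -(d : ℝ) < a) {n : ℕ} (hn : a + d < n) :
    Integrable fun η : Ed d => ‖η‖ ^ a * (1 + ‖η‖) ^ (-(n : ℝ)) := by
  have : Nonempty (Fin d) := ⟨⟨0, hd⟩⟩
  have hm : Measurable fun y : ℝ => y ^ (d - 1) • (y ^ a * (1 + y) ^ (-(n : ℝ))) := by fun_prop
  have e : ∀ y : ℝ, 0 < y → y ^ (d - 1) • (y ^ a * (1 + y) ^ (-(n : ℝ)))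
      = y ^ (a + d - 1) * (1 + y) ^ (-(n : ℝ)) := by
    intro y hy
    rw [smul_eq_mul, ← mul_assoc, ← Real.rpow_natCast, ← Real.rpow_add hy, Nat.cast_sub hd,
      Nat.cast_one]
    congr 2
    ring
  refine (integrable_fun_norm_addHaar (volume : Measure (Ed d))
    (f := fun y : ℝ => y ^ a * (1 + y) ^ (-(n : ℝ)))).2 ?_
  rw [finrank_euclideanSpace, Fintype.card_fin, ← Set.Ioc_union_Ioi_eq_Ioi zero_le_one]
  refine IntegrableOn.union ?_ ?_
  · have h := (intervalIntegral.intervalIntegrable_rpow' (a := 0) (b := 1)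
      (r := a + d - 1) (by linarith)).1
    refine Integrable.mono' h hm.aestronglyMeasurable
      ((ae_restrict_iff' measurableSet_Ioc).2 (ae_of_all _ fun y hy => ?_))
    have hy0 : 0 < y := hy.1
    rw [e y hy0, Real.norm_of_nonneg (by positivity)]
    exact mul_le_of_le_one_right (by positivity)
      (Real.rpow_le_one_of_one_le_of_nonpos (by linarith) (by simp))
  · have h := integrableOn_Ioi_rpow_of_lt (a := a + d - 1 + -(n : ℝ)) (by linarith) one_pos
    refine Integrable.mono' h hm.aestronglyMeasurable
      ((ae_restrict_iff' measurableSet_Ioi).2 (ae_of_all _ fun y hy => ?_))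
    have hy0 : 0 < y := one_pos.trans hy
    rw [e y hy0, Real.norm_of_nonneg (by positivity), Real.rpow_add hy0]
    refine mul_le_mul_of_nonneg_left ?_ (by positivity)
    exact Real.rpow_le_rpow_of_nonpos hy0 (by linarith) (by simp)

end Plate

namespace Plate

open FourierTransform

variable {d : ℕ} {f₀ f₁ : Ed d → ℂ} {g : ℝ → Ed d → ℂ} {maj : Ed d → ℝ}

lemma FT_two_pi_smul (f : Ed d → ℂ) (η : Ed d) : FT d f ((2 * Real.pi) • η) = 𝓕 f η := by
  rw [FT, Real.fourier_eq']
  refine integral_congr_ae (ae_of_all _ fun x => ?_)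
  simp only [smul_eq_mul, inner_smul_right]
  congr 2
  push_cast
  ring

lemma FTinv_eq_fourierInv (g : Ed d → ℂ) :
    FTinv d g = 𝓕⁻ fun η => g ((2 * Real.pi) • η) := by
  ext x
  have h := Measure.integral_comp_smul (volume : Measure (Ed d))
    (fun ξ => cexp (Complex.I * (⟪x, ξ⟫ : ℝ)) * g ξ) (2 * Real.pi)
  rw [finrank_euclideanSpace, Fintype.card_fin, abs_of_nonneg (by positivity)] at h
  rw [FTinv, Real.fourierInv_eq', ← Complex.ofReal_inv, ← Complex.real_smul, ← h]
  refine integral_congr_ae (ae_of_all _ fun ξ => ?_)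
  simp only [smul_eq_mul, inner_smul_right]
  congr 2
  rw [real_inner_comm]
  push_cast
  ring

lemma FTinv_radial_mul_FT (φ : ℝ → ℝ) (f : Ed d → ℂ) :
    FTinv d (fun ξ => (φ ‖ξ‖ : ℂ) * FT d f ξ)
      = 𝓕⁻ fun η => (φ (2 * Real.pi * ‖η‖) : ℂ) * 𝓕 f η := by
  rw [FTinv_eq_fourierInv]
  simp only [FT_two_pi_smul, norm_smul, norm_mul, Real.norm_ofNat,
    Real.norm_of_nonneg Real.pi_pos.le]

lemma rieszD_eq (s : ℝ) (f : Ed d → ℂ) :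
    rieszD d s f = 𝓕⁻ fun η => (((2 * Real.pi * ‖η‖) ^ s : ℝ) : ℂ) * 𝓕 f η :=
  FTinv_radial_mul_FT (fun ρ => ρ ^ s) f

lemma cosLap_eq (t : ℝ) (f : Ed d → ℂ) :
    cosLap d t f = 𝓕⁻ fun η => (Real.cos (t * (2 * Real.pi * ‖η‖) ^ 2) : ℂ) * 𝓕 f η :=
  FTinv_radial_mul_FT (fun ρ => Real.cos (t * ρ ^ 2)) f

/-- The symbol of `sin(τΔ)/Δ` in the normalisation of Mathlib's Fourier transform. -/
def sincSymbol (τ : ℝ) (η : Ed d) : ℝ :=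
  Real.sin (τ * (2 * Real.pi * ‖η‖) ^ 2) / (2 * Real.pi * ‖η‖) ^ 2

lemma sinLapDivLap_eq (t : ℝ) (f : Ed d → ℂ) :
    sinLapDivLap d t f = 𝓕⁻ fun η => (sincSymbol t η : ℂ) * 𝓕 f η :=
  FTinv_radial_mul_FT (fun ρ => Real.sin (t * ρ ^ 2) / ρ ^ 2) f

lemma abs_sincSymbol_le (τ : ℝ) (η : Ed d) : |sincSymbol τ η| ≤ |τ| := by
  rw [sincSymbol, abs_div, abs_of_nonneg (sq_nonneg (2 * Real.pi * ‖η‖))]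
  refine div_le_of_le_mul₀ (by positivity) (abs_nonneg _) ?_
  refine Real.abs_sin_le_abs.trans ?_
  rw [abs_mul, abs_of_nonneg (sq_nonneg (2 * Real.pi * ‖η‖))]

lemma measurable_sincSymbol : Measurable fun z : ℝ × Ed d => sincSymbol z.1 z.2 := by
  unfold sincSymbol
  fun_prop

/-- The spatial Fourier transform of the Duhamel solution of the plate equation. -/
def solFreq (f₀ f₁ : Ed d → ℂ) (g : ℝ → Ed d → ℂ) (t : ℝ) (η : Ed d) : ℂ :=
  (Real.cos (t * (2 * Real.pi * ‖η‖) ^ 2) : ℂ) * f₀ η + (sincSymbol t η : ℂ) * f₁ η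
    + ∫ σ in Set.Ico 0 t, (sincSymbol (t - σ) η : ℂ) * g σ η

lemma integrable_cos_mul (h : Integrable f₀) (t : ℝ) :
    Integrable fun η => (Real.cos (t * (2 * Real.pi * ‖η‖) ^ 2) : ℂ) * f₀ η := by
  refine h.bdd_mul (c := 1) ?_ (ae_of_all _ fun η => ?_)
  · refine Continuous.aestronglyMeasurable ?_
    fun_prop
  · rw [Complex.norm_real]
    exact Real.abs_cos_le_one _

lemma integrable_sinc_mul (h : Integrable f₁) (t : ℝ) :
    Integrable fun η => (sincSymbol t η : ℂ) * f₁ η := by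
  refine h.bdd_mul (c := |t|) ?_ (ae_of_all _ fun η => ?_)
  · have := (measurable_sincSymbol (d := d)).comp (measurable_prodMk_left (x := t))
    exact (Complex.measurable_ofReal.comp this).aestronglyMeasurable
  · rw [Complex.norm_real]
    exact abs_sincSymbol_le _ _

lemma integrable_sinc_duhamel (mg : Measurable (Function.uncurry g)) (hmaj : Integrable maj)
    (hg : ∀ σ η, ‖g σ η‖ ≤ maj η) (t : ℝ) :
    Integrable (fun z : ℝ × Ed d => (sincSymbol (t - z.1) z.2 : ℂ) * g z.1 z.2)
      ((volume.restrict (Set.Ico 0 t)).prod volume) := by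
  have hm : Measurable fun z : ℝ × Ed d => (sincSymbol (t - z.1) z.2 : ℂ) * g z.1 z.2 := by
    refine Measurable.mul ?_ mg
    refine Complex.measurable_ofReal.comp
      (measurable_sincSymbol.comp (g := fun z : ℝ × Ed d => sincSymbol z.1 z.2)
        (f := fun z : ℝ × Ed d => (t - z.1, z.2)) ?_)
    fun_prop
  have hi : Integrable (fun z : ℝ × Ed d => |t| * maj z.2)
      ((volume.restrict (Set.Ico 0 t)).prod volume) := (hmaj.comp_snd _).const_mul _
  refine hi.mono' hm.aestronglyMeasurable ?_
  have : ∀ᵐ z : ℝ × Ed d ∂((volume.restrict (Set.Ico 0 t)).prod volume), z.1 ∈ Set.Ico 0 t :=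
    Measure.quasiMeasurePreserving_fst.ae (ae_restrict_mem measurableSet_Ico)
  filter_upwards [this] with z hz
  rw [norm_mul, Complex.norm_real]
  refine mul_le_mul ((abs_sincSymbol_le _ _).trans ?_) (hg _ _) (norm_nonneg _) (abs_nonneg _)
  rw [abs_of_nonneg (by linarith [hz.2]), abs_of_nonneg (by linarith [hz.1, hz.2])]
  linarith [hz.1]

lemma integrable_solFreq (i₀ : Integrable f₀) (i₁ : Integrable f₁)
    (mg : Measurable (Function.uncurry g)) (hmaj : Integrable maj)
    (hg : ∀ σ η, ‖g σ η‖ ≤ maj η) (t : ℝ) : Integrable (solFreq f₀ f₁ g t) :=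
  ((integrable_cos_mul i₀ t).add (integrable_sinc_mul i₁ t)).add
    (integrable_sinc_duhamel mg hmaj hg t).integral_prod_right

lemma integrable_fourierInv_kernel {f : Ed d → ℂ} (hf : Integrable f) (x : Ed d) :
    Integrable fun η => cexp ((2 * Real.pi * ⟪η, x⟫ : ℝ) * Complex.I) • f η := by
  refine hf.bdd_mul (c := 1) (Continuous.aestronglyMeasurable (by fun_prop)) (ae_of_all _ fun η => ?_)
  rw [Complex.norm_exp_ofReal_mul_I]

lemma fourierInv_solFreq (i₀ : Integrable f₀) (i₁ : Integrable f₁)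
    (mg : Measurable (Function.uncurry g)) (hmaj : Integrable maj)
    (hg : ∀ σ η, ‖g σ η‖ ≤ maj η) {t : ℝ} (ht : 0 ≤ t) (x : Ed d) :
    𝓕⁻ (solFreq f₀ f₁ g t) x
      = 𝓕⁻ (fun η => (Real.cos (t * (2 * Real.pi * ‖η‖) ^ 2) : ℂ) * f₀ η) x
        + 𝓕⁻ (fun η => (sincSymbol t η : ℂ) * f₁ η) x
        + ∫ σ in (0:ℝ)..t, 𝓕⁻ (fun η => (sincSymbol (t - σ) η : ℂ) * g σ η) x := by
  have H := integrable_sinc_duhamel mg hmaj hg t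
  have a := integrable_fourierInv_kernel (integrable_cos_mul i₀ t) x
  have b := integrable_fourierInv_kernel (integrable_sinc_mul i₁ t) x
  have c := integrable_fourierInv_kernel H.integral_prod_right x
  rw [intervalIntegral.integral_of_le ht, ← integral_Ico_eq_integral_Ioc]
  simp only [Real.fourierInv_eq']
  rw [integral_integral_swap]
  · simp only [integral_smul, solFreq, smul_add]
    rw [← integral_add a b]
    exact integral_add (a.add b) c
  · refine H.bdd_mul (c := 1) (Continuous.aestronglyMeasurable (by fun_prop))
      (ae_of_all _ fun z => ?_)
    rw [Complex.norm_exp_ofReal_mul_I]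

lemma fourier_eq_zero_of_not_integrable {f : Ed d → ℂ} (hf : ¬ Integrable f) : 𝓕 f = 0 := by
  ext η
  rw [Real.fourier_eq]
  exact integral_undef fun h => hf ((Real.fourierIntegral_convergent_iff η).1 h)

end Plate

namespace Plate

open FourierTransform

variable {d : ℕ} {f₀ f₁ : Ed d → ℂ} {g : ℝ → Ed d → ℂ} {maj : Ed d → ℝ}

/-- The weight `|ξ|^a` in the normalisation of Mathlib's Fourier transform, applied to `f`. -/
def rieszMul (a : ℝ) (f : Ed d → ℂ) (η : Ed d) : ℂ :=
  (((2 * Real.pi * ‖η‖) ^ a : ℝ) : ℂ) * f η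

lemma measurable_rieszWeight (a : ℝ) : Measurable fun η : Ed d => (2 * Real.pi * ‖η‖) ^ a := by
  fun_prop

lemma rieszMul_solFreq {s : ℝ} (mk : Measurable (Function.uncurry fun σ => rieszMul (s - 2) (g σ)))
    (hk : ∀ σ η, ‖rieszMul (s - 2) (g σ) η‖ ≤ maj η) (t : ℝ) {η : Ed d} (hη : η ≠ 0) :
    rieszMul s (solFreq f₀ f₁ g t) η
      = plateFreq ((2 * Real.pi) ^ 2) (rieszMul s f₀) (rieszMul (s - 2) f₁)
        (fun σ => rieszMul (s - 2) (g σ)) t η := by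
  have hρ : 0 < 2 * Real.pi * ‖η‖ := mul_pos (by positivity) (norm_pos_iff.2 hη)
  have key : ∀ τ : ℝ, ((2 * Real.pi * ‖η‖) ^ s) * sincSymbol τ η
      = Real.sin ((2 * Real.pi) ^ 2 * τ * ‖η‖ ^ 2) * (2 * Real.pi * ‖η‖) ^ (s - 2) := by
    intro τ
    have : (2 * Real.pi * ‖η‖) ^ (s - 2) = (2 * Real.pi * ‖η‖) ^ s / (2 * Real.pi * ‖η‖) ^ 2 := by
      rw [Real.rpow_sub hρ, ← Real.rpow_natCast (2 * Real.pi * ‖η‖) 2, Nat.cast_ofNat]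
    rw [this, sincSymbol, show τ * (2 * Real.pi * ‖η‖) ^ 2 = (2 * Real.pi) ^ 2 * τ * ‖η‖ ^ 2 by ring]
    ring
  have key' : ∀ (τ : ℝ) (z : ℂ), (((2 * Real.pi * ‖η‖) ^ s : ℝ) : ℂ) * ((sincSymbol τ η : ℂ) * z)
      = (Real.sin ((2 * Real.pi) ^ 2 * τ * ‖η‖ ^ 2) : ℝ)
        * ((((2 * Real.pi * ‖η‖) ^ (s - 2) : ℝ) : ℂ) * z) := by
    intro τ z
    rw [← mul_assoc, ← mul_assoc, ← Complex.ofReal_mul, ← Complex.ofReal_mul, key]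
  rw [plateFreq_eq mk hk]
  simp only [rieszMul, solFreq]
  rw [mul_add, mul_add, key', ← integral_const_mul]
  simp only [key']
  rw [show t * (2 * Real.pi * ‖η‖) ^ 2 = (2 * Real.pi) ^ 2 * t * ‖η‖ ^ 2 by ring]
  congr 2
  ring

lemma sobNorm_fourierInv_solFreq_le {s : ℝ} {r : ℝ≥0∞} {t : ℝ} (hd : 1 ≤ d)
    (hi : Integrable (solFreq f₀ f₁ g t))
    (mk : Measurable (Function.uncurry fun σ => rieszMul (s - 2) (g σ)))
    (hk : ∀ σ η, ‖rieszMul (s - 2) (g σ) η‖ ≤ maj η) :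
    sobNorm d s r (𝓕⁻ (solFreq f₀ f₁ g t)) ≤ eLpNorm (𝓕⁻ (plateFreq ((2 * Real.pi) ^ 2)
      (rieszMul s f₀) (rieszMul (s - 2) f₁) (fun σ => rieszMul (s - 2) (g σ)) t)) r volume := by
  rw [sobNorm, rieszD_eq]
  by_cases hu : Integrable (𝓕⁻ (solFreq f₀ f₁ g t))
  · refine le_of_eq ?_
    congr 1
    ext x
    have : Nonempty (Fin d) := ⟨⟨0, hd⟩⟩
    refine Real.fourierInv_congr_ae ?_ x
    filter_upwards [fourier_fourierInv_ae hi hu, compl_mem_ae_iff.2 (measure_singleton (0 : Ed d))]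
      with η h1 h2
    rw [h1]
    exact rieszMul_solFreq mk hk t h2
  · have : (𝓕⁻ fun η : Ed d => (((2 * Real.pi * ‖η‖) ^ s : ℝ) : ℂ)
        * 𝓕 (𝓕⁻ (solFreq f₀ f₁ g t)) η) = 0 := by
      rw [fourier_eq_zero_of_not_integrable hu, fourierInv_eq_fourier_neg']
      simp only [Pi.zero_apply, mul_zero]
      ext x
      exact congrFun fourier_zero_fun (-x)
    rw [this, eLpNorm_zero]
    exact zero_le

lemma norm_rieszMul_le {a C : ℝ} {n : ℕ} {f : Ed d → ℂ}
    (hf : ∀ η, ‖f η‖ ≤ C * (1 + ‖η‖) ^ (-(n : ℝ))) (η : Ed d) :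
    ‖rieszMul a f η‖ ≤ (2 * Real.pi) ^ a * C * (‖η‖ ^ a * (1 + ‖η‖) ^ (-(n : ℝ))) := by
  rw [rieszMul, norm_mul, Complex.norm_real, Real.norm_of_nonneg (by positivity),
    Real.mul_rpow (by positivity) (norm_nonneg _)]
  calc _ ≤ (2 * Real.pi) ^ a * ‖η‖ ^ a * (C * (1 + ‖η‖) ^ (-(n : ℝ))) :=
        mul_le_mul_of_nonneg_left (hf η) (by positivity)
    _ = _ := by ring

lemma measurable_rieszMul (a : ℝ) {f : Ed d → ℂ} (hf : Measurable f) :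
    Measurable (rieszMul a f) :=
  (Complex.measurable_ofReal.comp (measurable_rieszWeight a)).mul hf

lemma integrable_rieszMul (hd : 1 ≤ d) {a C : ℝ} {n : ℕ} {f : Ed d → ℂ} (ha : -(d : ℝ) < a)
    (hn : a + d < n) (mf : Measurable f) (hf : ∀ η, ‖f η‖ ≤ C * (1 + ‖η‖) ^ (-(n : ℝ))) :
    Integrable (rieszMul a f) :=
  ((integrable_weight hd ha hn).const_mul _).mono' (measurable_rieszMul a mf).aestronglyMeasurable
    (ae_of_all _ (norm_rieszMul_le hf))

lemma mixedNorm_mono {q : ℝ≥0∞} {I : Set ℝ} {φ ψ : ℝ → ℝ≥0∞} (hI : MeasurableSet I)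
    (h : ∀ t ∈ I, φ t ≤ ψ t) : mixedNorm q I φ ≤ mixedNorm q I ψ := by
  rw [mixedNorm, mixedNorm]
  split_ifs
  · exact essSup_mono_ae ((ae_restrict_iff' hI).2 (ae_of_all _ h))
  · exact ENNReal.rpow_le_rpow (setLIntegral_mono' hI fun t ht =>
      ENNReal.rpow_le_rpow (h t ht) ENNReal.toReal_nonneg) (by positivity)

lemma mixedNorm_ofReal {Q p : ℝ} (hQ : 0 < Q) (hp : 0 < p) (I : Set ℝ) (v : ℝ → Ed d → ℂ) :
    mixedNorm (ENNReal.ofReal Q) I (fun σ => eLpNorm (v σ) (ENNReal.ofReal p) volume)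
      = (∫⁻ σ in I, nr p (v σ) ^ Q) ^ (1 / Q) := by
  simp only [mixedNorm, if_neg ENNReal.ofReal_ne_top, ENNReal.toReal_ofReal hQ.le,
    nr_eq_eLpNorm hp]

end Plate

open FourierTransform Plate

/-- Strichartz estimates for the vibrating plate equation.
For `d ≥ 1`, `s - 2 > -d` and admissible pairs `(q,r)`, `(q̃,r̃)`, there is `C > 0`,
independent of the interval, such that for every interval `I ⊆ [0,∞)` containing `0`,
all Schwartz `u₀, u₁` and every Schwartz `F` on `ℝ × ℝ^d`, the Duhamel solution
`u(t,·) = cos(tΔ)u₀ + (sin(tΔ)/Δ)u₁ + ∫₀ᵗ (sin((t-σ)Δ)/Δ) F(σ,·) dσ` of the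
vibrating plate equation `∂ₜ²u + Δ²u = F`, `u(0) = u₀`, `∂ₜu(0) = u₁`, satisfies
`‖u‖_{L^q_I Ẇ^{s,r}} ≤ C(‖u₀‖_{Ḣ^s} + ‖u₁‖_{Ḣ^{s-2}} + ‖F‖_{L^{q̃'}_I Ẇ^{s-2,r̃'}})`. -/
theorem strichartz_plate
    (d : ℕ) (hd : 1 ≤ d) (s : ℝ) (hs : -(d : ℝ) < s - 2)
    (q r qt rt qt' rt' : ℝ≥0∞)
    (hadm : Admissible d q r) (hadmt : Admissible d qt rt)
    (hqt' : 1 / qt + 1 / qt' = 1) (hrt' : 1 / rt + 1 / rt' = 1) :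
    ∃ C : ℝ, 0 < C ∧
      ∀ I : Set ℝ, I.OrdConnected → I ⊆ Set.Ici (0 : ℝ) → (0 : ℝ) ∈ I →
        ∀ u₀ u₁ : SchwartzMap (Ed d) ℂ, ∀ F : SchwartzMap (ℝ × Ed d) ℂ,
          mixedNorm q I (fun t => sobNorm d s r
              (fun x => cosLap d t (fun y => u₀ y) x + sinLapDivLap d t (fun y => u₁ y) x +
                ∫ σ in (0:ℝ)..t, sinLapDivLap d (t - σ) (fun y => F (σ, y)) x)) ≤
            ENNReal.ofReal C *
              (sobNorm d s 2 (fun x => u₀ x) + sobNorm d (s - 2) 2 (fun x => u₁ x) +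
                mixedNorm qt' I (fun σ => sobNorm d (s - 2) rt' (fun y => F (σ, y)))) := by
  have hq' := eq_ofReal_dualExp hadmt.1 hqt'
  have hr' := eq_ofReal_dualExp hadmt.2.1 hrt'
  have hQ : 0 < dualExp qt := one_pos.trans_le (one_le_dualExp hadmt.1)
  have hp : 0 < dualExp rt := one_pos.trans_le (one_le_dualExp hadmt.2.1)
  have hπ : Real.pi ≤ |(2 * Real.pi) ^ 2| := by
    rw [abs_of_nonneg (by positivity)]
    nlinarith [Real.pi_gt_three]
  obtain ⟨C, hC, hmain⟩ := exists_freqBound_plateFreq hd (dualAdm_of_admissible hadm)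
    (dualAdm_of_admissible hadmt) hπ
  refine ⟨C.toReal + 1, by positivity, fun I hI hI0 h0I u₀ u₁ F => ?_⟩
  have hCle : C ≤ ENNReal.ofReal (C.toReal + 1) := by
    rw [ENNReal.le_ofReal_iff_toReal_le hC (by positivity)]
    linarith
  have hIm := hI.measurableSet
  obtain ⟨n, hn⟩ := exists_nat_gt (|s| + d)
  have hd0 : (1 : ℝ) ≤ d := by exact_mod_cast hd
  have hn0 : d < n := by exact_mod_cast (by linarith [abs_nonneg s] : (d : ℝ) < n)
  have hns : s + d < n := by linarith [le_abs_self s]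
  have hns' : s - 2 + d < n := by linarith
  obtain ⟨C₀, hC₀⟩ := exists_fourier_schwartz_decay u₀ n
  obtain ⟨C₁, hC₁⟩ := exists_fourier_schwartz_decay u₁ n
  obtain ⟨C₂, hC₂⟩ := exists_fourier_slice_decay F n
  have m₀ : Measurable (𝓕 fun x => u₀ x) := (continuous_fourier u₀.integrable).measurable
  have m₁ : Measurable (𝓕 fun x => u₁ x) := (continuous_fourier u₁.integrable).measurable
  have mF : Measurable (Function.uncurry fun σ => 𝓕 fun x => F (σ, x)) :=
    (stronglyMeasurable_fourier (G := fun σ x => F (σ, x))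
      (by exact F.continuous.measurable)).measurable
  have i₀ := integrable_rieszMul hd (by linarith) hns m₀ hC₀
  have i₁ := integrable_rieszMul hd hs hns' m₁ hC₁
  have mk : Measurable (Function.uncurry fun σ => rieszMul (s - 2) (𝓕 fun x => F (σ, x))) :=
    (Complex.measurable_ofReal.comp ((measurable_rieszWeight (s - 2)).comp measurable_snd)).mul mF
  have hmaj := (integrable_weight hd hs hns').const_mul ((2 * Real.pi) ^ (s - 2) * C₂)
  have hk := fun σ => norm_rieszMul_le (a := s - 2) (hC₂ σ)
  have hw := integrable_decay hn0
  have j₀ : Integrable (𝓕 fun x => u₀ x) :=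
    (hw.const_mul C₀).mono' m₀.aestronglyMeasurable (ae_of_all _ hC₀)
  have j₁ : Integrable (𝓕 fun x => u₁ x) :=
    (hw.const_mul C₁).mono' m₁.aestronglyMeasurable (ae_of_all _ hC₁)
  have hN : mixedNorm qt' I (fun σ => sobNorm d (s - 2) rt' (fun y => F (σ, y)))
      = (∫⁻ σ in I, nr (dualExp rt) (𝓕⁻ (rieszMul (s - 2) (𝓕 fun x => F (σ, x)))) ^ dualExp qt)
        ^ (1 / dualExp qt) := by
    rw [hq', hr', ← mixedNorm_ofReal hQ hp]
    simp only [sobNorm, rieszD_eq]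
    rfl
  rw [hN]
  set N := (∫⁻ σ in I, nr (dualExp rt) (𝓕⁻ (rieszMul (s - 2) (𝓕 fun x => F (σ, x)))) ^ dualExp qt)
    ^ (1 / dualExp qt) with hNdef
  by_cases hfin : N = ∞
  · rw [hfin, add_top, ENNReal.mul_top (by simpa using by positivity)]
    exact le_top
  have hfb := hmain I hIm hI h0I hI0 _ _ _ _ i₀ (measurable_rieszMul s m₀) i₁
    (measurable_rieszMul (s - 2) m₁) mk hmaj hk hfin
  have hfam := fam_plateFreq i₀ (measurable_rieszMul s m₀) i₁ (measurable_rieszMul (s - 2) m₁) mk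
    hmaj hk ((2 * Real.pi) ^ 2)
  have hsol : ∀ t ∈ I, (fun x => cosLap d t (fun y => u₀ y) x + sinLapDivLap d t (fun y => u₁ y) x
      + ∫ σ in (0:ℝ)..t, sinLapDivLap d (t - σ) (fun y => F (σ, y)) x)
      = 𝓕⁻ (solFreq (𝓕 fun x => u₀ x) (𝓕 fun x => u₁ x) (fun σ => 𝓕 fun x => F (σ, x)) t) := by
    intro t ht
    ext x
    rw [fourierInv_solFreq j₀ j₁ mF (hw.const_mul C₂) hC₂ (hI0 ht) x]
    simp only [cosLap_eq, sinLapDivLap_eq]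
  refine (mixedNorm_mono hIm fun t ht => ?_).trans
    ((mixedNorm_fourierInv_le hd hadm hIm hfam hfb).trans (mul_le_mul' hCle ?_))
  · rw [hsol t ht]
    exact sobNorm_fourierInv_solFreq_le hd
      (integrable_solFreq j₀ j₁ mF (hw.const_mul C₂) hC₂ t) mk hk
  · refine add_le_add (add_le_add ?_ ?_) le_rfl
    · rw [sobNorm, rieszD_eq]
      exact eLpNorm_le_fourierInv i₀
    · rw [sobNorm, rieszD_eq]
      exact eLpNorm_le_fourierInv i₁
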